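/- arXiv:2510.05404 — 12 statements merged into one kernel-verified Lean document; each statement's English description precedes it below -/
import Mathlib

section
/- Let G be a finite connected vertex-transitive simple graph with at least 3 vertices. Then every path in G of length at most 4 closes to a cycle, i.e., for every path P in G with at most 4 edges there exists a cycle C in G such that every edge of P is an edge of C. -/
open SimpleGraph

/-- A walk `P` (typically a path) in `G` *closes to a cycle* if there is a cycle `C` in `G`
such that every edge of `P` is an edge of `C`. -/
def ClosesToCycle {V : Type*} (G : SimpleGraph V) {u v : V} (P : G.Walk u v) : Prop :=
  ∃ (w : V) (C : G.Walk w w), C.IsCycle ∧ ∀ e ∈ P.edges, e ∈ C.edges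

/-- A walk is *induced* if any two of its vertices that are adjacent in `G` are consecutive
on the walk, i.e. the corresponding edge is an edge of the walk. -/
def InducedWalk {V : Type*} (G : SimpleGraph V) {u v : V} (P : G.Walk u v) : Prop :=
  ∀ x ∈ P.support, ∀ y ∈ P.support, G.Adj x y → s(x, y) ∈ P.edges

/-- An induced path `P` *closes to an induced cycle* if there is an induced cycle `C` in `G`
such that every vertex of `P` is a vertex of `C` and every edge of `P` is an edge of `C`. -/
def ClosesToInducedCycle {V : Type*} (G : SimpleGraph V) {u v : V} (P : G.Walk u v) : Prop :=
  ∃ (w : V) (C : G.Walk w w), C.IsCycle ∧ InducedWalk G C ∧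
    (∀ x ∈ P.support, x ∈ C.support) ∧ (∀ e ∈ P.edges, e ∈ C.edges)

/-- `G` is vertex-transitive. -/
def VertexTransitive {V : Type*} (G : SimpleGraph V) : Prop :=
  ∀ u v : V, ∃ φ : G ≃g G, φ u = v

/-- `G` is edge-transitive. -/
def EdgeTransitive {V : Type*} (G : SimpleGraph V) : Prop :=
  ∀ e ∈ G.edgeSet, ∀ f ∈ G.edgeSet, ∃ φ : G ≃g G, Sym2.map φ e = f

/-- A path whose ends are joined by a walk avoiding its inner vertices closes to a cycle. -/
lemma SimpleGraph.Walk.IsPath.closesToCycle_of_walk {V : Type*} {G : SimpleGraph V}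
    {u v : V} {P : G.Walk u v} (hP : P.IsPath) (hlen : 1 < P.length) (Q : G.Walk v u)
    (hQ : ∀ x ∈ Q.support, x ∈ P.support → x = u ∨ x = v) : ClosesToCycle G P := by
  classical
  refine ⟨u, P.append Q.bypass, hP.isCycle_append Q.bypass_isPath ?_ (Or.inl hlen), ?_⟩
  · have hu : u ∉ P.support.tail := by
      have := hP.support_nodup
      rw [← Walk.cons_tail_support, List.nodup_cons] at this
      exact this.1
    have hv : v ∉ Q.bypass.support.tail := by
      have := Q.bypass_isPath.support_nodup
      rw [← Walk.cons_tail_support, List.nodup_cons] at this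
      exact this.1
    intro x hxP hxQ
    obtain rfl | rfl := hQ x (Q.support_bypass_subset_support (List.mem_of_mem_tail hxQ))
      (List.mem_of_mem_tail hxP)
    · exact hu hxP
    · exact hv hxQ
  · intro e he
    simp [he]

section Fragments

open Finset
open scoped Classical

variable {V : Type*} [Fintype V] {G : SimpleGraph V}

/-- The vertices outside `F` having a neighbour in `F`. -/
noncomputable def outerBoundary (G : SimpleGraph V) (F : Finset V) : Finset V :=
  {v | v ∉ F ∧ ∃ u ∈ F, G.Adj u v}

lemma mem_outerBoundary {F : Finset V} {v : V} :
    v ∈ outerBoundary G F ↔ v ∉ F ∧ ∃ u ∈ F, G.Adj u v := by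
  simp [outerBoundary]

lemma mem_outerBoundary_singleton {u v : V} : v ∈ outerBoundary G {u} ↔ G.Adj u v := by
  simp only [mem_outerBoundary, mem_singleton, exists_eq_left, and_iff_right_iff_imp]
  exact fun h => h.ne.symm

/-- The vertices neither in `F` nor adjacent to a vertex of `F`. -/
noncomputable def farSide (G : SimpleGraph V) (F : Finset V) : Finset V :=
  {v | v ∉ F ∧ v ∉ outerBoundary G F}

lemma mem_farSide {F : Finset V} {v : V} :
    v ∈ farSide G F ↔ v ∉ F ∧ v ∉ outerBoundary G F := by
  simp [farSide]

/-- `F` is separated by its outer boundary from a nonempty set of vertices. -/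
def IsSeparated (G : SimpleGraph V) (F : Finset V) : Prop :=
  F.Nonempty ∧ (farSide G F).Nonempty

/-- A separated set whose outer boundary is as small as possible. -/
def IsFragment (G : SimpleGraph V) (F : Finset V) : Prop :=
  IsSeparated G F ∧
    ∀ B, IsSeparated G B → (outerBoundary G F).card ≤ (outerBoundary G B).card

/-- A fragment of minimum cardinality. -/
def IsAtomicFragment (G : SimpleGraph V) (A : Finset V) : Prop :=
  IsFragment G A ∧ ∀ B, IsFragment G B → A.card ≤ B.card

lemma exists_isAtomicFragment {F : Finset V} (hF : IsSeparated G F) :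
    ∃ A, IsAtomicFragment G A := by
  obtain ⟨B, hB, hBmin⟩ := exists_min_image ({F | IsSeparated G F} : Finset (Finset V))
    (fun F => (outerBoundary G F).card) ⟨F, by simpa using hF⟩
  have hB' : IsFragment G B := ⟨by simpa using hB, fun C hC => hBmin C (by simpa using hC)⟩
  obtain ⟨A, hA, hAmin⟩ := exists_min_image ({F | IsFragment G F} : Finset (Finset V))
    Finset.card ⟨B, by simpa using hB'⟩
  exact ⟨A, by simpa using hA, fun C hC => hAmin C (by simpa using hC)⟩

lemma IsFragment.card_outerBoundary_eq {F F' : Finset V} (hF : IsFragment G F)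
    (hF' : IsFragment G F') : (outerBoundary G F).card = (outerBoundary G F').card :=
  le_antisymm (hF.2 _ hF'.1) (hF'.2 _ hF.1)

lemma IsAtomicFragment.card_eq {A B : Finset V} (hA : IsAtomicFragment G A)
    (hB : IsAtomicFragment G B) : A.card = B.card :=
  le_antisymm (hA.2 _ hB.1) (hB.2 _ hA.1)

lemma outerBoundary_map (φ : G ≃g G) (F : Finset V) :
    outerBoundary G (F.map φ.toEquiv.toEmbedding) =
      (outerBoundary G F).map φ.toEquiv.toEmbedding := by
  ext v
  obtain ⟨w, rfl⟩ := φ.surjective v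
  have key : ∀ (S : Finset V) (x : V), φ x ∈ S.map φ.toEquiv.toEmbedding ↔ x ∈ S :=
    fun _ _ => mem_map' φ.toEquiv.toEmbedding
  rw [key, mem_outerBoundary, mem_outerBoundary, key]
  refine and_congr_right fun _ => ⟨?_, ?_⟩
  · rintro ⟨u, hu, h⟩
    obtain ⟨u, rfl⟩ := φ.surjective u
    exact ⟨u, (key _ _).1 hu, φ.map_adj_iff.1 h⟩
  · rintro ⟨u, hu, h⟩
    exact ⟨φ u, (key _ _).2 hu, φ.map_adj_iff.2 h⟩

lemma IsSeparated.map (φ : G ≃g G) {F : Finset V} (hF : IsSeparated G F) :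
    IsSeparated G (F.map φ.toEquiv.toEmbedding) := by
  obtain ⟨hne, x, hx⟩ := hF
  rw [mem_farSide] at hx
  refine ⟨hne.map, φ x, ?_⟩
  rw [mem_farSide, outerBoundary_map]
  exact hx.imp (mt (mem_map' φ.toEquiv.toEmbedding).1) (mt (mem_map' φ.toEquiv.toEmbedding).1)

lemma IsAtomicFragment.map (φ : G ≃g G) {A : Finset V} (hA : IsAtomicFragment G A) :
    IsAtomicFragment G (A.map φ.toEquiv.toEmbedding) := by
  refine ⟨⟨hA.1.1.map φ, fun B hB => ?_⟩, fun B hB => ?_⟩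
  · rw [outerBoundary_map, card_map]
    exact hA.1.2 B hB
  · rw [card_map]
    exact hA.2 B hB

lemma VertexTransitive.exists_isAtomicFragment_mem (hvt : VertexTransitive G) {A : Finset V}
    (hA : IsAtomicFragment G A) (v : V) : ∃ B, IsAtomicFragment G B ∧ v ∈ B := by
  obtain ⟨a, ha⟩ := hA.1.1.1
  obtain ⟨φ, rfl⟩ := hvt a v
  exact ⟨_, hA.map φ, (mem_map' φ.toEquiv.toEmbedding).2 ha⟩

lemma VertexTransitive.card_outerBoundary_singleton (hvt : VertexTransitive G) (u v : V) :
    (outerBoundary G {u}).card = (outerBoundary G {v}).card := by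
  obtain ⟨φ, rfl⟩ := hvt u v
  have := outerBoundary_map φ {u}
  rw [map_singleton] at this
  exact (congrArg Finset.card this).trans (card_map _) |>.symm

lemma card_outerBoundary_inter_add_union_le (A B : Finset V) :
    (outerBoundary G (A ∩ B)).card + (outerBoundary G (A ∪ B)).card ≤
      (outerBoundary G A).card + (outerBoundary G B).card := by
  rw [← card_union_add_card_inter, ← card_union_add_card_inter (outerBoundary G A)]
  refine Nat.add_le_add (card_le_card fun x => ?_) (card_le_card fun x => ?_) <;>
  · simp only [mem_union, mem_inter, mem_outerBoundary]
    grind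

lemma outerBoundary_farSide_subset (F : Finset V) :
    outerBoundary G (farSide G F) ⊆ outerBoundary G F := by
  intro x hx
  obtain ⟨hx, y, hy, hyx⟩ := mem_outerBoundary.1 hx
  rw [mem_farSide] at hx hy
  by_contra h
  refine hy.2 (mem_outerBoundary.2 ⟨hy.1, x, ?_, hyx.symm⟩)
  tauto

lemma isFragment_farSide {F : Finset V} (hF : IsFragment G F) : IsFragment G (farSide G F) := by
  obtain ⟨⟨⟨x, hx⟩, hne⟩, hmin⟩ := hF
  refine ⟨⟨hne, x, ?_⟩, fun B hB =>
    (card_le_card (outerBoundary_farSide_subset F)).trans (hmin B hB)⟩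
  rw [mem_farSide]
  refine ⟨fun h => (mem_farSide.1 h).1 hx, fun h => ?_⟩
  exact (mem_outerBoundary.1 (outerBoundary_farSide_subset F h)).1 hx

lemma IsAtomicFragment.subset_of_inter_nonempty {A F : Finset V} (hA : IsAtomicFragment G A)
    (hF : IsFragment G F) (h : (A ∩ F).Nonempty) : A ⊆ F := by
  by_contra hAF
  have hlt : (A ∩ F).card < A.card := card_lt_card
    ⟨inter_subset_left, fun hs => hAF (hs.trans inter_subset_right)⟩
  have hsep : IsSeparated G (A ∩ F) := by
    obtain ⟨x, hx⟩ := hF.1.2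
    refine ⟨h, x, ?_⟩
    simp only [mem_farSide, mem_outerBoundary, mem_inter] at hx ⊢
    grind
  have hgt : (outerBoundary G A).card < (outerBoundary G (A ∩ F)).card := by
    by_contra! hle
    exact hlt.not_ge (hA.2 _ ⟨hsep, fun B hB => hle.trans (hA.1.2 B hB)⟩)
  have hsub := card_outerBoundary_inter_add_union_le (G := G) A F
  have heq := hA.1.card_outerBoundary_eq hF
  have hunion : ¬ IsSeparated G (A ∪ F) := fun hs => by
    have := hA.1.2 _ hs
    omega
  have hcover : ∀ x, x ∈ A ∪ F ∨ x ∈ outerBoundary G (A ∪ F) := by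
    intro x
    by_contra hx
    exact hunion ⟨hA.1.1.1.mono subset_union_left, x, mem_farSide.2 (by tauto)⟩
  have h1 : A.card ≤ (farSide G F).card := hA.2 _ (isFragment_farSide hF)
  have h2 : (farSide G F).card ≤
      (A ∩ farSide G F).card + (outerBoundary G A ∩ farSide G F).card := by
    refine (card_le_card fun x hx => ?_).trans (card_union_le _ _)
    have := hcover x
    simp only [mem_union, mem_inter, mem_farSide, mem_outerBoundary] at *
    grind
  have h3 : (outerBoundary G (A ∩ F)).card ≤
      (outerBoundary G A \ farSide G F).card + (A ∩ outerBoundary G F).card := by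
    refine (card_le_card fun x hx => ?_).trans (card_union_le _ _)
    simp only [mem_union, mem_inter, mem_sdiff, mem_farSide, mem_outerBoundary] at *
    grind
  have h4 := card_sdiff_add_card_inter (outerBoundary G A) (farSide G F)
  have h5 : (A ∩ F).card + (A ∩ outerBoundary G F).card + (A ∩ farSide G F).card ≤
      A.card := by
    rw [← card_union_of_disjoint, ← card_union_of_disjoint]
    · exact card_le_card (by grind)
    · rw [Finset.disjoint_left]
      intro x
      simp only [mem_union, mem_inter, mem_farSide]
      tauto
    · rw [Finset.disjoint_left]
      intro x
      simp only [mem_inter, mem_outerBoundary]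
      tauto
  have h6 := h.card_pos
  omega

lemma IsAtomicFragment.subset_outerBoundary {A F : Finset V} (hA : IsAtomicFragment G A)
    (hF : IsFragment G F) (h : (A ∩ outerBoundary G F).Nonempty) : A ⊆ outerBoundary G F := by
  obtain ⟨x, hx⟩ := h
  rw [mem_inter] at hx
  intro y hy
  by_contra hyF
  by_cases hy' : y ∈ F
  · exact (mem_outerBoundary.1 hx.2).1
      (hA.subset_of_inter_nonempty hF ⟨y, mem_inter.2 ⟨hy, hy'⟩⟩ hx.1)
  · have := hA.subset_of_inter_nonempty (isFragment_farSide hF)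
      ⟨y, mem_inter.2 ⟨hy, mem_farSide.2 ⟨hy', hyF⟩⟩⟩ hx.1
    exact (mem_farSide.1 this).2 hx.2

lemma IsAtomicFragment.eq_of_mem {A B : Finset V} (hA : IsAtomicFragment G A)
    (hB : IsAtomicFragment G B) {x : V} (hxA : x ∈ A) (hxB : x ∈ B) : A = B :=
  eq_of_subset_of_card_le (hA.subset_of_inter_nonempty hB.1 ⟨x, mem_inter.2 ⟨hxA, hxB⟩⟩)
    (hA.card_eq hB).ge

lemma SimpleGraph.Connected.eq_univ_of_outerBoundary_eq_empty (hconn : G.Connected)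
    {F : Finset V} (hne : F.Nonempty) (hF : outerBoundary G F = ∅) : F = univ := by
  obtain ⟨x, hx⟩ := hne
  refine eq_univ_of_forall fun y => ?_
  obtain ⟨p⟩ := hconn.preconnected x y
  induction p with
  | nil => exact hx
  | @cons a b _ h _ ih =>
    refine ih ?_
    by_contra hb
    have : b ∈ outerBoundary G F := mem_outerBoundary.2 ⟨hb, a, hx, h⟩
    simp [hF] at this

/-- In a connected vertex-transitive graph, every separator has at least four vertices or
at least as many vertices as the degree. -/
theorem VertexTransitive.four_le_or_card_le_card_outerBoundary (hvt : VertexTransitive G)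
    (hconn : G.Connected) {F : Finset V} (hF : IsSeparated G F) (v : V) :
    4 ≤ (outerBoundary G F).card ∨
      (outerBoundary G {v}).card ≤ (outerBoundary G F).card := by
  obtain ⟨A, hA⟩ := exists_isAtomicFragment hF
  suffices h : 4 ≤ (outerBoundary G A).card ∨
      (outerBoundary G {v}).card ≤ (outerBoundary G A).card from
    h.imp (·.trans (hA.1.2 F hF)) (·.trans (hA.1.2 F hF))
  obtain hA1 | hA2 : A.card = 1 ∨ 2 ≤ A.card := by
    have := hA.1.1.1.card_pos
    omega
  · obtain ⟨a, rfl⟩ := card_eq_one.1 hA1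
    exact Or.inr (hvt.card_outerBoundary_singleton v a).le
  left
  have hbdry : (outerBoundary G A).Nonempty := by
    rw [nonempty_iff_ne_empty]
    intro h
    obtain ⟨x, hx⟩ := hA.1.1.2
    rw [mem_farSide, hconn.eq_univ_of_outerBoundary_eq_empty hA.1.1.1 h] at hx
    exact hx.1 (mem_univ x)
  obtain ⟨b, hb⟩ := hbdry
  obtain ⟨B, hB, hbB⟩ := hvt.exists_isAtomicFragment_mem hA b
  have hBA : B ⊆ outerBoundary G A :=
    hB.subset_outerBoundary hA.1 ⟨b, mem_inter.2 ⟨hbB, hb⟩⟩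
  by_cases hAB : outerBoundary G A ⊆ B
  · exfalso
    obtain ⟨hbA, a, ha, hab⟩ := mem_outerBoundary.1 hb
    have haB : a ∉ B := fun h => (mem_outerBoundary.1 (hBA h)).1 ha
    have hAB' : A ⊆ outerBoundary G B := hA.subset_outerBoundary hB.1
      ⟨a, mem_inter.2 ⟨ha, mem_outerBoundary.2 ⟨haB, b, hbB, hab.symm⟩⟩⟩
    have hNA : outerBoundary G A = B := hAB.antisymm hBA
    have hNB : A = outerBoundary G B := by
      refine eq_of_subset_of_card_le hAB' ?_
      rw [hB.1.card_outerBoundary_eq hA.1, hNA, hA.card_eq hB]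
    have huniv : A ∪ B = univ := by
      refine hconn.eq_univ_of_outerBoundary_eq_empty (hA.1.1.1.mono subset_union_left) ?_
      ext x
      have h1 : x ∈ outerBoundary G A ↔ x ∈ B := by rw [hNA]
      have h2 : x ∈ outerBoundary G B ↔ x ∈ A := by rw [← hNB]
      simp only [mem_outerBoundary, mem_union, notMem_empty, iff_false] at h1 h2 ⊢
      grind
    obtain ⟨x, hx⟩ := hA.1.1.2
    rw [mem_farSide, hNA] at hx
    have : x ∈ A ∪ B := huniv ▸ mem_univ x
    rw [mem_union] at this
    tauto
  · obtain ⟨c, hc, hcB⟩ := not_subset.1 hAB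
    obtain ⟨C, hC, hcC⟩ := hvt.exists_isAtomicFragment_mem hA c
    have hCA : C ⊆ outerBoundary G A :=
      hC.subset_outerBoundary hA.1 ⟨c, mem_inter.2 ⟨hcC, hc⟩⟩
    have hdisj : Disjoint B C := Finset.disjoint_left.2 fun x hxB hxC =>
      hcB (hC.eq_of_mem hB hxC hxB ▸ hcC)
    have := card_le_card (union_subset hBA hCA)
    rw [card_union_of_disjoint hdisj, ← hA.card_eq hB, ← hA.card_eq hC] at this
    omega

/-- The inner vertices of a path that does not close to a cycle separate its ends. -/
lemma SimpleGraph.Walk.IsPath.exists_separation {u v : V} {P : G.Walk u v} (hP : P.IsPath)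
    (hlen : 1 < P.length) (hcyc : ¬ ClosesToCycle G P) :
    ∃ F F' : Finset V, u ∈ F ∧ v ∈ F' ∧ Disjoint F F' ∧
      (∀ x ∈ P.support, x ∈ F ∪ F' → x = u ∨ x = v) ∧
      (∀ x ∈ outerBoundary G F, x ∈ P.support ∧ x ≠ u ∧ x ≠ v) ∧
      ∀ x ∈ outerBoundary G F', x ∈ P.support ∧ x ≠ u ∧ x ≠ v := by
  let F : Finset V := {x | ∃ p : G.Walk x u, ∀ y ∈ p.support, y ∈ P.support → y = u ∨ y = v}
  have hF : ∀ x, x ∈ F ↔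
      ∃ p : G.Walk x u, ∀ y ∈ p.support, y ∈ P.support → y = u ∨ y = v := by
    simp [F]
  have hstep : ∀ x ∈ F, ∀ y, G.Adj x y → (y ∈ P.support → y = u ∨ y = v) → y ∈ F := by
    intro x hx y hxy hy
    obtain ⟨p, hp⟩ := (hF x).1 hx
    refine (hF y).2 ⟨.cons hxy.symm p, fun z hz => ?_⟩
    rw [Walk.support_cons, List.mem_cons] at hz
    obtain rfl | hz := hz
    · exact hy
    · exact hp z hz
  have hvF : v ∉ F := fun h => by
    obtain ⟨p, hp⟩ := (hF v).1 h
    exact hcyc (hP.closesToCycle_of_walk hlen p hp)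
  let F' : Finset V := {x | x ∉ F ∧ (x ∈ P.support → x = u ∨ x = v)}
  have hF' : ∀ x, x ∈ F' ↔ x ∉ F ∧ (x ∈ P.support → x = u ∨ x = v) := by
    simp [F']
  refine ⟨F, F', (hF u).2 ⟨.nil, by simp⟩, (hF' v).2 ⟨hvF, fun _ => Or.inr rfl⟩, ?_,
    fun x hxP hx => ?_, fun x hx => ?_, fun x hx => ?_⟩
  · rw [Finset.disjoint_left]
    exact fun x hx hx' => ((hF' x).1 hx').1 hx
  · obtain hx | hx := mem_union.1 hx
    · obtain ⟨p, hp⟩ := (hF x).1 hx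
      exact hp x p.start_mem_support hxP
    · exact ((hF' x).1 hx).2 hxP
  · obtain ⟨hx, y, hy, hyx⟩ := mem_outerBoundary.1 hx
    by_contra h
    exact hx (hstep y hy x hyx (by tauto))
  · obtain ⟨hx, y, hy, hyx⟩ := mem_outerBoundary.1 hx
    rw [hF'] at hx hy
    by_contra h
    exact hy.1 (hstep x (by tauto) y hyx.symm hy.2)

lemma card_le_card_outerBoundary_singleton {v : V} (s : Finset V) (h : ∀ x ∈ s, G.Adj v x) :
    s.card ≤ (outerBoundary G {v}).card :=
  card_le_card fun x hx => mem_outerBoundary_singleton.2 (h x hx)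

lemma VertexTransitive.closesToCycle_of_one_lt_length (hvt : VertexTransitive G)
    (hconn : G.Connected) {u v : V} {P : G.Walk u v} (hP : P.IsPath) (hlen : 1 < P.length)
    (hlen' : P.length ≤ 4) : ClosesToCycle G P := by
  by_contra hcyc
  obtain ⟨F, F', hu, hv, hdisj, hFP, hF, hF'⟩ := hP.exists_separation hlen hcyc
  rw [Finset.disjoint_left] at hdisj
  have hs := hvt.four_le_or_card_le_card_outerBoundary hconn (F := F)
    ⟨⟨u, hu⟩, v, mem_farSide.2 ⟨fun h => hdisj h hv, fun h => (hF v h).2.2 rfl⟩⟩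
  have hs' := hvt.four_le_or_card_le_card_outerBoundary hconn (F := F')
    ⟨⟨v, hv⟩, u, mem_farSide.2 ⟨hdisj hu, fun h => (hF' u h).2.1 rfl⟩⟩
  have hinner : ∀ z ∈ outerBoundary G F, ∃ x ∈ F, G.Adj z x := fun z hz => by
    obtain ⟨-, x, hx, h⟩ := mem_outerBoundary.1 hz
    exact ⟨x, hx, h.symm⟩
  have hinner' : ∀ z ∈ outerBoundary G F', ∃ x ∈ F', G.Adj z x := fun z hz => by
    obtain ⟨-, x, hx, h⟩ := mem_outerBoundary.1 hz
    exact ⟨x, hx, h.symm⟩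
  match P, hP, hlen, hlen' with
  | .cons (v := a) hua (.cons hav .nil), hP, _, _ =>
    simp only [Walk.isPath_def, Walk.support_cons, Walk.support_nil, List.nodup_cons,
      List.mem_cons, List.not_mem_nil, or_false, not_or, mem_union] at hP hF hF' hFP
    have hsub : outerBoundary G F ⊆ {a} := fun x hx => by
      have := hF x hx
      grind
    have hcard := card_le_card hsub
    have hdeg := card_le_card_outerBoundary_singleton (G := G) (v := a) {u, v}
      (by simp [hua.symm, hav])
    have := hs a
    grind
  | .cons (v := a) hua (.cons (v := b) hab (.cons hbv .nil)), hP, _, _ =>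
    simp only [Walk.isPath_def, Walk.support_cons, Walk.support_nil, List.nodup_cons,
      List.mem_cons, List.not_mem_nil, or_false, not_or, mem_union] at hP hF hF' hFP
    have hsub : outerBoundary G F ⊆ {a, b} := fun x hx => by
      have := hF x hx
      grind
    have hcard := card_le_card hsub
    have hcard2 : ({a, b} : Finset V).card = 2 := card_pair hab.ne
    have hdeg := card_le_card_outerBoundary_singleton (G := G) (v := a) {u, b}
      (by simp [hua.symm, hab])
    have hub : ({u, b} : Finset V).card = 2 := card_pair (by tauto)
    have hsa := hs a
    have heq := eq_of_subset_of_card_le hsub (by omega)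
    obtain ⟨x, hx, hbx⟩ := hinner b (by simp [heq])
    have hdeg' := card_le_card_outerBoundary_singleton (G := G) (v := b) {a, v, x}
      (by simp [hab.symm, hbv, hbx])
    have hthree : ({a, v, x} : Finset V).card = 3 := card_eq_three.2 ⟨a, v, x, by grind⟩
    have hsb := hs b
    omega
  | .cons (v := a) hua (.cons (v := b) hab (.cons (v := c) hbc (.cons hcv .nil))), hP, _, _ =>
    simp only [Walk.isPath_def, Walk.support_cons, Walk.support_nil, List.nodup_cons,
      List.mem_cons, List.not_mem_nil, or_false, not_or, mem_union] at hP hF hF' hFP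
    have hsub : outerBoundary G F ⊆ {a, b, c} := fun x hx => by
      have := hF x hx
      grind
    have hsub' : outerBoundary G F' ⊆ {a, b, c} := fun x hx => by
      have := hF' x hx
      grind
    have hcard := card_le_card hsub
    have hcard' := card_le_card hsub'
    have habc : ({a, b, c} : Finset V).card = 3 := card_eq_three.2 ⟨a, b, c, by grind⟩
    have hub : ({u, b} : Finset V).card = 2 := card_pair (by tauto)
    have hdeg := card_le_card_outerBoundary_singleton (G := G) (v := a) {u, b}
      (by simp [hua.symm, hab])
    have hab' := hvt.card_outerBoundary_singleton a b
    have hsa := hs a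
    have hsa' := hs' a
    by_cases hthree : 3 ≤ (outerBoundary G {a}).card
    · have heq := eq_of_subset_of_card_le hsub (by omega)
      have heq' := eq_of_subset_of_card_le hsub' (by omega)
      obtain ⟨x, hx, hbx⟩ := hinner b (by simp [heq])
      obtain ⟨y, hy, hby⟩ := hinner' b (by simp [heq'])
      have hdeg' := card_le_card_outerBoundary_singleton (G := G) (v := b) {a, c, x, y}
        (by simp [hab.symm, hbc, hbx, hby])
      have hfour : ({a, c, x, y} : Finset V).card = 4 := card_eq_four.2 ⟨a, c, x, y, by grind⟩
      omega
    · have hsingle : outerBoundary G F' ⊆ {c} := by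
        intro z hz
        obtain ⟨y, hy, hzy⟩ := hinner' z hz
        have hz' := hsub' hz
        simp only [mem_insert, mem_singleton] at hz' ⊢
        obtain rfl | rfl | rfl := hz'
        · have hdeg' := card_le_card_outerBoundary_singleton (G := G) (v := z) {u, b, y}
            (by simp [hua.symm, hab, hzy])
          have : ({u, b, y} : Finset V).card = 3 := card_eq_three.2 ⟨u, b, y, by grind⟩
          omega
        · have hdeg' := card_le_card_outerBoundary_singleton (G := G) (v := z) {a, c, y}
            (by simp [hab.symm, hbc, hzy])
          have : ({a, c, y} : Finset V).card = 3 := card_eq_three.2 ⟨a, c, y, by grind⟩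
          omega
        · rfl
      have := card_le_card hsingle
      rw [card_singleton] at this
      omega
  | .cons _ (.cons _ (.cons _ (.cons _ (.cons _ _)))), _, _, hlen' =>
    simp only [Walk.length_cons] at hlen'
    omega

/-- In a connected vertex-transitive graph on at least three vertices, the head of every edge
has a neighbour other than its tail. -/
lemma VertexTransitive.exists_adj_ne (hvt : VertexTransitive G) (hconn : G.Connected)
    (hcard : 3 ≤ Fintype.card V) {u v : V} (huv : G.Adj u v) : ∃ w, G.Adj v w ∧ w ≠ u := by
  by_contra! h
  have hv : outerBoundary G {v} = {u} := by
    ext w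
    rw [mem_outerBoundary_singleton, mem_singleton]
    exact ⟨h w, fun hw => hw ▸ huv.symm⟩
  have hu : outerBoundary G {u} = {v} := by
    have h1 := hvt.card_outerBoundary_singleton u v
    rw [hv, card_singleton] at h1
    obtain ⟨w, hw⟩ := card_eq_one.1 h1
    have : v ∈ outerBoundary G {u} := mem_outerBoundary_singleton.2 huv
    rw [hw, mem_singleton] at this
    rw [hw, this]
  have huniv : ({u, v} : Finset V) = univ := by
    refine hconn.eq_univ_of_outerBoundary_eq_empty (insert_nonempty _ _) ?_
    ext w
    have h1 : w ∈ outerBoundary G {u} ↔ w = v := by rw [hu, mem_singleton]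
    rw [mem_outerBoundary_singleton] at h1
    have h2 := h w
    simp only [mem_outerBoundary, mem_insert, mem_singleton, notMem_empty, iff_false]
    grind
  have := card_le_two (a := u) (b := v)
  rw [huniv, card_univ] at this
  omega

end Fragments

/-- In a finite connected vertex-transitive graph with at least 3 vertices,
every path of length at most 4 closes to a cycle. -/
theorem vertexTransitive_path_length_le_four_closesToCycle
    {V : Type*} [Fintype V] (G : SimpleGraph V)
    (hconn : G.Connected) (hcard : 3 ≤ Fintype.card V) (hvt : VertexTransitive G)
    {u v : V} (P : G.Walk u v) (hP : P.IsPath) (hlen : P.length ≤ 4) :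
    ClosesToCycle G P := by
  have hadj : ∀ {a b : V}, (h : G.Adj a b) → ClosesToCycle G h.toWalk := fun {a b} h => by
    obtain ⟨w, hbw, hne⟩ := hvt.exists_adj_ne hconn hcard h
    obtain ⟨x, C, hC, hsub⟩ := hvt.closesToCycle_of_one_lt_length hconn
      (P := .cons h hbw.toWalk) (by simp [Walk.isPath_def, h.ne, hne.symm, hbw.ne])
      (by simp) (by simp)
    refine ⟨x, C, hC, fun e he => hsub e ?_⟩
    simp only [Walk.edges_cons, Walk.edges_nil, List.mem_cons] at he ⊢
    tauto
  match P with
  | .nil =>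
    have : Nontrivial V := Fintype.one_lt_card_iff_nontrivial.1 (by omega)
    obtain ⟨w, hw⟩ := hconn.preconnected.exists_adj_of_nontrivial u
    obtain ⟨x, C, hC, -⟩ := hadj hw
    exact ⟨x, C, hC, by simp⟩
  | .cons h .nil => exact hadj h
  | .cons _ (.cons _ _) =>
    exact hvt.closesToCycle_of_one_lt_length hconn hP (by simp) hlen
end

section
/- Let G be a finite connected vertex-transitive simple graph with at least 3 vertices. Then every induced path in G of length at most 2 closes to an induced cycle, i.e., for every induced path P in G with at most 2 edges there exists an induced cycle C in G such that every vertex of P is a vertex of C and every edge of P is an edge of C. -/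
open SimpleGraph

/-- A *detour* around `w` from `u` to `v` is a walk all of whose vertices other than `u` and `v`
lie outside the closed neighborhood of `w`. -/
def HasDetour {V : Type*} (G : SimpleGraph V) (w u v : V) : Prop :=
  ∃ p : G.Walk u v, ∀ x ∈ p.support, x = u ∨ x = v ∨ (x ≠ w ∧ ¬ G.Adj w x)

/-- `C` is nonempty, connected in `G`, and disjoint from the closed neighborhood of `x`. -/
def IsFarSet {V : Type*} (G : SimpleGraph V) (x : V) (C : Set V) : Prop :=
  C.Nonempty ∧ (∀ a ∈ C, ∀ b ∈ C, ∃ p : G.Walk a b, ∀ z ∈ p.support, z ∈ C) ∧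
    ∀ c ∈ C, c ≠ x ∧ ¬ G.Adj x c

/-- The far sets of `x` whose size is largest among the far sets of all vertices. -/
def maxFarSets {V : Type*} (G : SimpleGraph V) (x : V) : Set (Set V) :=
  {C | IsFarSet G x C ∧ ∀ y D, IsFarSet G y D → D.ncard ≤ C.ncard}

section

variable {V : Type*} {G : SimpleGraph V}

theorem IsFarSet.image {x : V} {C : Set V} (h : IsFarSet G x C) (φ : G ≃g G) :
    IsFarSet G (φ x) (φ '' C) := by
  obtain ⟨hne, hconn, hfar⟩ := h
  refine ⟨hne.image _, ?_, ?_⟩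
  · rintro _ ⟨a, ha, rfl⟩ _ ⟨b, hb, rfl⟩
    obtain ⟨p, hp⟩ := hconn a ha b hb
    refine ⟨p.map φ.toHom, fun z hz => ?_⟩
    rw [Walk.support_map, List.mem_map] at hz
    obtain ⟨y, hy, rfl⟩ := hz
    exact ⟨y, hp y hy, rfl⟩
  · rintro _ ⟨c, hc, rfl⟩
    exact ⟨fun h => (hfar c hc).1 (φ.injective h),
      fun h => (hfar c hc).2 (φ.map_adj_iff.1 h)⟩

theorem IsFarSet.insert_vertex {x y c : V} {C : Set V} (h : IsFarSet G x C) (hc : c ∈ C)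
    (hyc : G.Adj y c) (hyx : y ≠ x) (hxy : ¬ G.Adj x y) : IsFarSet G x (insert y C) := by
  obtain ⟨-, hconn, hfar⟩ := h
  have hy : ∀ b ∈ C, ∃ p : G.Walk y b, ∀ z ∈ p.support, z ∈ insert y C := by
    intro b hb
    obtain ⟨p, hp⟩ := hconn c hc b hb
    refine ⟨p.cons hyc, fun z hz => ?_⟩
    rw [Walk.support_cons, List.mem_cons] at hz
    exact hz.imp_right (hp z)
  refine ⟨⟨y, Set.mem_insert _ _⟩, ?_, ?_⟩
  · rintro a (rfl | ha) b (rfl | hb)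
    · exact ⟨Walk.nil, by simp⟩
    · exact hy b hb
    · obtain ⟨p, hp⟩ := hy a ha
      exact ⟨p.reverse, by simpa using hp⟩
    · obtain ⟨p, hp⟩ := hconn a ha b hb
      exact ⟨p, fun z hz => Set.mem_insert_of_mem _ (hp z hz)⟩
  · rintro z (rfl | hz)
    · exact ⟨hyx, hxy⟩
    · exact hfar z hz

theorem IsFarSet.hasDetour {w u v a b : V} {C : Set V} (h : IsFarSet G w C) (ha : a ∈ C)
    (hb : b ∈ C) (hua : G.Adj u a) (hvb : G.Adj v b) : HasDetour G w u v := by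
  obtain ⟨p, hp⟩ := h.2.1 a ha b hb
  refine ⟨(p.concat hvb.symm).cons hua, fun x hx => ?_⟩
  simp only [Walk.support_cons, Walk.support_concat, List.mem_cons,
    List.mem_append, List.not_mem_nil, or_false] at hx
  rcases hx with rfl | hx | rfl
  · exact .inl rfl
  · exact .inr (.inr (h.2.2 x (hp x hx)))
  · exact .inr (.inl rfl)

theorem image_mem_maxFarSets {x : V} {C : Set V} (h : C ∈ maxFarSets G x) (φ : G ≃g G) :
    φ '' C ∈ maxFarSets G (φ x) := by
  refine ⟨h.1.image φ, fun y D hD => ?_⟩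
  rw [Set.ncard_image_of_injective _ φ.injective]
  exact h.2 y D hD

theorem maxFarSets_apply (φ : G ≃g G) (x : V) :
    maxFarSets G (φ x) = Set.image φ '' maxFarSets G x := by
  ext D
  constructor
  · intro hD
    refine ⟨φ.symm '' D, ?_, ?_⟩
    · simpa using image_mem_maxFarSets hD φ.symm
    · rw [← Set.image_comp]
      simp
  · rintro ⟨C, hC, rfl⟩
    exact image_mem_maxFarSets hC φ

theorem maxFarSets_nonempty [Finite V] (hvt : VertexTransitive G) {u v : V} (huv : u ≠ v)
    (hadj : ¬ G.Adj u v) (w : V) : (maxFarSets G w).Nonempty := by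
  have hfar : IsFarSet G u {v} := by
    refine ⟨Set.singleton_nonempty v, ?_, ?_⟩
    · rintro a rfl b rfl
      exact ⟨Walk.nil, by simp⟩
    · rintro c rfl
      exact ⟨huv.symm, hadj⟩
  obtain ⟨⟨x, C⟩, hC, hmax⟩ := Set.exists_max_image {q : V × Set V | IsFarSet G q.1 q.2}
    (fun q => q.2.ncard) (Set.toFinite _) ⟨(u, {v}), hfar⟩
  obtain ⟨φ, rfl⟩ := hvt x w
  exact ⟨_, image_mem_maxFarSets ⟨hC, fun y D hD => hmax (y, D) hD⟩ φ⟩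

theorem not_adj_of_mem_maxFarSets [Finite V] {x y c : V} {C : Set V} (hC : C ∈ maxFarSets G x)
    (hy : y ∉ C) (hyx : y ≠ x) (hxy : ¬ G.Adj x y) (hc : c ∈ C) : ¬ G.Adj y c := by
  intro hyc
  have := hC.2 x _ (hC.1.insert_vertex hc hyc hyx hxy)
  rw [Set.ncard_insert_of_notMem hy] at this
  omega

/-- The classes of an automorphism-invariant equivalence relation on a vertex-transitive graph
induce vertex-transitive graphs. -/
theorem VertexTransitive.induce_class (hvt : VertexTransitive G) (r : Setoid V)
    (hr : ∀ (φ : G ≃g G) (x y : V), r x y → r (φ x) (φ y)) (w : V) :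
    VertexTransitive (G.induce {x | r w x}) := by
  rintro ⟨x, hx⟩ ⟨y, hy⟩
  obtain ⟨φ, rfl⟩ := hvt x y
  have hiff : ∀ z, z ∈ {x | r w x} ↔ φ.toEquiv z ∈ {x | r w x} := by
    intro z
    constructor
    · intro hz
      exact r.trans hy (hr φ x z (r.trans (r.symm hx) hz))
    · intro hz
      have := hr φ.symm (φ x) (φ z) (r.trans (r.symm hy) hz)
      rw [φ.symm_apply_apply, φ.symm_apply_apply] at this
      exact r.trans hx this
  exact ⟨⟨φ.toEquiv.subtypeEquiv hiff, φ.map_adj_iff⟩, rfl⟩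

end

theorem VertexTransitive.hasDetour {V : Type*} [Finite V] {G : SimpleGraph V}
    (hvt : VertexTransitive G) {w u v : V} (hwu : G.Adj w u) (hwv : G.Adj w v) :
    HasDetour G w u v := by
  induction hn : Nat.card V using Nat.strong_induction_on generalizing V with
  | _ n ih =>
  subst hn
  by_cases huv : u = v
  · subst huv
    exact ⟨Walk.nil, by simp⟩
  by_cases hadj : G.Adj u v
  · exact ⟨hadj.toWalk, by simp +contextual⟩
  have key : ∀ r : Setoid V, (∀ (φ : G ≃g G) (x y : V), r x y → r (φ x) (φ y)) →
      r w u → r w v → (∃ y, ¬ r w y) → HasDetour G w u v := by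
    rintro r hr hu hv ⟨y, hy⟩
    obtain ⟨p, hp⟩ := ih (Nat.card {x | r w x}) (Finite.card_subtype_lt (x := y) hy)
      (hvt.induce_class r hr w) (w := ⟨w, r.refl w⟩) (u := ⟨u, hu⟩) (v := ⟨v, hv⟩)
      (by simpa using hwu) (by simpa using hwv) rfl
    refine ⟨p.map (Embedding.induce _).toHom, fun x hx => ?_⟩
    obtain ⟨z, hz, rfl⟩ := List.mem_map.1 (Walk.support_map _ p ▸ hx)
    simpa [Subtype.ext_iff] using hp z hz
  by_cases hconn : G.Preconnected
  swap
  · refine key G.reachableSetoid (fun φ x y h => h.map φ.toHom) hwu.reachable hwv.reachable ?_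
    by_contra! h
    exact hconn fun x y => (h x).symm.trans (h y)
  by_contra hno
  have hsub : ∀ C ∈ maxFarSets G w, IsFarSet G u C ∧ IsFarSet G v C := by
    intro C hC
    have hu : u ∉ C := fun h => (hC.1.2.2 u h).2 hwu
    have hv : v ∉ C := fun h => (hC.1.2.2 v h).2 hwv
    have far : ∀ x, x ∉ C → (∀ c ∈ C, ¬ G.Adj x c) → IsFarSet G x C := fun x hx h =>
      ⟨hC.1.1, hC.1.2.1, fun c hc => ⟨fun h' => hx (h' ▸ hc), h c hc⟩⟩
    by_cases hua : ∃ a ∈ C, G.Adj u a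
    · obtain ⟨a, ha, hua⟩ := hua
      by_cases hvb : ∃ b ∈ C, G.Adj v b
      · obtain ⟨b, hb, hvb⟩ := hvb
        exact (hno (hC.1.hasDetour ha hb hua hvb)).elim
      · push Not at hvb
        exact (not_adj_of_mem_maxFarSets ⟨far v hv hvb, hC.2⟩ hu huv
          (fun h => hadj h.symm) ha hua).elim
    · push Not at hua
      refine ⟨far u hu hua, far v hv fun b hb hvb => ?_⟩
      exact not_adj_of_mem_maxFarSets ⟨far u hu hua, hC.2⟩ hv (Ne.symm huv) hadj hb hvb
  have heq : ∀ x, maxFarSets G w ⊆ maxFarSets G x → maxFarSets G w = maxFarSets G x := by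
    intro x hx
    obtain ⟨φ, rfl⟩ := hvt w x
    refine Set.eq_of_subset_of_ncard_le hx ?_
    rw [maxFarSets_apply]
    exact Set.ncard_image_le
  refine hno (key (Setoid.ker (maxFarSets G)) (fun φ x y h => ?_)
    (heq u fun C hC => ⟨(hsub C hC).1, hC.2⟩) (heq v fun C hC => ⟨(hsub C hC).2, hC.2⟩) ?_)
  · rw [Setoid.ker_def] at h ⊢
    rw [maxFarSets_apply, maxFarSets_apply, h]
  · obtain ⟨C, hC⟩ := maxFarSets_nonempty hvt huv hadj w
    obtain ⟨c, hc⟩ := hC.1.1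
    obtain ⟨p⟩ := hconn c w
    obtain ⟨d, -, hd₁, hd₂⟩ := p.exists_boundary_dart C hc fun h => (hC.1.2.2 w h).1 rfl
    refine ⟨d.snd, fun h => ?_⟩
    rw [Setoid.ker_def] at h
    have hC' : C ∈ maxFarSets G d.snd := h ▸ hC
    exact (hC'.1.2.2 _ hd₁).2 d.adj.symm

section

variable {V : Type*} {G : SimpleGraph V}

/-- A shortest walk among those with all vertices in a given set is induced. -/
theorem inducedWalk_of_forall_length_le {S : Set V} {u v : V} {p : G.Walk u v}
    (hS : ∀ x ∈ p.support, x ∈ S)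
    (hmin : ∀ q : G.Walk u v, (∀ x ∈ q.support, x ∈ S) → p.length ≤ q.length) :
    InducedWalk G p := by
  have key : ∀ i j, i < j → j ≤ p.length → G.Adj (p.getVert i) (p.getVert j) →
      s(p.getVert i, p.getVert j) ∈ p.edges := by
    intro i j hij hj hadj
    have hle := hmin ((p.take i).append (Walk.cons hadj (p.drop j))) (by
      intro x hx
      rw [Walk.mem_support_append_iff, Walk.support_cons, List.mem_cons] at hx
      rcases hx with hx | rfl | hx
      · exact hS _ ((p.isSubwalk_take i).support_subset hx)
      · exact hS _ (p.getVert_mem_support i)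
      · exact hS _ ((p.isSubwalk_drop j).support_subset hx))
    rw [Walk.length_append, Walk.length_cons, Walk.take_length, Walk.drop_length] at hle
    obtain rfl : j = i + 1 := by omega
    rw [← Walk.adj_toSubgraph_iff_mem_edges]
    exact p.toSubgraph_adj_getVert hj
  intro x hx y hy hadj
  obtain ⟨i, rfl, hi⟩ := Walk.mem_support_iff_exists_getVert.1 hx
  obtain ⟨j, rfl, hj⟩ := Walk.mem_support_iff_exists_getVert.1 hy
  rcases lt_trichotomy i j with h | rfl | h
  · exact key i j h hj hadj
  · exact (G.irrefl hadj).elim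
  · rw [Sym2.eq_swap]
    exact key j i h hi hadj.symm

theorem HasDetour.exists_isPath_inducedWalk {w u v : V} (h : HasDetour G w u v) :
    ∃ p : G.Walk u v, p.IsPath ∧ InducedWalk G p ∧
      ∀ x ∈ p.support, x = u ∨ x = v ∨ (x ≠ w ∧ ¬ G.Adj w x) := by
  classical
  obtain ⟨p, hp, hmin⟩ := WellFounded.has_min (measure fun p : G.Walk u v => p.length).wf
    {p | ∀ x ∈ p.support, x ∈ {x | x = u ∨ x = v ∨ (x ≠ w ∧ ¬ G.Adj w x)}} h
  have hp' := fun x hx => hp x (p.support_bypass_subset_support hx)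
  exact ⟨p.bypass, p.bypass_isPath, inducedWalk_of_forall_length_le hp' fun q hq =>
    p.length_bypass_le_length.trans (not_lt.1 (hmin q hq)), hp'⟩

theorem HasDetour.exists_induced_cycle {w u v : V} (h : HasDetour G w u v) (hwu : G.Adj w u)
    (hwv : G.Adj w v) (huv : u ≠ v) :
    ∃ C : G.Walk w w, C.IsCycle ∧ InducedWalk G C ∧ s(w, u) ∈ C.edges ∧ s(w, v) ∈ C.edges := by
  obtain ⟨p, hpath, hind, hp⟩ := h.exists_isPath_inducedWalk
  have hw : w ∉ p.support := by
    intro hmem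
    rcases hp w hmem with rfl | rfl | h
    · exact G.irrefl hwu
    · exact G.irrefl hwv
    · exact h.1 rfl
  refine ⟨(p.concat hwv.symm).cons hwu, ?_, ?_, by simp, by simp [Walk.edges_concat, Sym2.eq_swap]⟩
  · rw [Walk.cons_isCycle_iff]
    refine ⟨hpath.concat hw _, ?_⟩
    rw [Walk.edges_concat, List.concat_eq_append, List.mem_append, List.mem_singleton]
    rintro (h | h)
    · exact hw (p.fst_mem_support_of_mem_edges h)
    · rw [Sym2.eq_swap, Sym2.congr_left] at h
      exact huv h
  · have hedge : ∀ x ∈ p.support, G.Adj w x →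
        s(w, x) ∈ ((p.concat hwv.symm).cons hwu).edges := by
      intro x hx hadj
      rcases hp x hx with rfl | rfl | h
      · simp
      · simp [Walk.edges_concat, Sym2.eq_swap]
      · exact (h.2 hadj).elim
    have hmem : ∀ x ∈ ((p.concat hwv.symm).cons hwu).support, x = w ∨ x ∈ p.support := by
      intro x hx
      simp only [Walk.support_cons, Walk.support_concat, List.mem_cons,
        List.mem_append, List.not_mem_nil, or_false] at hx
      tauto
    intro x hx y hy hadj
    rcases hmem x hx with rfl | hx'
    · rcases hmem y hy with rfl | hy'
      · exact (G.irrefl hadj).elim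
      · exact hedge y hy' hadj
    · rcases hmem y hy with rfl | hy'
      · rw [Sym2.eq_swap]
        exact hedge x hx' hadj.symm
      · simp [Walk.edges_concat, hind x hx' y hy' hadj]

theorem SimpleGraph.Connected.exists_adj_ne_or_exists_adj_ne [Fintype V] (hconn : G.Connected)
    (hcard : 3 ≤ Fintype.card V) (a b : V) :
    (∃ c, c ≠ b ∧ G.Adj a c) ∨ ∃ c, c ≠ a ∧ G.Adj b c := by
  classical
  obtain ⟨z, hz⟩ : ∃ z, z ∉ ({a, b} : Finset V) := by
    by_contra! h
    have := Finset.card_le_card (fun x _ => h x : (Finset.univ : Finset V) ⊆ {a, b})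
    have := Finset.card_le_two (a := a) (b := b)
    rw [Finset.card_univ] at *
    omega
  obtain ⟨p⟩ := hconn.preconnected a z
  obtain ⟨d, -, hd₁, hd₂⟩ := p.exists_boundary_dart ({a, b} : Set V) (by simp) (by simpa using hz)
  simp only [Set.mem_insert_iff, Set.mem_singleton_iff, not_or] at hd₁ hd₂
  rcases hd₁ with h | h
  · exact .inl ⟨d.snd, hd₂.2, h ▸ d.adj⟩
  · exact .inr ⟨d.snd, hd₂.1, h ▸ d.adj⟩

theorem VertexTransitive.exists_induced_cycle_of_adj [Fintype V] (hvt : VertexTransitive G)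
    (hconn : G.Connected) (hcard : 3 ≤ Fintype.card V) {a b : V} (hab : G.Adj a b) :
    ∃ (w : V) (C : G.Walk w w), C.IsCycle ∧ InducedWalk G C ∧ s(a, b) ∈ C.edges := by
  rcases hconn.exists_adj_ne_or_exists_adj_ne hcard a b with ⟨c, hne, hc⟩ | ⟨c, hne, hc⟩
  · obtain ⟨C, hC, hind, h, -⟩ := (hvt.hasDetour hab hc).exists_induced_cycle hab hc hne.symm
    exact ⟨a, C, hC, hind, h⟩
  · obtain ⟨C, hC, hind, h, -⟩ :=
      (hvt.hasDetour hab.symm hc).exists_induced_cycle hab.symm hc hne.symm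
    exact ⟨b, C, hC, hind, Sym2.eq_swap ▸ h⟩

end

/-- In a finite connected vertex-transitive graph with at least 3 vertices,
every induced path of length at most 2 closes to an induced cycle. -/
theorem vertexTransitive_inducedPath_length_le_two_closesToInducedCycle
    {V : Type*} [Fintype V] (G : SimpleGraph V)
    (hconn : G.Connected) (hcard : 3 ≤ Fintype.card V) (hvt : VertexTransitive G)
    {u v : V} (P : G.Walk u v) (hP : P.IsPath) (hind : InducedWalk G P)
    (hlen : P.length ≤ 2) :
    ClosesToInducedCycle G P := by
  rcases P with _ | ⟨h, _ | ⟨h', _ | ⟨h'', q⟩⟩⟩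
  · have : Nontrivial V := Fintype.one_lt_card_iff_nontrivial.1 (by omega)
    obtain ⟨b, hb⟩ := hconn.preconnected.exists_adj_of_nontrivial u
    obtain ⟨w, C, hC, hC', hedge⟩ := hvt.exists_induced_cycle_of_adj hconn hcard hb
    exact ⟨w, C, hC, hC', by simpa using C.fst_mem_support_of_mem_edges hedge, by simp⟩
  · obtain ⟨w, C, hC, hC', hedge⟩ := hvt.exists_induced_cycle_of_adj hconn hcard h
    exact ⟨w, C, hC, hC', by simpa using ⟨C.fst_mem_support_of_mem_edges hedge,
      C.snd_mem_support_of_mem_edges hedge⟩, by simpa using hedge⟩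
  · have huv : u ≠ v := by
      rintro rfl
      simp at hP
    obtain ⟨C, hC, hC', hu, hv⟩ :=
      (hvt.hasDetour h.symm h').exists_induced_cycle h.symm h' huv
    refine ⟨_, C, hC, hC', ?_, ?_⟩
    · simpa using ⟨C.snd_mem_support_of_mem_edges hu, C.snd_mem_support_of_mem_edges hv⟩
    · simpa using ⟨Sym2.eq_swap ▸ hu, hv⟩
  · simp at hlen
end

section
/- Let G be a finite connected edge-transitive simple graph that is not isomorphic to a star K_{1,n} for any n ≥ 0. Then every path in G of length at most 3 closes to a cycle. -/
open SimpleGraph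

/-- `D` is a *fragment* of `G` with respect to `X`: a nonempty set of vertices avoiding `X`, all of
whose outside neighbours lie in `X`, and which together with `X` does not exhaust the vertices. -/
structure IsFragment_s2 {V : Type*} (G : SimpleGraph V) (X D : Set V) : Prop where
  nonempty : D.Nonempty
  notMem : ∀ y ∈ D, y ∉ X
  exists_notMem : ∃ v, v ∉ D ∧ v ∉ X
  closed : ∀ y ∈ D, ∀ z, G.Adj y z → z ∈ D ∨ z ∈ X

namespace IsFragment_s2

variable {V : Type*} {G : SimpleGraph V} {X D : Set V}

lemma compl (h : IsFragment_s2 G X D) : IsFragment_s2 G X {v | v ∉ D ∧ v ∉ X} where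
  nonempty := h.exists_notMem
  notMem _ hy := hy.2
  exists_notMem := by
    obtain ⟨y, hy⟩ := h.nonempty
    exact ⟨y, fun hc => hc.1 hy, h.notMem y hy⟩
  closed y hy z hyz := by
    by_contra! hc
    have hz : z ∈ D := by
      by_contra hz
      exact hc.1 ⟨hz, hc.2⟩
    rcases h.closed z hz y hyz.symm with h' | h'
    exacts [hy.1 h', hy.2 h']

lemma image (h : IsFragment_s2 G X D) (φ : G ≃g G) : IsFragment_s2 G (φ '' X) (φ '' D) where
  nonempty := h.nonempty.image _
  notMem := by
    rintro _ ⟨y, hy, rfl⟩ ⟨z, hz, hzy⟩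
    exact h.notMem y hy (φ.injective hzy ▸ hz)
  exists_notMem := by
    obtain ⟨v, hv, hv'⟩ := h.exists_notMem
    exact ⟨φ v, fun hc => hv (φ.injective.mem_set_image.1 hc),
      fun hc => hv' (φ.injective.mem_set_image.1 hc)⟩
  closed := by
    rintro _ ⟨y, hy, rfl⟩ z hyz
    obtain ⟨z, rfl⟩ := φ.surjective z
    exact (h.closed y hy z (φ.map_adj_iff.1 hyz)).imp (Set.mem_image_of_mem _)
      (Set.mem_image_of_mem _)

/-- If `X` has a fragment, it has one missing a prescribed vertex. -/
lemma exists_notMem_fragment (h : IsFragment_s2 G X D) {c : V} : ∃ E, IsFragment_s2 G X E ∧ c ∉ E := by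
  by_cases hc : c ∈ D
  · exact ⟨_, h.compl, fun h' => h'.1 hc⟩
  · exact ⟨D, h, hc⟩

end IsFragment_s2

section Separation

variable {V : Type*} {G : SimpleGraph V}

/-- If `X` has no fragments, any two vertices outside `X` are joined by a path avoiding `X`. -/
lemma exists_isPath_of_not_isFragment {X : Set V} (hX : ∀ D, ¬ IsFragment_s2 G X D) {a d : V}
    (ha : a ∉ X) (hd : d ∉ X) : ∃ Q : G.Walk a d, Q.IsPath ∧ ∀ x ∈ Q.support, x ∉ X := by
  classical
  by_contra! hQ
  refine hX {z | ∃ p : G.Walk a z, ∀ x ∈ p.support, x ∉ X} ⟨⟨a, .nil, by simpa using ha⟩, ?_,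
    ⟨d, ?_, hd⟩, ?_⟩
  · rintro y ⟨p, hp⟩
    exact hp y p.end_mem_support
  · rintro ⟨p, hp⟩
    obtain ⟨x, hx, hx'⟩ := hQ p.bypass p.bypass_isPath
    exact hp x (p.support_bypass_subset_support hx) hx'
  · rintro y ⟨p, hp⟩ z hyz
    by_cases hz : z ∈ X
    · exact .inr hz
    · refine .inl ⟨p.concat hyz, fun x hx => ?_⟩
      rw [Walk.support_concat, List.mem_append, List.mem_singleton] at hx
      rcases hx with hx | rfl
      exacts [hp x hx, hz]

lemma SimpleGraph.Connected.not_isFragment_empty (hconn : G.Connected) (D : Set V) :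
    ¬ IsFragment_s2 G ∅ D := by
  intro h
  obtain ⟨y, hy⟩ := h.nonempty
  obtain ⟨v, hv, -⟩ := h.exists_notMem
  obtain ⟨p⟩ := hconn.preconnected y v
  obtain ⟨d, -, h₁, h₂⟩ := p.exists_boundary_dart D hy hv
  exact (h.closed _ h₁ _ d.adj).elim h₂ id

/-- Suppose that `X` has no fragments, that `D` is a fragment for `insert c X` and that `x ∈ D`.
Then every fragment for `insert x X` that misses `c` is properly contained in `D`. -/
lemma IsFragment_s2.ssubset {X D E : Set V} {c x : V} (hX : ∀ D, ¬ IsFragment_s2 G X D)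
    (hD : IsFragment_s2 G (insert c X) D) (hx : x ∈ D) (hE : IsFragment_s2 G (insert x X) E)
    (hcX : c ∉ X) (hc : c ∉ E) : E ⊂ D := by
  have hsub : E ⊆ D := by
    intro e he
    by_contra heD
    refine hX {z | z ∈ E ∧ z ∉ D} ⟨⟨e, he, heD⟩, ?_, ⟨c, fun h => hc h.1, hcX⟩, ?_⟩
    · exact fun y hy hyX => hE.notMem y hy.1 (.inr hyX)
    · rintro y ⟨hyE, hyD⟩ z hyz
      by_cases hzX : z ∈ X
      · exact .inr hzX
      have hzD : z ∉ D := by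
        intro hzD
        rcases hD.closed z hzD y hyz.symm with h | rfl | h
        exacts [hyD h, hc hyE, hE.notMem y hyE (.inr h)]
      rcases hE.closed y hyE z hyz with h | rfl | h
      exacts [.inl ⟨h, hzD⟩, absurd hx hzD, absurd h hzX]
  exact ⟨hsub, fun h => hE.notMem x (h hx) (.inl rfl)⟩

/-- If `X` has no fragments, each fragment for `insert c X` contains a neighbour of `c`. -/
lemma IsFragment_s2.exists_adj {X D : Set V} {c : V} (hX : ∀ D, ¬ IsFragment_s2 G X D)
    (hD : IsFragment_s2 G (insert c X) D) (hcX : c ∉ X) : ∃ x ∈ D, G.Adj c x := by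
  by_contra! h
  refine hX D ⟨hD.nonempty, fun y hy hyX => hD.notMem y hy (.inr hyX),
    ⟨c, fun hc => hD.notMem c hc (.inl rfl), hcX⟩, fun y hy z hyz => ?_⟩
  rcases hD.closed y hy z hyz with h' | rfl | h'
  exacts [.inl h', absurd hyz.symm (h y hy), .inr h']

lemma EdgeTransitive.exists_iso (het : EdgeTransitive G) {a b c d : V} (hab : G.Adj a b)
    (hcd : G.Adj c d) : ∃ φ : G ≃g G, φ a = c ∧ φ b = d ∨ φ a = d ∧ φ b = c := by
  obtain ⟨φ, hφ⟩ := het s(a, b) hab s(c, d) hcd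
  exact ⟨φ, by simpa using hφ⟩

/-- Edge-transitive connected graphs of minimum degree at least two have no cut vertices. -/
lemma EdgeTransitive.not_isFragment_singleton [Finite V] (hconn : G.Connected)
    (het : EdgeTransitive G) (hdeg : ∀ x y, G.Adj y x → ∃ z, z ≠ x ∧ G.Adj y z) (x : V)
    (D : Set V) : ¬ IsFragment_s2 G {x} D := by
  induction hn : D.ncard using Nat.strong_induction_on generalizing x D with
  | _ n ih =>
  intro hD
  have hempty := hconn.not_isFragment_empty
  rw [← insert_empty_eq] at hD
  obtain ⟨y, hy, hxy⟩ := hD.exists_adj hempty (Set.notMem_empty x)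
  obtain ⟨z, hzx, hyz⟩ := hdeg x y hxy.symm
  have hz : z ∈ D := by
    rcases hD.closed y hy z hyz with h | h | h
    exacts [h, absurd h hzx, absurd h (Set.notMem_empty z)]
  obtain ⟨φ, hφ⟩ := het.exists_iso hxy hyz
  have hφx : φ x ∈ D := by
    rcases hφ with h | h <;> rw [h.1] <;> assumption
  obtain ⟨E, hE, hxE⟩ := (hD.image φ).exists_notMem_fragment (c := x)
  rw [Set.image_insert_eq, Set.image_empty] at hE
  have hlt := Set.ncard_lt_ncard (hD.ssubset hempty hφx hE (Set.notMem_empty x) hxE)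
  exact ih _ (hn ▸ hlt) (φ x) E rfl (by rwa [insert_empty_eq] at hE)

/-- In an edge-transitive graph without cut vertices, the ends of an edge never separate. -/
lemma EdgeTransitive.not_isFragment_pair [Finite V] (het : EdgeTransitive G)
    (hcut : ∀ (x : V) (D : Set V), ¬ IsFragment_s2 G {x} D) {b c : V} (hbc : G.Adj b c)
    (D : Set V) : ¬ IsFragment_s2 G {b, c} D := by
  induction hn : D.ncard using Nat.strong_induction_on generalizing b c D with
  | _ n ih =>
  intro hD
  obtain ⟨x, hx, hbx⟩ := hD.exists_adj (hcut c) (by simpa using hbc.ne)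
  obtain ⟨φ, hφ⟩ := het.exists_iso hbc hbx.symm
  obtain ⟨E, hE, hcE⟩ := (hD.image φ).exists_notMem_fragment (c := c)
  have himg : φ '' {b, c} = {x, b} := by
    rw [Set.image_pair]
    rcases hφ with ⟨h₁, h₂⟩ | ⟨h₁, h₂⟩ <;> rw [h₁, h₂]
    exact Set.pair_comm _ _
  rw [himg] at hE
  have hlt := Set.ncard_lt_ncard (IsFragment_s2.ssubset (hcut b) (Set.pair_comm b c ▸ hD) hx hE
    (by simpa using hbc.ne') hcE)
  exact ih _ (hn ▸ hlt) hbx.symm E rfl hE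

end Separation

section Star

variable {V : Type*} {G : SimpleGraph V}

/-- A finite graph whose edges are exactly the pairs joining `x` to another vertex is a star. -/
lemma exists_iso_star [Fintype V] (x : V) (h : ∀ u v, G.Adj u v ↔ Xor (u = x) (v = x)) :
    ∃ n : ℕ, Nonempty (G ≃g completeBipartiteGraph (Fin 1) (Fin n)) := by
  classical
  let e : V ≃ Fin 1 ⊕ Fin (Fintype.card {v // ¬ v = x}) :=
    (Equiv.sumCompl (· = x)).symm.trans
      (Equiv.sumCongr (Equiv.ofUnique _ _) (Fintype.equivFin _))
  have he : ∀ v, ((e v).isLeft = true ↔ v = x) ∧ ((e v).isRight = true ↔ v ≠ x) := by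
    intro v
    by_cases hv : v = x
    · simp [e, hv]
    · simp [e, Equiv.sumCompl_symm_apply_of_neg (p := (· = x)) hv, hv]
  refine ⟨_, ⟨⟨e, fun {u v} => ?_⟩⟩⟩
  rw [h, completeBipartiteGraph_adj, (he u).1, (he u).2, (he v).1, (he v).2, xor_def]
  tauto

/-- In a connected edge-transitive graph in which `x` is the only neighbour of `y`, the edges are
exactly the pairs joining `x` to another vertex. -/
lemma EdgeTransitive.adj_iff_of_leaf (hconn : G.Connected) (het : EdgeTransitive G) {x y : V}
    (hyx : G.Adj y x) (hy : ∀ z, G.Adj y z → z = x) (u v : V) :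
    G.Adj u v ↔ Xor (u = x) (v = x) := by
  have hleaf : ∀ w, G.Adj x w → ∀ z, G.Adj w z → z = x := by
    intro w hxw z hwz
    obtain ⟨φ, ⟨h₁, h₂⟩ | ⟨h₁, h₂⟩⟩ := het.exists_iso hyx hxw
    · have hwy : ∀ t, G.Adj x t → t = w := by
        intro t ht
        obtain ⟨t, rfl⟩ := φ.surjective t
        rw [← h₁, φ.map_adj_iff] at ht
        rw [hy t ht, h₂]
      exact hy z (hwy y hyx.symm ▸ hwz)
    · obtain ⟨t, rfl⟩ := φ.surjective z
      rw [← h₁, φ.map_adj_iff] at hwz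
      rw [hy t hwz, h₂]
  have hall : ∀ w, w = x ∨ G.Adj x w := by
    by_contra! hw
    obtain ⟨w, hw⟩ := hw
    refine hconn.not_isFragment_empty {z | z = x ∨ G.Adj x z} ⟨⟨x, .inl rfl⟩, by simp,
      ⟨w, by simpa using hw, by simp⟩, ?_⟩
    rintro p (rfl | hp) z hpz
    exacts [.inl (.inr hpz), .inl (.inl (hleaf p hp z hpz))]
  constructor
  · intro huv
    rcases hall u with rfl | hu
    · exact .inl ⟨rfl, huv.ne'⟩
    · exact .inr ⟨hleaf u hu v huv, hu.ne'⟩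
  · rintro (⟨rfl, hv⟩ | ⟨rfl, hu⟩)
    exacts [(hall v).resolve_left hv, ((hall u).resolve_left hu).symm]

end Star

section Cycles

variable {V : Type*} {G : SimpleGraph V}

lemma exists_isCycle_of_not_isFragment_singleton {a b c : V} (hb : ∀ D, ¬ IsFragment_s2 G {b} D)
    (hab : G.Adj a b) (hbc : G.Adj b c) (hac : a ≠ c) :
    ∃ C : G.Walk b b, C.IsCycle ∧ s(a, b) ∈ C.edges ∧ s(b, c) ∈ C.edges := by
  obtain ⟨Q, hQ, hQb⟩ := exists_isPath_of_not_isFragment (a := a) (d := c) hb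
    (by simpa using hab.ne) (by simpa using hbc.ne')
  have hbQ : b ∉ Q.support := fun h => hQb b h rfl
  refine ⟨.cons hab.symm (Q.concat hbc.symm), ?_, ?_, ?_⟩
  · rw [Walk.cons_isCycle_iff]
    refine ⟨hQ.concat hbQ _, ?_⟩
    rw [Walk.edges_concat, List.concat_eq_append,
        List.mem_append, List.mem_singleton]
    rintro (h | h)
    · exact hbQ (Q.fst_mem_support_of_mem_edges h)
    · simp [hac, hbc.ne] at h
  · simp [Sym2.eq_swap]
  · simp [Walk.edges_concat, Sym2.eq_swap]

lemma exists_isCycle_of_not_isFragment_pair {a b c d : V} (hX : ∀ D, ¬ IsFragment_s2 G {b, c} D)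
    (hab : G.Adj a b) (hbc : G.Adj b c) (hcd : G.Adj c d) (hac : a ≠ c) (hbd : b ≠ d) :
    ∃ C : G.Walk c c, C.IsCycle ∧ s(a, b) ∈ C.edges ∧ s(b, c) ∈ C.edges ∧
      s(c, d) ∈ C.edges := by
  obtain ⟨Q, hQ, hQX⟩ := exists_isPath_of_not_isFragment (a := a) (d := d) hX
    (by simp [hab.ne, hac]) (by simp [hbd.symm, hcd.ne'])
  have hbQ : b ∉ Q.support := fun h => hQX b h (.inl rfl)
  have hcQ : c ∉ Q.support := fun h => hQX c h (.inr rfl)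
  refine ⟨.cons hbc.symm (.cons hab.symm (Q.concat hcd.symm)), ?_, ?_, ?_, ?_⟩
  · rw [Walk.cons_isCycle_iff, Walk.cons_isPath_iff]
    refine ⟨⟨hQ.concat hcQ _, ?_⟩, ?_⟩
    · rw [Walk.support_concat, List.mem_append, List.mem_singleton]
      rintro (h | h)
      exacts [hbQ h, hbc.ne h]
    · rw [Walk.edges_cons, List.mem_cons, Walk.edges_concat, List.concat_eq_append,
        List.mem_append, List.mem_singleton]
      rintro (h | h | h)
      · simp [hac.symm, hbc.ne'] at h
      · exact hcQ (Q.fst_mem_support_of_mem_edges h)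
      · simp [hbd, hbc.ne] at h
  · simp [Sym2.eq_swap]
  · simp [Sym2.eq_swap]
  · simp [Walk.edges_concat, Sym2.eq_swap]

end Cycles

/-- In a finite connected edge-transitive graph that is not isomorphic to any
star `K_{1,n}`, every path of length at most 3 closes to a cycle. -/
theorem edgeTransitive_nonStar_path_length_le_three_closesToCycle
    {V : Type*} [Fintype V] (G : SimpleGraph V)
    (hconn : G.Connected) (het : EdgeTransitive G)
    (hstar : ¬ ∃ n : ℕ, Nonempty (G ≃g completeBipartiteGraph (Fin 1) (Fin n)))
    {u v : V} (P : G.Walk u v) (hP : P.IsPath) (hlen : P.length ≤ 3) :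
    ClosesToCycle G P := by
  have hdeg : ∀ x y, G.Adj y x → ∃ z, z ≠ x ∧ G.Adj y z := by
    intro x y hyx
    by_contra! h
    refine hstar (exists_iso_star x (het.adj_iff_of_leaf hconn hyx fun z hz => ?_))
    by_contra hzx
    exact h z hzx hz
  have hcut := het.not_isFragment_singleton hconn hdeg
  have hedge : ∀ {a b : V}, G.Adj a b → ∃ C : G.Walk b b, C.IsCycle ∧ s(a, b) ∈ C.edges := by
    intro a b hab
    obtain ⟨c, hca, hbc⟩ := hdeg a b hab.symm
    obtain ⟨C, hC, h, -⟩ := exists_isCycle_of_not_isFragment_singleton (hcut b) hab hbc hca.symm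
    exact ⟨C, hC, h⟩
  match P, hP, hlen with
  | .nil, _, _ =>
    have hadj : ∃ w, G.Adj u w := by
      by_contra! h
      have hall : ∀ w, w = u := by
        by_contra! hw
        obtain ⟨w, hw⟩ := hw
        exact hconn.not_isFragment_empty {u} ⟨⟨u, rfl⟩, by simp, ⟨w, by simpa using hw, by simp⟩,
          by rintro _ rfl z hz; exact absurd hz (h z)⟩
      refine hstar (exists_iso_star u fun a b => ?_)
      rw [hall a, hall b]
      simp
    obtain ⟨w, hw⟩ := hadj
    obtain ⟨C, hC, -⟩ := hedge hw
    exact ⟨_, C, hC, by simp⟩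
  | .cons hab .nil, _, _ =>
    obtain ⟨C, hC, h⟩ := hedge hab
    exact ⟨_, C, hC, by simpa using h⟩
  | .cons (v := b) hab (.cons hbc .nil), hP, _ =>
    have hne : u ≠ v := by
      rintro rfl
      simp at hP
    obtain ⟨C, hC, h⟩ := exists_isCycle_of_not_isFragment_singleton (hcut b) hab hbc hne
    exact ⟨_, C, hC, by simpa using h⟩
  | .cons (v := b) hab (.cons (v := c) hbc (.cons hcd .nil)), hP, _ =>
    simp only [Walk.cons_isPath_iff, Walk.support_cons, Walk.support_nil, List.mem_cons,
      not_or] at hP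
    obtain ⟨C, hC, h⟩ := exists_isCycle_of_not_isFragment_pair
      (het.not_isFragment_pair hcut hbc) hab hbc hcd hP.2.2.1 hP.1.2.2.1
    exact ⟨_, C, hC, by simpa using h⟩
  | .cons _ (.cons _ (.cons _ (.cons _ _))), _, hlen =>
    simp only [Walk.length_cons] at hlen
    omega
end

section
/- Let G be a finite connected edge-transitive simple graph that is not isomorphic to a star K_{1,n} for any n ≥ 0. Then every induced path in G of length at most 3 closes to an induced cycle. -/
open SimpleGraph

namespace SimpleGraph

variable {V : Type*} {G : SimpleGraph V}

section InducedCycles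

lemma isPath_and_inducedWalk_cons {u v w : V} (h : G.Adj u v) {p : G.Walk v w}
    (hp : p.IsPath) (hi : InducedWalk G p) (hu : u ∉ p.support)
    (hadj : ∀ x ∈ p.support, G.Adj u x → x = v) :
    (Walk.cons h p).IsPath ∧ InducedWalk G (Walk.cons h p) := by
  refine ⟨(Walk.cons_isPath_iff h p).2 ⟨hp, hu⟩, ?_⟩
  intro x hx y hy hxy
  simp only [Walk.support_cons, List.mem_cons] at hx hy
  simp only [Walk.edges_cons, List.mem_cons]
  rcases hx with rfl | hx <;> rcases hy with rfl | hy
  · exact absurd hxy (G.loopless.irrefl _)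
  · rw [hadj y hy hxy]
    exact .inl rfl
  · rw [hadj x hx hxy.symm]
    exact .inl Sym2.eq_swap
  · exact .inr (hi x hx y hy hxy)

/-- Joining a new vertex to exactly the two ends of an induced path gives an induced cycle. -/
lemma isCycle_and_inducedWalk_cons_cons {u v b : V} (hvb : G.Adj v b) (hbu : G.Adj b u)
    {q : G.Walk u v} (hq : q.IsPath) (hi : InducedWalk G q) (hb : b ∉ q.support)
    (huv : u ≠ v) (hadj : ∀ x ∈ q.support, G.Adj b x → x = u ∨ x = v) :
    (Walk.cons hvb (Walk.cons hbu q)).IsCycle ∧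
      InducedWalk G (Walk.cons hvb (Walk.cons hbu q)) := by
  constructor
  · refine (Walk.cons_isCycle_iff _ _).2 ⟨(Walk.cons_isPath_iff _ _).2 ⟨hq, hb⟩, ?_⟩
    simp only [Walk.edges_cons, List.mem_cons, not_or]
    refine ⟨?_, fun h => hb (q.snd_mem_support_of_mem_edges h)⟩
    intro h
    rcases Sym2.eq_iff.1 h with ⟨h, -⟩ | ⟨h, -⟩
    · exact hvb.ne h
    · exact huv h.symm
  · have key : ∀ x ∈ q.support, G.Adj b x →
        s(b, x) ∈ (Walk.cons hvb (Walk.cons hbu q)).edges := by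
      intro x hx hbx
      simp only [Walk.edges_cons, List.mem_cons]
      rcases hadj x hx hbx with rfl | rfl
      · exact .inr (.inl rfl)
      · exact .inl Sym2.eq_swap
    have mem : ∀ x ∈ (Walk.cons hvb (Walk.cons hbu q)).support, x = b ∨ x ∈ q.support := by
      intro x hx
      simp only [Walk.support_cons, List.mem_cons] at hx
      rcases hx with h | h | h
      · exact .inr (h ▸ q.end_mem_support)
      · exact .inl h
      · exact .inr h
    intro x hx y hy hxy
    replace hx := mem x hx
    replace hy := mem y hy
    rcases hx with rfl | hx <;> rcases hy with rfl | hy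
    · exact absurd hxy (G.loopless.irrefl _)
    · exact key y hy hxy
    · rw [Sym2.eq_swap]
      exact key x hx hxy.symm
    · have := hi x hx y hy hxy
      simp [this]

end InducedCycles

section ReachableWithin

/-- `y` can be reached from `x` by a walk all of whose vertices lie in `S`. -/
def ReachableWithin (G : SimpleGraph V) (S : Set V) (x y : V) : Prop :=
  ∃ p : G.Walk x y, ∀ z ∈ p.support, z ∈ S

namespace ReachableWithin

variable {S T : Set V} {x y z : V}

lemma refl (hx : x ∈ S) : G.ReachableWithin S x x :=
  ⟨Walk.nil, by simpa using hx⟩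

lemma symm (h : G.ReachableWithin S x y) : G.ReachableWithin S y x := by
  obtain ⟨p, hp⟩ := h
  exact ⟨p.reverse, by simpa using hp⟩

lemma trans (h : G.ReachableWithin S x y) (h' : G.ReachableWithin S y z) :
    G.ReachableWithin S x z := by
  obtain ⟨p, hp⟩ := h
  obtain ⟨q, hq⟩ := h'
  refine ⟨p.append q, fun w hw => ?_⟩
  rcases (Walk.mem_support_append_iff _ _).1 hw with hw | hw
  exacts [hp w hw, hq w hw]

lemma of_adj (h : G.Adj x y) (hx : x ∈ S) (hy : y ∈ S) : G.ReachableWithin S x y :=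
  ⟨Walk.cons h Walk.nil, by simp [hx, hy]⟩

lemma mono (hST : S ⊆ T) (h : G.ReachableWithin S x y) : G.ReachableWithin T x y := by
  obtain ⟨p, hp⟩ := h
  exact ⟨p, fun w hw => hST (hp w hw)⟩

lemma left_mem (h : G.ReachableWithin S x y) : x ∈ S := by
  obtain ⟨p, hp⟩ := h
  exact hp _ p.start_mem_support

lemma right_mem (h : G.ReachableWithin S x y) : y ∈ S :=
  h.symm.left_mem

lemma map (φ : G ≃g G) (h : G.ReachableWithin S x y) (hST : ∀ w ∈ S, φ w ∈ T) :
    G.ReachableWithin T (φ x) (φ y) := by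
  obtain ⟨p, hp⟩ := h
  refine ⟨p.map φ.toHom, fun w hw => ?_⟩
  rw [Walk.support_map, List.mem_map] at hw
  obtain ⟨w', hw', rfl⟩ := hw
  exact hST w' (hp w' hw')

lemma of_component_subset (h : G.ReachableWithin S x y)
    (hK : ∀ w, G.ReachableWithin S x w → w ∈ T) : G.ReachableWithin T x y := by
  obtain ⟨p, hp⟩ := h
  classical
  exact ⟨p, fun w hw => hK w
    ⟨p.takeUntil w hw, fun w' hw' => hp w' (p.support_takeUntil_subset_support hw hw')⟩⟩

/-- A shortest walk within `S` is an induced path. -/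
lemma exists_inducedWalk (h : G.ReachableWithin S x y) :
    ∃ p : G.Walk x y, p.IsPath ∧ InducedWalk G p ∧ ∀ w ∈ p.support, w ∈ S := by
  classical
  obtain ⟨p₀, hp₀⟩ := h
  have hex : ∃ n, ∃ p : G.Walk x y, (∀ w ∈ p.support, w ∈ S) ∧ p.length = n :=
    ⟨_, p₀, hp₀, rfl⟩
  obtain ⟨p, hpS, hplen⟩ := Nat.find_spec hex
  have hmin : ∀ q : G.Walk x y, (∀ w ∈ q.support, w ∈ S) → p.bypass.length ≤ q.length :=
    fun q hq => p.length_bypass_le_length.trans (hplen ▸ Nat.find_min' hex ⟨q, hq, rfl⟩)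
  have hpS' : ∀ w ∈ p.bypass.support, w ∈ S :=
    fun w hw => hpS w (p.support_bypass_subset_support hw)
  refine ⟨p.bypass, p.bypass_isPath, ?_, hpS'⟩
  generalize p.bypass = q at hmin hpS'
  have key : ∀ i j, i ≤ q.length → j ≤ q.length → i ≤ j →
      G.Adj (q.getVert i) (q.getVert j) → s(q.getVert i, q.getVert j) ∈ q.edges := by
    intro i j hi hj hij hadj
    have hle := hmin ((q.take i).append (Walk.cons hadj (q.drop j))) (by
      intro w hw
      rcases (Walk.mem_support_append_iff _ _).1 hw with hw | hw
      · exact hpS' w ((q.isSubwalk_take i).support_subset hw)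
      · rw [Walk.support_cons, List.mem_cons] at hw
        rcases hw with rfl | hw
        · exact hpS' _ (q.getVert_mem_support i)
        · exact hpS' w ((q.isSubwalk_drop j).support_subset hw))
    rw [Walk.length_append, Walk.length_cons, Walk.take_length, Walk.drop_length] at hle
    have hne : i ≠ j := fun h => hadj.ne (h ▸ rfl)
    obtain rfl : j = i + 1 := by omega
    exact q.mk_mem_edges_iff_exists.2 ⟨i, by omega, rfl⟩
  intro v hv w hw hvw
  obtain ⟨i, rfl, hi⟩ := Walk.mem_support_iff_exists_getVert.1 hv
  obtain ⟨j, rfl, hj⟩ := Walk.mem_support_iff_exists_getVert.1 hw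
  rcases le_total i j with hij | hij
  · exact key i j hi hj hij hvw
  · rw [Sym2.eq_swap]
    exact key j i hj hi hij hvw.symm

/-- If a component `K` of `G[S]` lies in `T` and the component of `G[T]` containing `K` is not
larger than `K`, then no vertex of `T \ S` is adjacent to `K`. -/
lemma not_adj_of_ncard_le [Finite V] {d : V} (hK : ∀ w, G.ReachableWithin S x w → w ∈ T)
    (hcard : {w | G.ReachableWithin T x w}.ncard ≤ {w | G.ReachableWithin S x w}.ncard)
    (hdT : d ∈ T) (hdS : d ∉ S) (h : G.ReachableWithin S x y) : ¬ G.Adj d y := by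
  intro hdy
  have heq : {w | G.ReachableWithin S x w} = {w | G.ReachableWithin T x w} :=
    Set.eq_of_subset_of_ncard_le (fun w hw => of_component_subset hw hK) hcard
  have hd : d ∈ {w | G.ReachableWithin T x w} :=
    (of_component_subset h hK).trans (of_adj hdy.symm (hK _ h) hdT)
  rw [← heq] at hd
  exact hdS hd.right_mem

end ReachableWithin

end ReachableWithin

section FarSet

/-- The vertices that are neither on the edge `e` nor adjacent to an end of it. -/
def farSet (G : SimpleGraph V) (e : Sym2 V) : Set V :=
  {x | ∀ z ∈ e, x ≠ z ∧ ¬ G.Adj z x}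

lemma mem_farSet {x a b : V} :
    x ∈ G.farSet s(a, b) ↔ (x ≠ a ∧ ¬ G.Adj a x) ∧ (x ≠ b ∧ ¬ G.Adj b x) := by
  simp [farSet]

lemma map_mem_farSet (φ : G ≃g G) (e : Sym2 V) (x : V) :
    φ x ∈ G.farSet (Sym2.map φ e) ↔ x ∈ G.farSet e := by
  induction e with
  | _ a b => simp [mem_farSet, φ.map_adj_iff]

lemma reachableWithin_farSet_map (φ : G ≃g G) (e : Sym2 V) (x y : V) :
    G.ReachableWithin (G.farSet (Sym2.map φ e)) (φ x) (φ y) ↔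
      G.ReachableWithin (G.farSet e) x y := by
  constructor
  · intro h
    have := h.map (T := G.farSet e) φ.symm (fun w hw => by
      rw [← map_mem_farSet φ]
      simpa using hw)
    simpa using this
  · exact fun h => h.map φ fun w hw => (map_mem_farSet φ e w).2 hw

/-- The order of the component of `x` in the graph induced on `G.farSet e`; it is zero when `x`
is not in that set. -/
noncomputable def farComponentSize (G : SimpleGraph V) (e : Sym2 V) (x : V) : ℕ :=
  {y | G.ReachableWithin (G.farSet e) x y}.ncard

lemma farComponentSize_map (φ : G ≃g G) (e : Sym2 V) (x : V) :
    G.farComponentSize (Sym2.map φ e) (φ x) = G.farComponentSize e x := by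
  unfold farComponentSize
  rw [← Set.ncard_image_of_injective {y | G.ReachableWithin (G.farSet e) x y} φ.injective]
  congr 1
  ext y
  obtain ⟨y, rfl⟩ := φ.surjective y
  exact (reachableWithin_farSet_map φ e x y).trans
    (φ.injective.mem_set_image (s := {y | G.ReachableWithin (G.farSet e) x y})).symm

lemma ncard_le_farComponentSize_map (φ : G ≃g G) (e : Sym2 V) (t : ℕ) :
    {x | t ≤ G.farComponentSize (Sym2.map φ e) x}.ncard =
      {x | t ≤ G.farComponentSize e x}.ncard := by
  rw [← Set.ncard_image_of_injective {x | t ≤ G.farComponentSize e x} φ.injective]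
  congr 1
  ext y
  obtain ⟨y, rfl⟩ := φ.surjective y
  simp [farComponentSize_map]

lemma one_le_farComponentSize [Finite V] {e : Sym2 V} {x : V} :
    1 ≤ G.farComponentSize e x ↔ x ∈ G.farSet e := by
  rw [farComponentSize, Nat.one_le_iff_ne_zero, ← Nat.pos_iff_ne_zero, Set.ncard_pos]
  exact ⟨fun ⟨_, hy⟩ => hy.left_mem, fun h => ⟨x, .refl h⟩⟩

lemma farComponentSize_le [Finite V] (e : Sym2 V) (x : V) :
    G.farComponentSize e x ≤ Nat.card V :=
  Set.ncard_le_card _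

/-- In an edge-transitive graph, the ends of an induced path `a b c d` are both adjacent to some
component of the graph far from the edge `bc`. -/
lemma exists_reachableWithin_farSet [Finite V] (het : EdgeTransitive G) {a b c d : V}
    (hab : G.Adj a b) (hbc : G.Adj b c) (hcd : G.Adj c d) (hac : ¬ G.Adj a c)
    (hbd : ¬ G.Adj b d) (had : ¬ G.Adj a d) (had' : a ≠ d) :
    ∃ y z, G.ReachableWithin (G.farSet s(b, c)) y z ∧ G.Adj a y ∧ G.Adj d z := by
  by_contra! hno
  have hda_far : d ∈ G.farSet s(a, b) :=
    mem_farSet.2 ⟨⟨had'.symm, had⟩, fun h => had (h ▸ hab), hbd⟩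
  have had_far : a ∈ G.farSet s(c, d) :=
    mem_farSet.2 ⟨⟨fun h => had (h ▸ hcd), fun h => hac h.symm⟩, had', fun h => had h.symm⟩
  have hdn : d ∉ G.farSet s(b, c) := fun h => (mem_farSet.1 h).2.2 hcd
  have han : a ∉ G.farSet s(b, c) := fun h => (mem_farSet.1 h).1.2 hab.symm
  have hcard : ∀ e ∈ G.edgeSet, ∀ t, {x | t ≤ G.farComponentSize e x}.ncard =
      {x | t ≤ G.farComponentSize s(b, c) x}.ncard := by
    intro e he t
    obtain ⟨φ, rfl⟩ := het s(b, c) hbc e he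
    exact ncard_le_farComponentSize_map φ _ t
  have key : ∀ k t, t + k = Nat.card V + 1 → 1 ≤ t →
      {x | t ≤ G.farComponentSize s(b, c) x} = {x | t ≤ G.farComponentSize s(a, b) x} ∧
      {x | t ≤ G.farComponentSize s(b, c) x} = {x | t ≤ G.farComponentSize s(c, d) x} := by
    intro k
    induction k with
    | zero =>
      intro t ht _
      have hempty : ∀ e, {x | t ≤ G.farComponentSize e x} = ∅ := by
        intro e
        ext x
        have := G.farComponentSize_le e x
        simp only [Set.mem_ofPred_eq, Set.mem_empty_iff_false, iff_false]
        omega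
      simp only [hempty, and_self]
    | succ k ih =>
      intro t ht h1
      obtain ⟨ih₁, ih₂⟩ := ih (t + 1) (by omega) (by omega)
      have hsub : ∀ x, t ≤ G.farComponentSize s(b, c) x →
          t ≤ G.farComponentSize s(a, b) x ∧ t ≤ G.farComponentSize s(c, d) x := by
        intro x hx
        have e₁ := Set.ext_iff.1 ih₁ x
        have e₂ := Set.ext_iff.1 ih₂ x
        simp only [Set.mem_ofPred_eq] at e₁ e₂
        by_cases hx' : t + 1 ≤ G.farComponentSize s(b, c) x
        · have := e₁.1 hx'
          have := e₂.1 hx'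
          omega
        have le₁ : G.farComponentSize s(a, b) x ≤ G.farComponentSize s(b, c) x := by omega
        have le₂ : G.farComponentSize s(c, d) x ≤ G.farComponentSize s(b, c) x := by omega
        have sub₁ : (∀ y, G.ReachableWithin (G.farSet s(b, c)) x y → ¬ G.Adj a y) →
            ∀ y, G.ReachableWithin (G.farSet s(b, c)) x y → y ∈ G.farSet s(a, b) := by
          intro h y hy
          have hy' := mem_farSet.1 hy.right_mem
          exact mem_farSet.2 ⟨⟨fun e => hy'.1.2 (e ▸ hab.symm), h y hy⟩, hy'.1⟩
        have sub₂ : (∀ y, G.ReachableWithin (G.farSet s(b, c)) x y → ¬ G.Adj d y) →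
            ∀ y, G.ReachableWithin (G.farSet s(b, c)) x y → y ∈ G.farSet s(c, d) := by
          intro h y hy
          have hy' := mem_farSet.1 hy.right_mem
          exact mem_farSet.2 ⟨hy'.2, fun e => hy'.2.2 (e ▸ hcd), h y hy⟩
        have hor : (∀ y, G.ReachableWithin (G.farSet s(b, c)) x y → ¬ G.Adj a y) ∨
            (∀ y, G.ReachableWithin (G.farSet s(b, c)) x y → ¬ G.Adj d y) := by
          by_contra! hcon
          obtain ⟨⟨y, hy, hay⟩, z, hz, hdz⟩ := hcon
          exact hno y z (hy.symm.trans hz) hay hdz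
        obtain ⟨hA, hD⟩ : (∀ y, G.ReachableWithin (G.farSet s(b, c)) x y → ¬ G.Adj a y) ∧
            (∀ y, G.ReachableWithin (G.farSet s(b, c)) x y → ¬ G.Adj d y) := by
          rcases hor with h | h
          · exact ⟨h, fun y => ReachableWithin.not_adj_of_ncard_le (sub₁ h) le₁ hda_far hdn⟩
          · exact ⟨fun y => ReachableWithin.not_adj_of_ncard_le (sub₂ h) le₂ had_far han, h⟩
        exact ⟨hx.trans (Set.ncard_le_ncard fun y hy =>
            ReachableWithin.of_component_subset hy (sub₁ hA)),
          hx.trans (Set.ncard_le_ncard fun y hy =>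
            ReachableWithin.of_component_subset hy (sub₂ hD))⟩
      exact ⟨Set.eq_of_subset_of_ncard_le (fun x hx => (hsub x hx).1) (hcard _ hab t).le,
        Set.eq_of_subset_of_ncard_le (fun x hx => (hsub x hx).2) (hcard _ hcd t).le⟩
  have h := (Set.ext_iff.1 (key (Nat.card V) 1 (by omega) le_rfl).1 d).2
    (one_le_farComponentSize.2 hda_far)
  exact hdn (one_le_farComponentSize.1 h)

end FarSet

section ClosingPaths

lemma exists_inducedCycle_of_path_three [Finite V] (het : EdgeTransitive G) {a b c d : V}
    (hab : G.Adj a b) (hbc : G.Adj b c) (hcd : G.Adj c d) (hac : ¬ G.Adj a c)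
    (hbd : ¬ G.Adj b d) (had : ¬ G.Adj a d) (hac' : a ≠ c) (hbd' : b ≠ d) (had' : a ≠ d) :
    ∃ (w : V) (C : G.Walk w w), C.IsCycle ∧ InducedWalk G C ∧
      s(a, b) ∈ C.edges ∧ s(b, c) ∈ C.edges ∧ s(c, d) ∈ C.edges := by
  obtain ⟨y, z, hyz, hay, hdz⟩ :=
    exists_reachableWithin_farSet het hab hbc hcd hac hbd had had'
  have hsub : G.farSet s(b, c) ⊆ insert a (insert d (G.farSet s(b, c))) :=
    fun x hx => .inr (.inr hx)
  have hda : G.ReachableWithin (insert a (insert d (G.farSet s(b, c)))) d a :=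
    ((ReachableWithin.of_adj hdz (by simp) (hsub hyz.right_mem)).trans
      (hyz.symm.mono hsub)).trans
      (ReachableWithin.of_adj hay.symm (hsub hyz.left_mem) (by simp))
  obtain ⟨p, hp, hi, hS⟩ := hda.exists_inducedWalk
  have hb : b ∉ p.support := by
    intro h
    rcases hS b h with h | h | h
    exacts [hab.ne h.symm, hbd' h, (mem_farSet.1 h).1.1 rfl]
  have hc : c ∉ p.support := by
    intro h
    rcases hS c h with h | h | h
    exacts [hac' h.symm, hcd.ne h, (mem_farSet.1 h).2.1 rfl]
  obtain ⟨hq, hqi⟩ := isPath_and_inducedWalk_cons hcd hp hi hc (by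
    intro x hx hcx
    rcases hS x hx with rfl | rfl | h
    exacts [absurd hcx.symm hac, rfl, absurd hcx (mem_farSet.1 h).2.2])
  obtain ⟨hC, hCi⟩ := isCycle_and_inducedWalk_cons_cons hab hbc hq hqi
    (by simp [hb, hbc.ne]) hac'.symm (by
      intro x hx hbx
      rw [Walk.support_cons, List.mem_cons] at hx
      rcases hx with rfl | hx
      · exact .inl rfl
      rcases hS x hx with rfl | rfl | h
      exacts [.inr rfl, absurd hbx hbd, absurd hbx (mem_farSet.1 h).1.2])
  exact ⟨_, _, hC, hCi, by simp, by simp, by simp⟩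

lemma exists_inducedCycle_of_path_two [Finite V] (het : EdgeTransitive G)
    (hdeg : ∀ u v, G.Adj u v → ∃ w, w ≠ v ∧ G.Adj u w) {a b c : V}
    (hab : G.Adj a b) (hbc : G.Adj b c) (hac : ¬ G.Adj a c) (hac' : a ≠ c) :
    ∃ (w : V) (C : G.Walk w w), C.IsCycle ∧ InducedWalk G C ∧
      s(a, b) ∈ C.edges ∧ s(b, c) ∈ C.edges := by
  by_cases hd : ∃ d, G.Adj c d ∧ d ≠ b ∧ ¬ G.Adj b d
  · obtain ⟨d, hcd, hdb, hbd⟩ := hd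
    have had' : a ≠ d := fun h => hbd (h ▸ hab.symm)
    by_cases had : G.Adj a d
    · obtain ⟨hp, hpi⟩ := isPath_and_inducedWalk_cons had.symm (p := Walk.nil) .nil
        (by intro x hx y hy hxy; simp_all) (by simpa using had'.symm) (by
          intro x hx _
          simpa using hx)
      obtain ⟨hq, hqi⟩ := isPath_and_inducedWalk_cons hcd hp hpi
        (by simp [hcd.ne, hac'.symm]) (by
          intro x hx hcx
          simp only [Walk.support_cons, Walk.support_nil, List.mem_cons, List.not_mem_nil,
            or_false] at hx
          rcases hx with rfl | rfl
          exacts [rfl, absurd hcx.symm hac])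
      obtain ⟨hC, hCi⟩ := isCycle_and_inducedWalk_cons_cons hab hbc hq hqi
        (by simp [hbc.ne, hdb.symm, hab.ne']) hac'.symm (by
          intro x hx hbx
          simp only [Walk.support_cons, Walk.support_nil, List.mem_cons, List.not_mem_nil,
            or_false] at hx
          rcases hx with rfl | rfl | rfl
          exacts [.inl rfl, absurd hbx hbd, .inr rfl])
      exact ⟨_, _, hC, hCi, by simp, by simp⟩
    · obtain ⟨w, C, hC, hCi, h₁, h₂, -⟩ := exists_inducedCycle_of_path_three het hab hbc hcd
        hac hbd had hac' hdb.symm had'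
      exact ⟨w, C, hC, hCi, h₁, h₂⟩
  · push Not at hd
    exfalso
    have hinv : ∀ (φ : G ≃g G) x, (insert (φ x) (G.neighborSet (φ x))).ncard =
        (insert x (G.neighborSet x)).ncard := by
      intro φ x
      rw [← Set.ncard_image_of_injective (insert x (G.neighborSet x)) φ.injective]
      congr 1
      ext y
      obtain ⟨y, rfl⟩ := φ.surjective y
      simp [φ.map_adj_iff]
    have hlt : (insert c (G.neighborSet c)).ncard < (insert b (G.neighborSet b)).ncard := by
      refine Set.ncard_lt_ncard ((Set.ssubset_iff_of_subset ?_).2 ⟨a, ?_, ?_⟩)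
      · rintro x (rfl | hx)
        · exact .inr hbc
        · by_cases hxb : x = b
          exacts [.inl hxb, .inr (hd x hx hxb)]
      · exact .inr hab.symm
      · rintro (h | h)
        exacts [hac' h, hac h.symm]
    obtain ⟨d, hdb, hcd⟩ := hdeg c b hbc.symm
    have hbd := hd d hcd hdb
    obtain ⟨φ, hφ⟩ := het s(c, b) hbc.symm s(c, d) hcd
    obtain ⟨ψ, hψ⟩ := het s(c, b) hbc.symm s(b, d) hbd
    rw [Sym2.map_mk, Sym2.eq_iff] at hφ hψ
    have h₁ := hinv φ c
    have h₂ := hinv φ b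
    have h₃ := hinv ψ c
    have h₄ := hinv ψ b
    rcases hφ with ⟨e₁, e₂⟩ | ⟨e₁, e₂⟩ <;> rcases hψ with ⟨e₃, e₄⟩ | ⟨e₃, e₄⟩ <;>
      rw [e₁] at h₁ <;> rw [e₂] at h₂ <;> rw [e₃] at h₃ <;> rw [e₄] at h₄ <;> omega

lemma exists_inducedCycle_of_adj [Finite V] (het : EdgeTransitive G)
    (hdeg : ∀ u v, G.Adj u v → ∃ w, w ≠ v ∧ G.Adj u w) {a b : V} (hab : G.Adj a b) :
    ∃ (w : V) (C : G.Walk w w), C.IsCycle ∧ InducedWalk G C ∧ s(a, b) ∈ C.edges := by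
  obtain ⟨c, hca, hbc⟩ := hdeg b a hab.symm
  by_cases hac : G.Adj a c
  · obtain ⟨hp, hpi⟩ := isPath_and_inducedWalk_cons hac.symm (p := Walk.nil) .nil
      (by intro x hx y hy hxy; simp_all) (by simpa using hca) (by
        intro x hx _
        simpa using hx)
    obtain ⟨hC, hCi⟩ := isCycle_and_inducedWalk_cons_cons hab hbc hp hpi
      (by simp [hbc.ne, hab.ne']) hca (by
        intro x hx _
        simpa using hx)
    exact ⟨_, _, hC, hCi, by simp⟩
  · obtain ⟨w, C, hC, hCi, h, -⟩ :=
      exists_inducedCycle_of_path_two het hdeg hab hbc hac hca.symm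
    exact ⟨w, C, hC, hCi, h⟩

end ClosingPaths

section Stars

lemma nonempty_iso_star [Finite V] {b : V} (h : ∀ x y, G.Adj x y ↔ (x = b ↔ y ≠ b)) :
    ∃ n : ℕ, Nonempty (G ≃g completeBipartiteGraph (Fin 1) (Fin n)) := by
  classical
  obtain ⟨n, ⟨f⟩⟩ := Finite.exists_equiv_fin {x // ¬ x = b}
  let e : V ≃ Fin 1 ⊕ Fin n :=
    (Equiv.sumCompl (· = b)).symm.trans (Equiv.sumCongr (Equiv.ofUnique _ _) f)
  have hl : ∀ x, (e x).isLeft ↔ x = b := by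
    intro x
    by_cases hx : x = b <;> simp [e, hx, Equiv.sumCompl_symm_apply_of_pos,
      Equiv.sumCompl_symm_apply_of_neg]
  refine ⟨n, ⟨⟨e, ?_⟩⟩⟩
  intro x y
  rw [h, completeBipartiteGraph_adj, ← Sum.not_isLeft, ← Sum.not_isLeft]
  have hx := hl x
  have hy := hl y
  grind

/-- A connected edge-transitive graph with a vertex of degree one is a star. -/
lemma nonempty_iso_star_of_leaf [Finite V] (hconn : G.Connected) (het : EdgeTransitive G)
    {b c : V} (hcb : G.Adj c b) (hc : ∀ d, G.Adj c d → d = b) :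
    ∃ n : ℕ, Nonempty (G ≃g completeBipartiteGraph (Fin 1) (Fin n)) := by
  have hleaf : ∀ x, G.Adj b x → ∀ y, G.Adj x y → y = b := by
    intro x hbx
    have hφ' : ∀ (φ : G ≃g G) y, G.Adj (φ c) y → y = φ b := by
      intro φ y hy
      obtain ⟨y, rfl⟩ := φ.surjective y
      rw [hc y (φ.map_adj_iff.1 hy)]
    obtain ⟨φ, hφ⟩ := het s(c, b) hcb s(b, x) hbx
    have hφ' := hφ' φ
    rw [Sym2.map_mk, Sym2.eq_iff] at hφ
    rcases hφ with ⟨e₁, e₂⟩ | ⟨e₁, e₂⟩ <;> rw [e₁, e₂] at hφ'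
    · rwa [← hφ' c hcb.symm]
    · exact hφ'
  have hall : ∀ x, x = b ∨ G.Adj b x := by
    intro x
    obtain ⟨p⟩ := hconn.preconnected x b
    induction p with
    | nil => exact .inl rfl
    | cons hxy _ ih =>
      rcases ih hcb hc hleaf with rfl | h
      · exact .inr hxy.symm
      · exact .inl (hleaf _ h _ hxy.symm)
  refine nonempty_iso_star (b := b) fun x y => ⟨fun hxy => ⟨?_, ?_⟩, fun hxy => ?_⟩
  · rintro rfl
    exact hxy.ne'
  · intro hy
    exact hleaf y ((hall y).resolve_left hy) x hxy.symm
  · by_cases hx : x = b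
    · rw [hx]
      exact (hall y).resolve_left (hxy.1 hx)
    · obtain rfl : y = b := by tauto
      exact ((hall x).resolve_left hx).symm

end Stars

end SimpleGraph

/-- In a finite connected edge-transitive graph that is not isomorphic to any
star `K_{1,n}`, every induced path of length at most 3 closes to an induced cycle. -/
theorem edgeTransitive_nonStar_inducedPath_length_le_three_closesToInducedCycle
    {V : Type*} [Fintype V] (G : SimpleGraph V)
    (hconn : G.Connected) (het : EdgeTransitive G)
    (hstar : ¬ ∃ n : ℕ, Nonempty (G ≃g completeBipartiteGraph (Fin 1) (Fin n)))
    {u v : V} (P : G.Walk u v) (hP : P.IsPath) (hind : InducedWalk G P)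
    (hlen : P.length ≤ 3) :
    ClosesToInducedCycle G P := by
  have hdeg : ∀ u v, G.Adj u v → ∃ w, w ≠ v ∧ G.Adj u w := by
    intro c b hcb
    by_contra! hno
    exact hstar (nonempty_iso_star_of_leaf hconn het hcb fun d hd => by
      by_contra hne
      exact hno d hne hd)
  match P, hP, hind, hlen with
  | .nil, _, _, _ =>
    obtain ⟨x, hx⟩ : ∃ x, G.Adj u x := by
      by_contra! hno
      have hall : ∀ x, x = u := by
        intro x
        obtain ⟨p⟩ := hconn.preconnected u x
        cases p with
        | nil => rfl
        | cons h _ => exact absurd h (hno _)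
      exact hstar (nonempty_iso_star (b := u) fun x y => by simp [hall x, hall y])
    obtain ⟨w, C, hC, hCi, h⟩ := exists_inducedCycle_of_adj het hdeg hx
    refine ⟨w, C, hC, hCi, ?_, by simp⟩
    simpa using C.fst_mem_support_of_mem_edges h
  | .cons hab .nil, _, _, _ =>
    obtain ⟨w, C, hC, hCi, h⟩ := exists_inducedCycle_of_adj het hdeg hab
    refine ⟨w, C, hC, hCi, ?_, by simpa using h⟩
    simpa using ⟨C.fst_mem_support_of_mem_edges h, C.snd_mem_support_of_mem_edges h⟩
  | .cons (v := b) hab (.cons hbc .nil), hP, hind, _ =>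
    have hne : u ≠ v := by
      rintro rfl
      simp at hP
    have huv : ¬ G.Adj u v := by
      intro h
      have := hind u (by simp) v (by simp) h
      have := hab.ne
      have := hbc.ne
      simp_all
    obtain ⟨w, C, hC, hCi, h₁, h₂⟩ :=
      exists_inducedCycle_of_path_two het hdeg hab hbc huv hne
    refine ⟨w, C, hC, hCi, ?_, by simpa using ⟨h₁, h₂⟩⟩
    simpa using ⟨C.fst_mem_support_of_mem_edges h₁, C.fst_mem_support_of_mem_edges h₂,
      C.snd_mem_support_of_mem_edges h₂⟩
  | .cons (v := b) hab (.cons (v := c) hbc (.cons hcd .nil)), hP, hind, _ =>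
    obtain ⟨⟨-, hbv⟩, -, huc, huv⟩ : (b ≠ c ∧ b ≠ v) ∧ u ≠ b ∧ u ≠ c ∧ u ≠ v := by
      simp [Walk.isPath_def] at hP
      tauto
    have hne := hab.ne
    have hne' := hbc.ne
    have hne'' := hcd.ne
    have hac : ¬ G.Adj u c := by
      intro h
      have := hind u (by simp) c (by simp) h
      simp_all
    have hbd : ¬ G.Adj b v := by
      intro h
      have := hind b (by simp) v (by simp) h
      have := huv
      simp_all
      tauto
    have had : ¬ G.Adj u v := by
      intro h
      have := hind u (by simp) v (by simp) h
      simp_all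
    obtain ⟨w, C, hC, hCi, h₁, h₂, h₃⟩ :=
      exists_inducedCycle_of_path_three het hab hbc hcd hac hbd had huc hbv huv
    refine ⟨w, C, hC, hCi, ?_, by simpa using ⟨h₁, h₂, h₃⟩⟩
    simpa using ⟨C.fst_mem_support_of_mem_edges h₁, C.fst_mem_support_of_mem_edges h₂,
      C.fst_mem_support_of_mem_edges h₃, C.snd_mem_support_of_mem_edges h₃⟩
  | .cons _ (.cons _ (.cons _ (.cons _ _))), _, _, hlen =>
    simp at hlen
    omega
end

section
/- Every path of length 3 in a finite edge-transitive simple graph closes to a cycle: if G is edge-transitive and P is a path in G with 3 edges, then there exists a cycle C in G such that every edge of P is an edge of C. -/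
open SimpleGraph

/-- `X` is a union of components of `G - b`, and `b` has neighbours both in `X` and outside `X`. -/
structure IsCutVertexSide {V : Type*} (G : SimpleGraph V) (b : V) (X : Set V) : Prop where
  notMem : b ∉ X
  closed : ∀ x ∈ X, ∀ y, G.Adj x y → y ∈ X ∨ y = b
  exists_mem : ∃ x ∈ X, G.Adj b x
  exists_notMem : ∃ x ∉ X, G.Adj b x

/-- `S` is a union of components of `G - b - c` for an edge `bc`, and `b` has neighbours both in
`S` and outside `S ∪ {c}`. -/
structure IsCutEdgeSide {V : Type*} (G : SimpleGraph V) (b c : V) (S : Set V) : Prop where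
  adj : G.Adj b c
  left_notMem : b ∉ S
  right_notMem : c ∉ S
  closed : ∀ x ∈ S, ∀ y, G.Adj x y → y ∈ S ∨ y = b ∨ y = c
  exists_mem : ∃ x ∈ S, G.Adj b x
  exists_notMem : ∃ x ∉ S, x ≠ c ∧ G.Adj b x

section

variable {V : Type*} {G : SimpleGraph V}

theorem EdgeTransitive.exists_iso_s4 (het : EdgeTransitive G) {x y u v : V}
    (hxy : G.Adj x y) (huv : G.Adj u v) :
    ∃ φ : G ≃g G, (φ x = u ∧ φ y = v) ∨ (φ x = v ∧ φ y = u) := by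
  obtain ⟨φ, hφ⟩ := het s(x, y) hxy s(u, v) huv
  exact ⟨φ, by simpa using hφ⟩

theorem IsCutVertexSide.map {b : V} {X : Set V} (h : IsCutVertexSide G b X) (φ : G ≃g G) :
    IsCutVertexSide G (φ b) (φ.symm ⁻¹' X) where
  notMem := by simpa using h.notMem
  closed x hx y hxy := by
    have := h.closed _ hx (φ.symm y) (φ.symm.map_adj_iff.2 hxy)
    rwa [φ.symm_apply_eq] at this
  exists_mem := by
    obtain ⟨x, hx, hbx⟩ := h.exists_mem
    exact ⟨φ x, by simpa using hx, φ.map_adj_iff.2 hbx⟩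
  exists_notMem := by
    obtain ⟨x, hx, hbx⟩ := h.exists_notMem
    exact ⟨φ x, by simpa using hx, φ.map_adj_iff.2 hbx⟩

theorem IsCutEdgeSide.map {b c : V} {S : Set V} (h : IsCutEdgeSide G b c S) (φ : G ≃g G) :
    IsCutEdgeSide G (φ b) (φ c) (φ.symm ⁻¹' S) where
  adj := φ.map_adj_iff.2 h.adj
  left_notMem := by simpa using h.left_notMem
  right_notMem := by simpa using h.right_notMem
  closed x hx y hxy := by
    have := h.closed _ hx (φ.symm y) (φ.symm.map_adj_iff.2 hxy)
    rwa [φ.symm_apply_eq, φ.symm_apply_eq] at this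
  exists_mem := by
    obtain ⟨x, hx, hbx⟩ := h.exists_mem
    exact ⟨φ x, by simpa using hx, φ.map_adj_iff.2 hbx⟩
  exists_notMem := by
    obtain ⟨x, hx, hxc, hbx⟩ := h.exists_notMem
    exact ⟨φ x, by simpa using hx, by simpa using hxc, φ.map_adj_iff.2 hbx⟩

theorem EdgeTransitive.exists_ne_adj (het : EdgeTransitive G) {a b c d : V}
    (hba : G.Adj b a) (hac : a ≠ c) (hbc : G.Adj b c) (hcd : G.Adj c d) (hdb : d ≠ b)
    {x y : V} (hxy : G.Adj x y) : ∃ z, z ≠ x ∧ G.Adj y z := by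
  obtain ⟨φ, ⟨rfl, rfl⟩ | ⟨rfl, rfl⟩⟩ := het.exists_iso_s4 hbc hxy
  · exact ⟨φ d, by simpa using hdb, φ.map_adj_iff.2 hcd⟩
  · exact ⟨φ a, by simpa using hac, φ.map_adj_iff.2 hba⟩

/-- If all ends of edges have degree at least two, an edge-transitive graph has no cut vertex. -/
theorem EdgeTransitive.not_isCutVertexSide [Finite V] (het : EdgeTransitive G)
    (hdeg : ∀ x y, G.Adj x y → ∃ z, z ≠ x ∧ G.Adj y z) (b : V) (X : Set V) :
    ¬ IsCutVertexSide G b X := by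
  induction X using WellFoundedLT.induction generalizing b with
  | ind X ih =>
  intro h
  obtain ⟨x, hx, hbx⟩ := h.exists_mem
  obtain ⟨x', hx'b, hxx'⟩ := hdeg b x hbx
  have hx' : x' ∈ X := (h.closed x hx x' hxx').resolve_right hx'b
  obtain ⟨z, hz, Y, hY⟩ : ∃ z ∈ X, ∃ Y, IsCutVertexSide G z Y := by
    obtain ⟨φ, ⟨hφ, -⟩ | ⟨hφ, -⟩⟩ := het.exists_iso_s4 hbx hxx'
    · exact ⟨x, hx, _, hφ ▸ h.map φ⟩
    · exact ⟨x', hx', _, hφ ▸ h.map φ⟩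
  have hbX := h.notMem
  have hzY := hY.notMem
  have hX := h.closed
  have hYc := hY.closed
  obtain ⟨p, hpY, hzp⟩ := hY.exists_mem
  obtain ⟨q, hqY, hzq⟩ := hY.exists_notMem
  have hp := hX z hz p hzp
  have hq := hX z hz q hzq
  by_cases hbY : b ∈ Y
  · refine ih (X \ (insert z Y)) ⟨Set.sdiff_subset, fun hs => (hs hz).2 (by simp)⟩ z
      ⟨by simp, ?_, ⟨q, ?_, hzq⟩, ⟨p, by simp [hpY], hzp⟩⟩
    · rintro s ⟨hsX, hs⟩ t hst
      have h1 := hX s hsX t hst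
      have h2 := hYc t
      simp only [Set.mem_insert_iff, Set.mem_sdiff] at *
      grind [hst.symm]
    · have := hzq.ne
      simp only [Set.mem_insert_iff, Set.mem_sdiff]
      grind
  · refine ih (X ∩ Y) ⟨Set.inter_subset_left, fun hs => hzY (hs hz).2⟩ z
      ⟨fun hs => hzY hs.2, ?_, ⟨p, ⟨?_, hpY⟩, hzp⟩, ⟨q, fun hs => hqY hs.2, hzq⟩⟩
    · rintro s ⟨hsX, hsY⟩ t hst
      have h1 := hX s hsX t hst
      have h2 := hYc s hsY t hst
      simp only [Set.mem_inter_iff]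
      grind
    · grind

/-- In the absence of cut vertices, a union of components of `G - b - c` that is attached to `b`
is also attached to `c`. -/
theorem exists_mem_adj_of_closed (hcut : ∀ b X, ¬ IsCutVertexSide G b X) {b c : V} {T : Set V}
    (hbc : G.Adj b c) (hb : b ∉ T) (hc : c ∉ T)
    (hT : ∀ x ∈ T, ∀ y, G.Adj x y → y ∈ T ∨ y = b ∨ y = c)
    (h : ∃ x ∈ T, G.Adj b x) : ∃ x ∈ T, G.Adj c x := by
  by_contra! hcon
  refine hcut b T ⟨hb, fun x hx y hxy => ?_, h, ⟨c, hc, hbc⟩⟩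
  have := hT x hx y hxy
  have := hcon x hx
  grind [hxy.symm]

theorem closed_compl {b c : V} {S : Set V}
    (hS : ∀ x ∈ S, ∀ y, G.Adj x y → y ∈ S ∨ y = b ∨ y = c) :
    ∀ x ∈ {x | x ∉ S ∧ x ≠ b ∧ x ≠ c}, ∀ y, G.Adj x y →
      y ∈ {x | x ∉ S ∧ x ≠ b ∧ x ≠ c} ∨ y = b ∨ y = c := by
  intro x hx y hxy
  have := hS y
  simp only [Set.mem_ofPred_eq] at *
  grind [hxy.symm]

theorem IsCutEdgeSide.symm (hcut : ∀ b X, ¬ IsCutVertexSide G b X) {b c : V} {S : Set V}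
    (h : IsCutEdgeSide G b c S) : IsCutEdgeSide G c b S where
  adj := h.adj.symm
  left_notMem := h.right_notMem
  right_notMem := h.left_notMem
  closed x hx y hxy := (h.closed x hx y hxy).imp_right Or.symm
  exists_mem := exists_mem_adj_of_closed hcut h.adj h.left_notMem h.right_notMem h.closed
    h.exists_mem
  exists_notMem := by
    obtain ⟨x, hx, hxc, hbx⟩ := h.exists_notMem
    obtain ⟨y, hy, hcy⟩ := exists_mem_adj_of_closed hcut h.adj (by simp) (by simp)
      (closed_compl h.closed) ⟨x, ⟨hx, hbx.ne', hxc⟩, hbx⟩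
    exact ⟨y, hy.1, hy.2.1, hcy⟩

/-- In an edge-transitive graph without cut vertices, no edge has ends that separate the graph. -/
theorem EdgeTransitive.not_isCutEdgeSide [Finite V] (het : EdgeTransitive G)
    (hcut : ∀ b X, ¬ IsCutVertexSide G b X) (b c : V) (S : Set V) :
    ¬ IsCutEdgeSide G b c S := by
  induction S using WellFoundedLT.induction generalizing b c with
  | ind S ih =>
  intro h
  obtain ⟨a, ha, hba⟩ := h.exists_mem
  obtain ⟨Y, hY⟩ : ∃ Y, IsCutEdgeSide G a b Y := by
    obtain ⟨φ, ⟨hb, hc⟩ | ⟨hb, hc⟩⟩ := het.exists_iso_s4 h.adj hba.symm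
    · exact ⟨_, hb ▸ hc ▸ h.map φ⟩
    · have := (h.map φ).symm hcut
      rw [hb, hc] at this
      exact ⟨_, this⟩
  have hbS := h.left_notMem
  have hcS := h.right_notMem
  have haY := hY.left_notMem
  have hbY := hY.right_notMem
  have hS := h.closed
  have hYc := hY.closed
  obtain ⟨p, hpY, hap⟩ := hY.exists_mem
  obtain ⟨q, hqY, hqb, haq⟩ := hY.exists_notMem
  have hp := hS a ha p hap
  have hq := hS a ha q haq
  by_cases hcY : c ∈ Y
  · refine ih (S \ (insert a Y)) ⟨Set.sdiff_subset, fun hs => (hs ha).2 (by simp)⟩ a b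
      ⟨hba.symm, by simp, fun hs => hbS hs.1, ?_, ⟨q, ?_, haq⟩,
        ⟨p, by simp [hpY], ?_, hap⟩⟩
    · rintro s ⟨hsS, hs⟩ t hst
      have h1 := hS s hsS t hst
      have h2 := hYc t
      simp only [Set.mem_insert_iff, Set.mem_sdiff] at *
      grind [hst.symm]
    · have := haq.ne
      simp only [Set.mem_insert_iff, Set.mem_sdiff]
      grind
    · grind
  · refine ih (S ∩ Y) ⟨Set.inter_subset_left, fun hs => haY (hs ha).2⟩ a b
      ⟨hba.symm, fun hs => haY hs.2, fun hs => hbY hs.2, ?_, ⟨p, ⟨?_, hpY⟩, hap⟩,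
        ⟨q, fun hs => hqY hs.2, hqb, haq⟩⟩
    · rintro s ⟨hsS, hsY⟩ t hst
      have h1 := hS s hsS t hst
      have h2 := hYc s hsY t hst
      simp only [Set.mem_inter_iff]
      grind
    · grind

/-- In an edge-transitive graph, the outer vertices of a path `a b c d` are joined by a walk that
avoids the inner vertices. -/
theorem EdgeTransitive.exists_walk_avoiding [Finite V] (het : EdgeTransitive G) {a b c d : V}
    (hba : G.Adj b a) (hac : a ≠ c) (hbc : G.Adj b c) (hcd : G.Adj c d) (hdb : d ≠ b) :
    ∃ p : G.Walk d a, b ∉ p.support ∧ c ∉ p.support := by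
  have hcut := het.not_isCutVertexSide fun x y hxy =>
    het.exists_ne_adj hba hac hbc hcd hdb hxy
  let S : Set V := {x | ∃ p : G.Walk x a, b ∉ p.support ∧ c ∉ p.support}
  have hb : b ∉ S := fun ⟨p, hp, _⟩ => hp p.start_mem_support
  have hc : c ∉ S := fun ⟨p, _, hp⟩ => hp p.start_mem_support
  have hS : ∀ x ∈ S, ∀ y, G.Adj x y → y ∈ S ∨ y = b ∨ y = c := by
    rintro x ⟨p, hpb, hpc⟩ y hxy
    by_cases hyb : y = b
    · exact .inr (.inl hyb)
    by_cases hyc : y = c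
    · exact .inr (.inr hyc)
    exact .inl ⟨.cons hxy.symm p, by simp [Ne.symm hyb, hpb], by simp [Ne.symm hyc, hpc]⟩
  by_contra hd
  obtain ⟨x, hx, hbx⟩ := exists_mem_adj_of_closed hcut hbc.symm (by simp) (by simp)
    (fun x hx y hxy => (closed_compl hS x hx y hxy).imp_right Or.symm)
    ⟨d, ⟨hd, hdb, hcd.ne'⟩, hcd⟩
  exact het.not_isCutEdgeSide hcut b c S
    ⟨hbc, hb, hc, hS, ⟨a, ⟨.nil, by simp [hba.ne], by simp [hac.symm]⟩, hba⟩,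
      ⟨x, hx.1, hx.2.2, hbx⟩⟩

end

/-- Every path of length 3 in a finite edge-transitive graph closes to a cycle. -/
theorem edgeTransitive_path_length_three_closesToCycle
    {V : Type*} [Fintype V] (G : SimpleGraph V) (het : EdgeTransitive G)
    {u v : V} (P : G.Walk u v) (hP : P.IsPath) (hlen : P.length = 3) :
    ClosesToCycle G P := by
  classical
  match P, hP, hlen with
  | .cons (v := b) hab (.cons (v := c) hbc (.cons (v := d) hcd .nil)), hP, _ =>
    simp only [Walk.cons_isPath_iff, Walk.support_cons, Walk.support_nil, List.mem_cons,
      List.not_mem_nil, or_false, not_or] at hP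
    obtain ⟨⟨-, -, hbd⟩, -, hac, had⟩ := hP
    obtain ⟨p, hb, hc⟩ := het.exists_walk_avoiding hab.symm hac hbc hcd (Ne.symm hbd)
    have hb' : b ∉ p.bypass.support := fun h => hb (p.support_bypass_subset_support h)
    have hc' : c ∉ p.bypass.support := fun h => hc (p.support_bypass_subset_support h)
    refine ⟨u, .cons hab (.cons hbc (.cons hcd p.bypass)), ?_, ?_⟩
    · rw [Walk.cons_isCycle_iff]
      simp only [Walk.cons_isPath_iff, Walk.support_cons, Walk.edges_cons, List.mem_cons, not_or]
      refine ⟨⟨⟨p.bypass_isPath, hc'⟩, hbc.ne, hb'⟩, ?_, ?_,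
        fun h => hb' (p.bypass.snd_mem_support_of_mem_edges h)⟩
      · simp [hac, hab.ne]
      · simp [hac, had]
    · intro e he
      simp only [Walk.edges_cons, Walk.edges_nil, List.mem_cons, List.not_mem_nil] at he ⊢
      tauto
end

section
/- Every induced path of length 3 in a finite edge-transitive simple graph closes to an induced cycle: if G is edge-transitive and P is an induced path in G with 3 edges, then there exists an induced cycle C in G such that every vertex of P is a vertex of C and every edge of P is an edge of C. -/
open SimpleGraph

namespace SimpleGraph

variable {V : Type*} {G : SimpleGraph V}

/-- The vertices joined to `v` by a walk of `G` that stays inside `X`. -/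
def reachWithin (G : SimpleGraph V) (X : Set V) (v : V) : Set V :=
  {w | ∃ p : G.Walk v w, ∀ x ∈ p.support, x ∈ X}

/-- The vertices that are neither endpoints of `e` nor adjacent to an endpoint of `e`. -/
def farFrom (G : SimpleGraph V) (e : Sym2 V) : Set V :=
  {x | ∀ y ∈ e, x ≠ y ∧ ¬ G.Adj y x}

lemma mem_farFrom_mk {b c x : V} :
    x ∈ G.farFrom s(b, c) ↔ (x ≠ b ∧ ¬ G.Adj b x) ∧ (x ≠ c ∧ ¬ G.Adj c x) := by
  simp [farFrom]

lemma reachWithin_subset (X : Set V) (v : V) : G.reachWithin X v ⊆ X :=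
  fun _ ⟨p, hp⟩ => hp _ p.end_mem_support

lemma mem_of_mem_reachWithin {X : Set V} {v w : V} (h : w ∈ G.reachWithin X v) : v ∈ X :=
  let ⟨p, hp⟩ := h
  hp _ p.start_mem_support

lemma self_mem_reachWithin {X : Set V} {v : V} (h : v ∈ X) : v ∈ G.reachWithin X v :=
  ⟨Walk.nil, by simpa using h⟩

lemma reachWithin_mono {X Y : Set V} (h : X ⊆ Y) (v : V) :
    G.reachWithin X v ⊆ G.reachWithin Y v :=
  fun _ ⟨p, hp⟩ => ⟨p, fun x hx => h (hp x hx)⟩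

lemma mem_reachWithin_symm {X : Set V} {v w : V} (h : w ∈ G.reachWithin X v) :
    v ∈ G.reachWithin X w :=
  let ⟨p, hp⟩ := h
  ⟨p.reverse, by simpa using hp⟩

lemma mem_reachWithin_trans {X : Set V} {u v w : V} (h₁ : v ∈ G.reachWithin X u)
    (h₂ : w ∈ G.reachWithin X v) : w ∈ G.reachWithin X u := by
  obtain ⟨p, hp⟩ := h₁
  obtain ⟨q, hq⟩ := h₂
  refine ⟨p.append q, fun x hx => ?_⟩
  rcases (Walk.mem_support_append_iff _ _).1 hx with h | h
  exacts [hp x h, hq x h]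

lemma Adj.mem_reachWithin {X : Set V} {v w : V} (h : G.Adj v w) (hv : v ∈ X) (hw : w ∈ X) :
    w ∈ G.reachWithin X v :=
  ⟨h.toWalk, by simp [hv, hw]⟩

lemma reachWithin_subset_reachWithin {X Y : Set V} {v : V} (h : G.reachWithin X v ⊆ Y) :
    G.reachWithin X v ⊆ G.reachWithin Y v := by
  rintro w ⟨p, hp⟩
  refine ⟨p, fun x hx => h ?_⟩
  classical
  exact ⟨p.takeUntil x hx, fun y hy => hp y (p.support_takeUntil_subset_support hx hy)⟩

lemma image_reachWithin_subset (φ : G ≃g G) (X : Set V) (v : V) :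
    φ '' G.reachWithin X v ⊆ G.reachWithin (φ '' X) (φ v) := by
  rintro _ ⟨w, ⟨p, hp⟩, rfl⟩
  refine ⟨p.map φ.toHom, fun x hx => ?_⟩
  rw [Walk.support_map, List.mem_map] at hx
  obtain ⟨y, hy, rfl⟩ := hx
  exact ⟨y, hp y hy, rfl⟩

lemma image_farFrom_subset (φ : G ≃g G) (e : Sym2 V) :
    φ '' G.farFrom e ⊆ G.farFrom (e.map φ) := by
  rintro _ ⟨x, hx, rfl⟩ y hy
  obtain ⟨z, hz, rfl⟩ := Sym2.mem_map.1 hy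
  simpa [φ.map_adj_iff] using hx z hz

/-- The vertices lying in a component of `G - N[e]` with at least `t` vertices. -/
def inLargeComponent (G : SimpleGraph V) (e : Sym2 V) (t : ℕ) : Set V :=
  {v | v ∈ G.farFrom e ∧ t ≤ (G.reachWithin (G.farFrom e) v).ncard}

lemma ncard_inLargeComponent_le_map [Finite V] (φ : G ≃g G) (e : Sym2 V) (t : ℕ) :
    (G.inLargeComponent e t).ncard ≤ (G.inLargeComponent (e.map φ) t).ncard := by
  rw [← Set.ncard_image_of_injective _ φ.injective]
  refine Set.ncard_le_ncard ?_
  rintro _ ⟨v, ⟨hv, hn⟩, rfl⟩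
  refine ⟨image_farFrom_subset φ e ⟨v, hv, rfl⟩, hn.trans ?_⟩
  rw [← Set.ncard_image_of_injective _ φ.injective]
  exact Set.ncard_le_ncard ((image_reachWithin_subset φ _ v).trans
    (reachWithin_mono (image_farFrom_subset φ e) _))

/-- If `a` and `d` are separated by the closed neighbourhood of `bc` in the induced path
`a b c d`, then the component of `d` is smaller than that of `a`. -/
lemma ncard_reachWithin_lt_of_separated [Finite V] (het : EdgeTransitive G) {a b c d : V}
    (hab : G.Adj a b) (hbc : G.Adj b c) (hcd : G.Adj c d)
    (hac : ¬ G.Adj a c) (hbd : ¬ G.Adj b d) (had : ¬ G.Adj a d)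
    (had' : a ≠ d) (hbd' : b ≠ d)
    (hsep : d ∉ G.reachWithin (insert a (insert d (G.farFrom s(b, c)))) a) :
    (G.reachWithin (insert d (G.farFrom s(b, c))) d).ncard <
      (G.reachWithin (insert a (G.farFrom s(b, c))) a).ncard := by
  set X := G.farFrom s(b, c)
  by_contra! hle
  set t := (G.reachWithin (insert d X) d).ncard
  have haX : a ∉ X := fun h => (mem_farFrom_mk.1 h).1.2 hab.symm
  have hdX : d ∉ X := fun h => (mem_farFrom_mk.1 h).2.2 hcd
  have hd : G.reachWithin (insert d X) d ⊆ G.farFrom s(a, b) := by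
    intro y hy
    have hyX := reachWithin_subset _ _ hy
    have hay : ¬ G.Adj a y := fun h => hsep <| mem_reachWithin_trans
      (h.mem_reachWithin (Set.mem_insert _ _) (Set.mem_insert_of_mem _ hyX))
      (mem_reachWithin_symm (reachWithin_mono (Set.subset_insert _ _) _ hy))
    refine mem_farFrom_mk.2 ⟨⟨?_, hay⟩, ?_⟩
    · rintro rfl
      exact hyX.elim had' haX
    · rcases hyX with rfl | h
      exacts [⟨hbd'.symm, hbd⟩, (mem_farFrom_mk.1 h).1]
  have hsub : G.inLargeComponent s(b, c) t ⊂ G.inLargeComponent s(a, b) t := by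
    refine Set.ssubset_iff_exists.2 ⟨?_, d, ⟨?_, ?_⟩, fun h => hdX h.1⟩
    · rintro v ⟨hv, hvt⟩
      have hsub' : G.reachWithin X v ⊆ G.farFrom s(a, b) := by
        intro y hy
        have hyX := reachWithin_subset _ _ hy
        refine mem_farFrom_mk.2 ⟨⟨fun h => haX (h ▸ hyX), fun h => ?_⟩,
          (mem_farFrom_mk.1 hyX).1⟩
        have hlt : (G.reachWithin X v).ncard < (G.reachWithin (insert a X) a).ncard := by
          refine Set.ncard_lt_ncard (Set.ssubset_iff_exists.2 ⟨fun z hz => ?_, a,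
            self_mem_reachWithin (Set.mem_insert _ _), fun h => haX (reachWithin_subset _ _ h)⟩)
          exact mem_reachWithin_trans
            (h.mem_reachWithin (Set.mem_insert _ _) (Set.mem_insert_of_mem _ hyX))
            (reachWithin_mono (Set.subset_insert _ _) _
              (mem_reachWithin_trans (mem_reachWithin_symm hy) hz))
        exact (hvt.trans_lt hlt).not_ge hle
      exact ⟨hsub' (self_mem_reachWithin hv),
        hvt.trans (Set.ncard_le_ncard (reachWithin_subset_reachWithin hsub'))⟩
    · exact hd (self_mem_reachWithin (Set.mem_insert _ _))
    · exact Set.ncard_le_ncard (reachWithin_subset_reachWithin hd)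
  obtain ⟨φ, hφ⟩ := het s(a, b) hab s(b, c) hbc
  have h₁ := ncard_inLargeComponent_le_map φ s(a, b) t
  rw [hφ] at h₁
  exact h₁.not_gt (Set.ncard_lt_ncard hsub)

lemma mem_reachWithin_of_inducedPath [Finite V] (het : EdgeTransitive G) {a b c d : V}
    (hab : G.Adj a b) (hbc : G.Adj b c) (hcd : G.Adj c d)
    (hac : ¬ G.Adj a c) (hbd : ¬ G.Adj b d) (had : ¬ G.Adj a d)
    (had' : a ≠ d) (hac' : a ≠ c) (hbd' : b ≠ d) :
    d ∈ G.reachWithin (insert a (insert d (G.farFrom s(b, c)))) a := by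
  by_contra hsep
  have h₁ := ncard_reachWithin_lt_of_separated het hab hbc hcd hac hbd had had' hbd' hsep
  have h₂ := ncard_reachWithin_lt_of_separated het hcd.symm hbc.symm hab.symm
    (fun h => hbd h.symm) (fun h => hac h.symm) (fun h => had h.symm) had'.symm hac'.symm
    (fun h => hsep (by
      rw [Sym2.eq_swap, Set.insert_comm]
      exact mem_reachWithin_symm h))
  rw [Sym2.eq_swap] at h₂
  exact lt_asymm h₁ h₂

lemma Walk.exists_eq_append_append {u v x y : V} (p : G.Walk u v) (hx : x ∈ p.support)
    (hy : y ∈ p.support) :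
    (∃ (p₁ : G.Walk u x) (p₂ : G.Walk x y) (p₃ : G.Walk y v), p = p₁.append (p₂.append p₃)) ∨
    ∃ (p₁ : G.Walk u y) (p₂ : G.Walk y x) (p₃ : G.Walk x v), p = p₁.append (p₂.append p₃) := by
  obtain ⟨q, r, rfl⟩ := Walk.mem_support_iff_exists_append.1 hx
  rcases (Walk.mem_support_append_iff _ _).1 hy with h | h
  · obtain ⟨q₁, q₂, rfl⟩ := Walk.mem_support_iff_exists_append.1 h
    exact .inr ⟨q₁, q₂, r, by simp [Walk.append_assoc]⟩
  · obtain ⟨r₁, r₂, rfl⟩ := Walk.mem_support_iff_exists_append.1 h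
    exact .inl ⟨q, r₁, r₂, rfl⟩

/-- A shortest walk inside `X` is an induced path. -/
lemma exists_inducedWalk_isPath_of_mem_reachWithin {X : Set V} {u v : V}
    (h : v ∈ G.reachWithin X u) :
    ∃ p : G.Walk u v, p.IsPath ∧ InducedWalk G p ∧ ∀ x ∈ p.support, x ∈ X := by
  classical
  have hex : ∃ n, ∃ p : G.Walk u v, p.length = n ∧ ∀ x ∈ p.support, x ∈ X :=
    let ⟨p, hp⟩ := h
    ⟨_, p, rfl, hp⟩
  obtain ⟨q, hq, hqX⟩ := Nat.find_spec hex
  have hmin : ∀ r : G.Walk u v, (∀ x ∈ r.support, x ∈ X) → q.length ≤ r.length :=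
    fun r hr => hq ▸ Nat.find_min' hex ⟨r, rfl, hr⟩
  set p := q.bypass
  have hpX : ∀ x ∈ p.support, x ∈ X := fun x hx => hqX x (q.support_bypass_subset_support hx)
  have hpmin : ∀ r : G.Walk u v, (∀ x ∈ r.support, x ∈ X) → p.length ≤ r.length :=
    fun r hr => q.length_bypass_le_length.trans (hmin r hr)
  have key : ∀ {x y : V} (p₁ : G.Walk u x) (p₂ : G.Walk x y) (p₃ : G.Walk y v), G.Adj x y →
      p = p₁.append (p₂.append p₃) → s(x, y) ∈ p.edges := by
    intro x y p₁ p₂ p₃ hxy he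
    have hle := hpmin (p₁.append (Walk.cons hxy p₃)) (fun z hz => hpX z (by
      rw [he]
      simp only [Walk.mem_support_append_iff, Walk.support_cons, List.mem_cons] at hz ⊢
      rcases hz with h | rfl | h
      exacts [.inl h, .inr (.inl p₂.start_mem_support), .inr (.inr h)]))
    rw [he] at hle ⊢
    simp only [Walk.length_append, Walk.length_cons] at hle
    cases p₂ with
    | nil => exact (hxy.ne rfl).elim
    | cons hxz r =>
      cases r with
      | nil => simp
      | cons _ _ => simp only [Walk.length_cons] at hle; omega
  refine ⟨p, q.bypass_isPath, fun x hx y hy hxy => ?_, hpX⟩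
  rcases p.exists_eq_append_append hx hy with ⟨p₁, p₂, p₃, he⟩ | ⟨p₁, p₂, p₃, he⟩
  · exact key p₁ p₂ p₃ hxy he
  · rw [Sym2.eq_swap]
    exact key p₁ p₂ p₃ hxy.symm he

end SimpleGraph

/-- Every induced path of length 3 in a finite edge-transitive graph closes to
an induced cycle. -/
theorem edgeTransitive_inducedPath_length_three_closesToInducedCycle
    {V : Type*} [Fintype V] (G : SimpleGraph V) (het : EdgeTransitive G)
    {u v : V} (P : G.Walk u v) (hP : P.IsPath) (hind : InducedWalk G P)
    (hlen : P.length = 3) :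
    ClosesToInducedCycle G P := by
  cases P with
  | nil => simp at hlen
  | @cons a b _ hab P =>
  cases P with
  | nil => simp at hlen
  | @cons _ c _ hbc P =>
  cases P with
  | nil => simp at hlen
  | @cons _ d _ hcd P =>
  cases P with
  | cons _ _ => simp at hlen
  | nil =>
  simp only [Walk.cons_isPath_iff, Walk.support_cons, Walk.support_nil, List.mem_cons,
    List.not_mem_nil, or_false, not_or] at hP
  obtain ⟨⟨⟨-, hcd'⟩, hbc', hbd'⟩, hab', hac', had'⟩ := hP
  have hac : ¬ G.Adj u c := fun h => by
    have := hind u (by simp) c (by simp) h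
    simp at this
    grind
  have hbd : ¬ G.Adj b v := fun h => by
    have := hind b (by simp) v (by simp) h
    simp at this
    grind
  have had : ¬ G.Adj u v := fun h => by
    have := hind u (by simp) v (by simp) h
    simp at this
    grind
  obtain ⟨p, hp, hpi, hpX⟩ := exists_inducedWalk_isPath_of_mem_reachWithin
    (mem_reachWithin_of_inducedPath het hab hbc hcd hac hbd had had' hac' hbd')
  have hpb : ∀ x ∈ p.support, x ≠ b ∧ (G.Adj b x → x = u) := by
    intro x hx
    rcases hpX x hx with rfl | rfl | h
    · exact ⟨hab', fun _ => rfl⟩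
    · exact ⟨Ne.symm hbd', fun h => (hbd h).elim⟩
    · exact ⟨(mem_farFrom_mk.1 h).1.1, fun h' => ((mem_farFrom_mk.1 h).1.2 h').elim⟩
  have hpc : ∀ x ∈ p.support, x ≠ c ∧ (G.Adj c x → x = v) := by
    intro x hx
    rcases hpX x hx with rfl | rfl | h
    · exact ⟨hac', fun h => (hac h.symm).elim⟩
    · exact ⟨Ne.symm hcd', fun _ => rfl⟩
    · exact ⟨(mem_farFrom_mk.1 h).2.1, fun h' => ((mem_farFrom_mk.1 h).2.2 h').elim⟩
  have hu := p.start_mem_support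
  have hv := p.end_mem_support
  refine ⟨b, Walk.cons hab.symm ((p.concat hcd.symm).concat hbc.symm), ?_, ?_, ?_, ?_⟩
  · rw [Walk.cons_isCycle_iff]
    refine ⟨(hp.concat (fun h => (hpc c h).1 rfl) _).concat ?_ _, ?_⟩
    · simp only [Walk.support_concat, List.mem_append, List.mem_singleton]
      rintro (h | h)
      exacts [(hpb b h).1 rfl, hbc' h]
    · simp only [Walk.edges_concat, List.concat_eq_append, List.mem_append, List.mem_singleton]
      rintro ((h | h) | h)
      · exact (hpb b (p.fst_mem_support_of_mem_edges h)).1 rfl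
      · grind
      · grind
  · intro x hx y hy hxy
    simp only [Walk.support_cons, Walk.support_concat, List.mem_append,
      List.mem_cons] at hx hy
    simp only [Walk.edges_cons, Walk.edges_concat, List.concat_eq_append, List.mem_append,
      List.mem_cons]
    have hx' : x = b ∨ x = c ∨ x ∈ p.support := by tauto
    have hy' : y = b ∨ y = c ∨ y ∈ p.support := by tauto
    rcases hx' with rfl | rfl | hx' <;> rcases hy' with rfl | rfl | hy'
    · exact (hxy.ne rfl).elim
    · simp
    · simp [(hpb y hy').2 hxy]
    · simp
    · exact (hxy.ne rfl).elim
    · simp [(hpc y hy').2 hxy]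
    · simp [(hpb x hx').2 hxy.symm]
    · simp [(hpc x hx').2 hxy.symm]
    · exact .inr (.inl (.inl (hpi x hx' y hy' hxy)))
  · simp [Walk.support_concat, hu, hv]
  · simp [Walk.edges_concat, Sym2.eq_swap]
end

section
/- Let G be a finite connected 3-regular simple graph such that for every set S of at most 2 vertices, the graph obtained from G by deleting the vertices of S is connected (i.e., G is 3-connected). Then every path in G of length at most 4 closes to a cycle. -/
open SimpleGraph

namespace SimpleGraph

variable {V : Type*} {G : SimpleGraph V}

/-- A path closes to a cycle as soon as its endpoints are joined by a path avoiding its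
interior. -/
theorem Walk.IsPath.closesToCycle {u v : V} {P : G.Walk u v} {Q : G.Walk v u}
    (hP : P.IsPath) (hQ : Q.IsPath) (hlen : 1 < P.length)
    (hPQ : ∀ x ∈ P.support, x ∈ Q.support → x = u ∨ x = v) : ClosesToCycle G P := by
  refine ⟨u, P.append Q, hP.isCycle_append hQ ?_ (.inl hlen), fun e he ↦ ?_⟩
  · intro x hxP hxQ
    have hu : u ∉ P.support.tail := by
      have h := hP.support_nodup
      rw [← P.cons_tail_support] at h
      exact (List.nodup_cons.1 h).1
    have hv : v ∉ Q.support.tail := by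
      have h := hQ.support_nodup
      rw [← Q.cons_tail_support] at h
      exact (List.nodup_cons.1 h).1
    rcases hPQ x (List.mem_of_mem_tail hxP) (List.mem_of_mem_tail hxQ) with rfl | rfl
    · exact hu hxP
    · exact hv hxQ
  · rw [Walk.edges_append]
    exact List.mem_append_left _ he

/-- Two vertices of a connected induced subgraph are joined by a path inside it which avoids
every other given vertex having at most one neighbour in that subgraph. -/
theorem Preconnected.exists_isPath_of_induce {s : Set V} (hs : (G.induce s).Preconnected)
    {u v : V} (hu : u ∈ s) (hv : v ∈ s) :
    ∃ Q : G.Walk u v, Q.IsPath ∧ (∀ x ∈ Q.support, x ∈ s) ∧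
      ∀ x, x ≠ u → x ≠ v → {y ∈ s | G.Adj x y}.Subsingleton → x ∉ Q.support := by
  obtain ⟨q, hq⟩ := hs.exists_isPath ⟨u, hu⟩ ⟨v, hv⟩
  obtain ⟨Q, hQ, hQq⟩ : ∃ Q : G.Walk u v, Q.IsPath ∧ Q.support = q.support.map Subtype.val :=
    ⟨q.map (Embedding.induce s).toHom, hq.map Subtype.val_injective, Walk.support_map _ _⟩
  refine ⟨Q, hQ, ?_, ?_⟩
  · intro x hx
    rw [hQq, List.mem_map] at hx
    obtain ⟨y, -, rfl⟩ := hx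
    exact y.2
  · intro x hxu hxv hx hxq
    rw [hQq, List.mem_map] at hxq
    obtain ⟨y, hyq, rfl⟩ := hxq
    refine hq.isTrail.not_mem_support_of_subsingleton_neighborSet ?_ ?_ ?_ hyq
    · rintro rfl
      exact hxu rfl
    · rintro rfl
      exact hxv rfl
    · exact fun a ha b hb ↦ Subtype.ext (hx ⟨a.2, ha⟩ ⟨b.2, hb⟩)

/-- A vertex of degree at most three has at most one neighbour besides two given ones. -/
theorem subsingleton_adj_compl_pair [Fintype V] [DecidableRel G.Adj] {b c d : V}
    (hdeg : G.degree c ≤ 3) (hb : G.Adj c b) (hd : G.Adj c d) (hbd : b ≠ d) :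
    {y ∈ ({b, d} : Set V)ᶜ | G.Adj c y}.Subsingleton := by
  classical
  rintro x ⟨hx, hcx⟩ y ⟨hy, hcy⟩
  by_contra hxy
  simp only [Set.mem_compl_iff, Set.mem_insert_iff, Set.mem_singleton_iff, not_or] at hx hy
  have hsub : ({b, d, x, y} : Finset V) ⊆ G.neighborFinset c := by
    intro z hz
    simp only [Finset.mem_insert, Finset.mem_singleton] at hz
    rw [mem_neighborFinset]
    rcases hz with rfl | rfl | rfl | rfl <;> assumption
  have hcard := Finset.card_le_card hsub
  rw [card_neighborFinset_eq_degree] at hcard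
  have hfour : ({b, d, x, y} : Finset V).card = 4 := by grind
  omega

/-- A vertex of degree at least two has a neighbour different from a given vertex. -/
theorem exists_adj_ne_of_two_le_degree [Fintype V] [DecidableRel G.Adj] {u : V}
    (hdeg : 2 ≤ G.degree u) (v : V) : ∃ w, G.Adj u w ∧ w ≠ v := by
  rw [← card_neighborFinset_eq_degree] at hdeg
  obtain ⟨w, hw, hwv⟩ := Finset.exists_mem_ne hdeg v
  exact ⟨w, by simpa using hw, hwv⟩

end SimpleGraph

/-- In a finite connected 3-regular 3-connected graph, every path of length at
most 4 closes to a cycle. -/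
theorem cubic_threeConnected_path_length_le_four_closesToCycle
    {V : Type*} [Fintype V] (G : SimpleGraph V) [DecidableRel G.Adj]
    (hconn : G.Connected) (hreg : ∀ v : V, G.degree v = 3)
    (h3conn : ∀ S : Finset V, S.card ≤ 2 → (G.induce ((↑S : Set V)ᶜ)).Connected)
    {u v : V} (P : G.Walk u v) (hP : P.IsPath) (hlen : P.length ≤ 4) :
    ClosesToCycle G P := by
  classical
  have two : ∀ {a b c : V} (hab : G.Adj a b) (hbc : G.Adj b c), a ≠ c →
      ClosesToCycle G (.cons hab (.cons hbc .nil)) := by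
    intro a b c hab hbc hac
    obtain ⟨Q, hQ, hQs, -⟩ := (h3conn {b} (by simp)).preconnected.exists_isPath_of_induce
      (u := c) (v := a) (by simpa using hbc.ne') (by simpa using hab.ne)
    refine Walk.IsPath.closesToCycle (Q := Q) ?_ hQ (by simp) fun x hx hxQ ↦ ?_
    · simp [hab.ne, hac, hbc.ne]
    · have := hQs x hxQ
      simp at hx this
      tauto
  have one : ∀ {a b : V} (hab : G.Adj a b), ClosesToCycle G (.cons hab .nil) := by
    intro a b hab
    obtain ⟨c, hac, hcb⟩ := exists_adj_ne_of_two_le_degree (G := G) (u := a)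
      (by rw [hreg]; omega) b
    obtain ⟨w, C, hC, hPC⟩ := two hac.symm hab hcb
    exact ⟨w, C, hC, fun e he ↦ hPC e (by simp at he ⊢; exact .inr he)⟩
  match P, hP, hlen with
  | .nil, _, _ =>
    obtain ⟨c, hc, -⟩ := exists_adj_ne_of_two_le_degree (G := G) (u := u)
      (by rw [hreg]; omega) u
    obtain ⟨w, C, hC, -⟩ := one hc
    exact ⟨w, C, hC, by simp⟩
  | .cons hab .nil, _, _ => exact one hab
  | .cons hab (.cons hbc .nil), hP, _ =>
    refine two hab hbc ?_
    simp at hP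
    tauto
  | .cons (v := b) hab (.cons (v := c) hbc (.cons hcd .nil)), hP, _ =>
    have hP' := hP
    simp at hP'
    obtain ⟨Q, hQ, hQs, -⟩ :=
      (h3conn {b, c} Finset.card_le_two).preconnected.exists_isPath_of_induce
        (u := v) (v := u) (by simp; grind) (by simp; grind)
    refine hP.closesToCycle hQ (by simp) fun x hx hxQ ↦ ?_
    have := hQs x hxQ
    simp at hx this
    tauto
  | .cons (v := b) hab (.cons (v := c) hbc (.cons (v := d) hcd (.cons hde .nil))), hP, _ =>
    have hP' := hP
    simp at hP'
    obtain ⟨Q, hQ, hQs, hQc⟩ :=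
      (h3conn {b, d} Finset.card_le_two).preconnected.exists_isPath_of_induce
        (u := v) (v := u) (by simp; grind) (by simp; grind)
    have hc : c ∉ Q.support := by
      refine hQc c (by grind) (by grind) ?_
      rw [Finset.coe_pair]
      exact subsingleton_adj_compl_pair (hreg c).le hbc.symm hcd (by grind)
    refine hP.closesToCycle hQ (by simp) fun x hx hxQ ↦ ?_
    have := hQs x hxQ
    simp at hx this
    grind
  | .cons _ (.cons _ (.cons _ (.cons _ (.cons _ _)))), _, hlen =>
    simp at hlen
    omega
end

section
/- Let d ≥ 4 and let G be a finite connected d-regular simple graph such that for every set S of at most 3 vertices, the graph obtained from G by deleting the vertices of S is connected (i.e., G is 4-connected). Then every path in G of length at most 4 closes to a cycle. -/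
open SimpleGraph

namespace SimpleGraph.Walk

variable {V : Type*} {G : SimpleGraph V}

/-- A path with at least one internal vertex, together with a path joining its endpoints and
avoiding its internal vertices, closes to a cycle. -/
theorem IsPath.closesToCycle_of_isPath_of_internallyDisjoint {u v : V} {P Q : G.Walk u v}
    (hP : P.IsPath) (hQ : Q.IsPath) (hlen : 2 ≤ P.length)
    (hdisj : ∀ x ∈ P.support, x ∈ Q.support → x = u ∨ x = v) : ClosesToCycle G P := by
  have hdisj' : P.support.tail.Disjoint Q.reverse.support.tail := by
    have hPn := hP.support_nodup
    have hQn := hQ.reverse.support_nodup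
    rw [← cons_tail_support, List.nodup_cons] at hPn hQn
    intro x hxP hxQ
    have hxQ' : x ∈ Q.support := by simpa using List.mem_of_mem_tail hxQ
    rcases hdisj x (List.mem_of_mem_tail hxP) hxQ' with rfl | rfl
    · exact hPn.1 hxP
    · exact hQn.1 hxQ
  exact ⟨u, P.append Q.reverse, hP.isCycle_append hQ.reverse hdisj' (Or.inl hlen),
    fun e he ↦ by simp [edges_append, he]⟩

/-- A path can be prolonged at its end when the degree there exceeds the length of the path. -/
theorem IsPath.exists_isPath_concat_of_length_lt_degree {u v : V} {P : G.Walk u v}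
    [Fintype (G.neighborSet v)] (hP : P.IsPath) (hlt : P.length < G.degree v) :
    ∃ (w : V) (h : G.Adj v w), (P.concat h).IsPath := by
  classical
  by_contra! hno
  have hsub : G.neighborFinset v ⊆ P.support.toFinset.erase v := by
    intro w hw
    rw [mem_neighborFinset] at hw
    refine Finset.mem_erase.2 ⟨hw.ne', List.mem_toFinset.2 ?_⟩
    by_contra hwP
    exact hno w hw (hP.concat hwP hw)
  have hcard := Finset.card_le_card hsub
  rw [card_neighborFinset_eq_degree, Finset.card_erase_of_mem (by simp),
    List.toFinset_card_of_nodup hP.support_nodup, length_support] at hcard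
  omega

/-- If deleting at most `k` vertices never disconnects `G`, then every path of length between `2`
and `k + 1` closes to a cycle. -/
theorem IsPath.closesToCycle_of_connected_induce_compl {k : ℕ}
    (hconn : ∀ S : Finset V, S.card ≤ k → (G.induce ((↑S : Set V)ᶜ)).Connected)
    {u v : V} {P : G.Walk u v} (hP : P.IsPath) (hlen : 2 ≤ P.length)
    (hlen' : P.length ≤ k + 1) : ClosesToCycle G P := by
  classical
  have huv : u ≠ v := by
    rintro rfl
    have := (isPath_iff_nil.1 hP).length_eq_zero
    omega
  let S := (P.support.toFinset.erase u).erase v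
  have hcard : S.card ≤ k := by
    rw [Finset.card_erase_of_mem (by simp [huv.symm]), Finset.card_erase_of_mem (by simp),
      List.toFinset_card_of_nodup hP.support_nodup, length_support]
    omega
  obtain ⟨Q, hQ⟩ := (hconn S hcard).exists_isPath
    (⟨u, by simp [S]⟩ : ((↑S : Set V)ᶜ : Set V)) ⟨v, by simp [S]⟩
  let f := (Embedding.induce (G := G) ((↑S : Set V)ᶜ)).toHom
  refine hP.closesToCycle_of_isPath_of_internallyDisjoint (Q := Q.map f)
    (hQ.map Subtype.val_injective) hlen fun x hxP hxQ ↦ ?_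
  change x ∈ (Q.map f).support at hxQ
  rw [support_map, List.mem_map] at hxQ
  obtain ⟨y, -, rfl⟩ := hxQ
  have hy : (y : V) ∉ S := y.2
  by_contra! hne
  exact hy (Finset.mem_erase.2 ⟨hne.2, Finset.mem_erase.2 ⟨hne.1, List.mem_toFinset.2 hxP⟩⟩)

end SimpleGraph.Walk

theorem ClosesToCycle.of_concat {V : Type*} {G : SimpleGraph V} {u v w : V} {P : G.Walk u v}
    {h : G.Adj v w} (hc : ClosesToCycle G (P.concat h)) : ClosesToCycle G P := by
  obtain ⟨x, C, hC, hsub⟩ := hc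
  exact ⟨x, C, hC, fun e he ↦ hsub e (by simp [Walk.edges_concat, he])⟩

/-- For `d ≥ 4`, in a finite connected `d`-regular 4-connected graph, every path
of length at most 4 closes to a cycle. -/
theorem regular_fourConnected_path_length_le_four_closesToCycle
    {V : Type*} [Fintype V] (G : SimpleGraph V) [DecidableRel G.Adj]
    (d : ℕ) (hd : 4 ≤ d)
    (hconn : G.Connected) (hreg : ∀ v : V, G.degree v = d)
    (h4conn : ∀ S : Finset V, S.card ≤ 3 → (G.induce ((↑S : Set V)ᶜ)).Connected)
    {u v : V} (P : G.Walk u v) (hP : P.IsPath) (hlen : P.length ≤ 4) :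
    ClosesToCycle G P := by
  by_cases h2 : 2 ≤ P.length
  · exact hP.closesToCycle_of_connected_induce_compl h4conn h2 hlen
  obtain ⟨w, h, hQ⟩ := hP.exists_isPath_concat_of_length_lt_degree (by rw [hreg]; omega)
  have hQlen : (P.concat h).length = P.length + 1 := P.length_concat h
  obtain ⟨x, h', hR⟩ := hQ.exists_isPath_concat_of_length_lt_degree (by rw [hreg]; omega)
  have hRlen : ((P.concat h).concat h').length = P.length + 2 := by
    rw [Walk.length_concat, hQlen]
  exact (hR.closesToCycle_of_connected_induce_compl h4conn (by omega) (by omega)).of_concat.of_concat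
end

section
/- For every integer n ≥ 8, the circulant graph Circ(n, {±1, ±2}) is vertex-transitive and contains a path of length 5 that does not close to any cycle; concretely, (0, n−2, n−1, 1, 2, 3) is such a path. -/
open SimpleGraph

/-- A cycle containing two distinct edges at `v` has no further edge at `v`. -/
theorem SimpleGraph.Walk.IsCycle.eq_or_eq_of_mem_edges {V : Type*} {G : SimpleGraph V} {w : V}
    {C : G.Walk w w} (hC : C.IsCycle) {v a b x : V} (hab : a ≠ b)
    (ha : s(v, a) ∈ C.edges) (hb : s(v, b) ∈ C.edges) (hx : s(v, x) ∈ C.edges) :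
    x = a ∨ x = b := by
  have h2 := hC.ncard_neighborSet_toSubgraph_eq_two (C.fst_mem_support_of_mem_edges ha)
  obtain ⟨p, q, -, h⟩ := Set.ncard_eq_two.mp h2
  have key : ∀ y, s(v, y) ∈ C.edges → y = p ∨ y = q := by
    intro y hy
    have : y ∈ C.toSubgraph.neighborSet v := by
      rwa [Subgraph.mem_neighborSet, C.adj_toSubgraph_iff_mem_edges]
    simpa [h] using this
  grind

/-- A cycle containing an edge at `v` contains another edge at `v`. -/
theorem SimpleGraph.Walk.IsCycle.exists_ne_mem_edges {V : Type*} {G : SimpleGraph V} {w : V}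
    {C : G.Walk w w} (hC : C.IsCycle) {v a : V} (ha : s(v, a) ∈ C.edges) :
    ∃ x, x ≠ a ∧ s(v, x) ∈ C.edges := by
  have h2 := hC.ncard_neighborSet_toSubgraph_eq_two (C.fst_mem_support_of_mem_edges ha)
  obtain ⟨x, hx, hxa⟩ := Set.exists_ne_of_one_lt_ncard (h2 ▸ one_lt_two) a
  exact ⟨x, hxa, C.adj_toSubgraph_iff_mem_edges.mp hx⟩

/-- Translations act transitively on the vertices of a circulant graph. -/
theorem vertexTransitive_circulantGraph {A : Type*} [AddCommGroup A] (s : Set A) :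
    VertexTransitive (circulantGraph s) := fun u v =>
  ⟨⟨Equiv.addRight (v - u), by simp [circulantGraph_adj]⟩, by simp⟩

theorem ZMod.natCast_ne_zero_of_pos_of_lt {n k : ℕ} (hk : 0 < k) (hkn : k < n) :
    (k : ZMod n) ≠ 0 := by
  rw [Ne, ZMod.natCast_eq_zero_iff]
  exact Nat.not_dvd_of_pos_of_lt hk hkn

/-- In a commutative ring where `0, -2, -1, 1, 2, 3` are distinct, the path through these vertices
does not close to a cycle in the circulant graph with jumps `1` and `2`: all four neighbors of `0`
are inner vertices of the path. -/
theorem exists_path_not_closesToCycle_circulantGraph_one_two {R : Type*} [CommRing R]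
    (h1 : (1 : R) ≠ 0) (h2 : (2 : R) ≠ 0) (h3 : (3 : R) ≠ 0) (h4 : (4 : R) ≠ 0)
    (h5 : (5 : R) ≠ 0) :
    ∃ P : (circulantGraph ({1, 2} : Set R)).Walk 0 3,
      P.IsPath ∧ P.length = 5 ∧ P.support = [0, -2, -1, 1, 2, 3] ∧
      ¬ ClosesToCycle (circulantGraph ({1, 2} : Set R)) P := by
  have adj {u v : R} : (circulantGraph ({1, 2} : Set (R))).Adj u v ↔
      u ≠ v ∧ (u - v = 1 ∨ u - v = 2 ∨ v - u = 1 ∨ v - u = 2) := by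
    simp [circulantGraph_adj, or_assoc]
  have hnd : ([0, -2, -1, 1, 2, 3] : List R).Nodup := by
    simp only [List.nodup_cons, List.mem_cons, List.not_mem_nil, or_false, not_or,
      List.nodup_nil, not_false_eq_true, and_true]
    refine ⟨⟨?_, ?_, ?_, ?_, ?_⟩, ⟨?_, ?_, ?_, ?_⟩, ⟨?_, ?_, ?_⟩, ⟨?_, ?_⟩, ?_⟩ <;> intro h <;>
    first
    | exact h1 (by linear_combination h)
    | exact h1 (by linear_combination -h)
    | exact h2 (by linear_combination h)
    | exact h2 (by linear_combination -h)
    | exact h3 (by linear_combination -h)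
    | exact h4 (by linear_combination -h)
    | exact h5 (by linear_combination -h)
  have hne := hnd
  simp only [List.nodup_cons, List.mem_cons, List.not_mem_nil, or_false, not_or,
    List.nodup_nil, not_false_eq_true, and_true] at hne
  obtain ⟨⟨n02, n01, n0p1, n0p2, -⟩, ⟨n21, n2p1, n2p2, -⟩, ⟨n1p1, n1p2, n1p3⟩,
    ⟨np12, np13⟩, np23⟩ := hne
  have e1 : (circulantGraph ({1, 2} : Set R)).Adj 0 (-2) := adj.mpr ⟨n02, by norm_num⟩
  have e2 : (circulantGraph ({1, 2} : Set R)).Adj (-2) (-1) := adj.mpr ⟨n21, by norm_num⟩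
  have e3 : (circulantGraph ({1, 2} : Set R)).Adj (-1) 1 := adj.mpr ⟨n1p1, by norm_num⟩
  have e4 : (circulantGraph ({1, 2} : Set R)).Adj 1 2 := adj.mpr ⟨np12, by norm_num⟩
  have e5 : (circulantGraph ({1, 2} : Set R)).Adj 2 3 := adj.mpr ⟨np23, by norm_num⟩
  refine ⟨.cons e1 (.cons e2 (.cons e3 (.cons e4 (.cons e5 .nil)))), .mk' hnd, rfl, rfl, ?_⟩
  rintro ⟨w, C, hC, hP⟩
  simp only [Walk.edges_cons, Walk.edges_nil, List.forall_mem_cons] at hP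
  obtain ⟨m1, m2, m3, m4, m5, -⟩ := hP
  obtain ⟨x, hx, mx⟩ := hC.exists_ne_mem_edges m1
  have hcases : x = -1 ∨ x = 1 ∨ x = 2 := by
    rcases (adj.mp (C.adj_of_mem_edges mx)).2 with h | h | h | h
    · exact .inl (by linear_combination -h)
    · exact absurd (by linear_combination -h) hx
    · exact .inr (.inl (by linear_combination h))
    · exact .inr (.inr (by linear_combination h))
  rw [Sym2.eq_swap] at mx
  rcases hcases with rfl | rfl | rfl
  · rcases hC.eq_or_eq_of_mem_edges n2p1 (Sym2.eq_swap ▸ m2) m3 mx with h | h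
    exacts [n02 h, n0p1 h]
  · rcases hC.eq_or_eq_of_mem_edges n1p2 (Sym2.eq_swap ▸ m3) m4 mx with h | h
    exacts [n01 h, n0p2 h]
  · rcases hC.eq_or_eq_of_mem_edges np13 (Sym2.eq_swap ▸ m4) m5 mx with h | h
    exacts [n0p1 h, h3 h.symm]

/-- For every `n ≥ 8`, the circulant graph `Circ(n, {±1, ±2})` is
vertex-transitive and the sequence `(0, n-2, n-1, 1, 2, 3)` is a path of length 5 in it that
does not close to any cycle. -/
theorem circulant_vertexTransitive_and_exists_path_length_five_not_closing
    (n : ℕ) (hn : 8 ≤ n) :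
    VertexTransitive (circulantGraph ({1, 2} : Set (ZMod n))) ∧
    ∃ P : (circulantGraph ({1, 2} : Set (ZMod n))).Walk 0 3,
      P.IsPath ∧ P.length = 5 ∧
      P.support = [0, (n : ZMod n) - 2, (n : ZMod n) - 1, 1, 2, 3] ∧
      ¬ ClosesToCycle (circulantGraph ({1, 2} : Set (ZMod n))) P := by
  refine ⟨vertexTransitive_circulantGraph _, ?_⟩
  have h1 : (1 : ZMod n) ≠ 0 := by
    exact_mod_cast ZMod.natCast_ne_zero_of_pos_of_lt (k := 1) (by omega) (by omega)
  have h2 : (2 : ZMod n) ≠ 0 := by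
    exact_mod_cast ZMod.natCast_ne_zero_of_pos_of_lt (k := 2) (by omega) (by omega)
  have h3 : (3 : ZMod n) ≠ 0 := by
    exact_mod_cast ZMod.natCast_ne_zero_of_pos_of_lt (k := 3) (by omega) (by omega)
  have h4 : (4 : ZMod n) ≠ 0 := by
    exact_mod_cast ZMod.natCast_ne_zero_of_pos_of_lt (k := 4) (by omega) (by omega)
  have h5 : (5 : ZMod n) ≠ 0 := by
    exact_mod_cast ZMod.natCast_ne_zero_of_pos_of_lt (k := 5) (by omega) (by omega)
  simp only [ZMod.natCast_self, zero_sub]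
  exact exists_path_not_closesToCycle_circulantGraph_one_two h1 h2 h3 h4 h5
end

section
/- For every integer n ≥ 3, the sequence (v_{12}, v_1, v_{21}, v_2, v_{23}) is a path of length 4 in the graph K_n^⋄ that does not close to any cycle. -/
open SimpleGraph

/-- The graph `K_n^⋄` obtained from the complete graph on `{v_1, …, v_n}` by replacing each
edge with a 4-cycle: its vertices are the `v_i` (encoded `Sum.inl i`) together with the
vertices `v_{ij}` for ordered pairs `i ≠ j` (encoded `Sum.inr ⟨(i, j), _⟩`), and the edges are
exactly the pairs `{v_i, v_{ij}}` and `{v_j, v_{ij}}` for distinct `i, j`. -/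
def diamondComplete (n : ℕ) :
    SimpleGraph (Fin n ⊕ {p : Fin n × Fin n // p.1 ≠ p.2}) :=
  SimpleGraph.fromRel (fun a b =>
    ∃ (i : Fin n) (p : {p : Fin n × Fin n // p.1 ≠ p.2}),
      a = Sum.inl i ∧ b = Sum.inr p ∧ (i = p.1.1 ∨ i = p.1.2))

namespace SimpleGraph.Walk.IsCycle

variable {V : Type*} {G : SimpleGraph V} {w : V} {C : G.Walk w w}

/-- A cycle through a vertex with at most two neighbours uses the edges to both of them. -/
theorem mem_edges_of_neighborSet_subset (hC : C.IsCycle) {a x y : V}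
    (ha : ∀ z, G.Adj a z → z = x ∨ z = y) (hx : s(a, x) ∈ C.edges) : s(a, y) ∈ C.edges := by
  have hcard := hC.ncard_neighborSet_toSubgraph_eq_two (C.fst_mem_support_of_mem_edges hx)
  by_contra hy
  have hsub : C.toSubgraph.neighborSet a ⊆ {x} := by
    intro z hz
    have hadj : C.toSubgraph.Adj a z := hz
    rcases ha z hadj.adj_sub with rfl | rfl
    · rfl
    · exact absurd (C.adj_toSubgraph_iff_mem_edges.mp hadj) hy
  have hle := Set.ncard_le_ncard hsub
  rw [hcard, Set.ncard_singleton] at hle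
  omega

/-- A cycle does not use three edges at the same vertex. -/
theorem not_three_edges (hC : C.IsCycle) {a x y z : V} (hxy : x ≠ y) (hxz : x ≠ z) (hyz : y ≠ z)
    (hx : s(a, x) ∈ C.edges) (hy : s(a, y) ∈ C.edges) (hz : s(a, z) ∈ C.edges) : False := by
  have hcard := hC.ncard_neighborSet_toSubgraph_eq_two (C.fst_mem_support_of_mem_edges hx)
  have hsub : ({x, y, z} : Set V) ⊆ C.toSubgraph.neighborSet a := by
    rintro t (rfl | rfl | rfl) <;> exact C.adj_toSubgraph_iff_mem_edges.mpr ‹_›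
  have hle := Set.ncard_le_ncard hsub (Set.finite_of_ncard_ne_zero (by omega))
  rw [hcard, Set.ncard_eq_three.mpr ⟨x, y, z, hxy, hxz, hyz, rfl⟩] at hle
  omega

end SimpleGraph.Walk.IsCycle

theorem diamondComplete_adj_inr_iff {n : ℕ} (p : {p : Fin n × Fin n // p.1 ≠ p.2})
    (z : Fin n ⊕ {p : Fin n × Fin n // p.1 ≠ p.2}) :
    (diamondComplete n).Adj (Sum.inr p) z ↔ z = Sum.inl p.1.1 ∨ z = Sum.inl p.1.2 := by
  rcases z with i | q
  · simp only [diamondComplete, fromRel_adj]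
    aesop
  · simp [diamondComplete]

/-- For every `n ≥ 3`, the sequence `(v_{12}, v_1, v_{21}, v_2, v_{23})` is a
path of length 4 in `K_n^⋄` that does not close to any cycle. Here `v_1, v_2, v_3` are encoded
by `Fin n` elements `⟨0,_⟩, ⟨1,_⟩, ⟨2,_⟩`. -/
theorem diamondComplete_path_length_four_not_closesToCycle (n : ℕ) (hn : 3 ≤ n) :
    ∃ P : (diamondComplete n).Walk
        (Sum.inr ⟨((⟨0, by omega⟩ : Fin n), (⟨1, by omega⟩ : Fin n)),
          by simp [Fin.ext_iff]⟩)
        (Sum.inr ⟨((⟨1, by omega⟩ : Fin n), (⟨2, by omega⟩ : Fin n)),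
          by simp [Fin.ext_iff]⟩),
      P.IsPath ∧ P.length = 4 ∧
      P.support =
        [Sum.inr ⟨((⟨0, by omega⟩ : Fin n), (⟨1, by omega⟩ : Fin n)), by simp [Fin.ext_iff]⟩,
         Sum.inl (⟨0, by omega⟩ : Fin n),
         Sum.inr ⟨((⟨1, by omega⟩ : Fin n), (⟨0, by omega⟩ : Fin n)), by simp [Fin.ext_iff]⟩,
         Sum.inl (⟨1, by omega⟩ : Fin n),
         Sum.inr ⟨((⟨1, by omega⟩ : Fin n), (⟨2, by omega⟩ : Fin n)), by simp [Fin.ext_iff]⟩] ∧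
      ¬ ClosesToCycle (diamondComplete n) P := by
  have h₁ := diamondComplete_adj_inr_iff (n := n)
    ⟨(⟨0, by omega⟩, ⟨1, by omega⟩), by simp [Fin.ext_iff]⟩
  have h₂ := diamondComplete_adj_inr_iff (n := n)
    ⟨(⟨1, by omega⟩, ⟨0, by omega⟩), by simp [Fin.ext_iff]⟩
  have h₃ := diamondComplete_adj_inr_iff (n := n)
    ⟨(⟨1, by omega⟩, ⟨2, by omega⟩), by simp [Fin.ext_iff]⟩
  refine ⟨.cons ((h₁ _).mpr (.inl rfl)) (.cons ((h₂ _).mpr (.inr rfl)).symm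
    (.cons ((h₂ _).mpr (.inl rfl)) (.cons ((h₃ _).mpr (.inl rfl)).symm .nil))), ?_, rfl, rfl, ?_⟩
  · simp [Walk.isPath_def]
  · rintro ⟨w, C, hC, hP⟩
    simp only [Walk.edges_cons, Walk.edges_nil, List.forall_mem_cons] at hP
    obtain ⟨e₁, -, e₃, e₄, -⟩ := hP
    have e := hC.mem_edges_of_neighborSet_subset (fun z => (h₁ z).mp) e₁
    refine hC.not_three_edges ?_ ?_ ?_ (Sym2.eq_swap ▸ e) (Sym2.eq_swap ▸ e₃) e₄ <;> simp
end

section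
/- Let G be a finite connected edge-transitive simple graph with minimum degree δ(G) at least 2. Then every path in G of length at most δ(G) closes to a cycle. -/
open SimpleGraph

namespace SimpleGraph

open Finset Classical

variable {V : Type*} [Fintype V] (G : SimpleGraph V)

/-- The vertices outside `A` that are adjacent to some vertex of `A`. -/
noncomputable def vertexBoundary (A : Finset V) : Finset V :=
  {x | x ∉ A ∧ ∃ a ∈ A, G.Adj a x}

/-- The vertices that are neither in `A` nor adjacent to `A`. -/
noncomputable def vertexExterior (A : Finset V) : Finset V :=
  (A ∪ G.vertexBoundary A)ᶜ

variable {G}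

lemma mem_vertexBoundary {A : Finset V} {x : V} :
    x ∈ G.vertexBoundary A ↔ x ∉ A ∧ ∃ a ∈ A, G.Adj a x := by
  simp [vertexBoundary]

lemma mem_vertexExterior {A : Finset V} {x : V} :
    x ∈ G.vertexExterior A ↔ x ∉ A ∧ ∀ a ∈ A, ¬ G.Adj a x := by
  simp only [vertexExterior, mem_compl, mem_union, mem_vertexBoundary]
  grind

variable (G) in
/-- `A` is separated from a nonempty set of vertices by its boundary. -/
def IsSeparated (A : Finset V) : Prop :=
  A.Nonempty ∧ (G.vertexExterior A).Nonempty

variable (G) in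
/-- A smallest separated set among those with the smallest boundary. -/
structure IsAtom (A : Finset V) : Prop where
  separated : G.IsSeparated A
  card_boundary_le : ∀ B, G.IsSeparated B → #(G.vertexBoundary A) ≤ #(G.vertexBoundary B)
  card_le : ∀ B, G.IsSeparated B → #(G.vertexBoundary B) = #(G.vertexBoundary A) → #A ≤ #B

lemma IsSeparated.exists_isAtom {A : Finset V} (hA : G.IsSeparated A) :
    ∃ B, G.IsAtom B := by
  obtain ⟨B, hB, hBmin⟩ := exists_min_image (univ.filter G.IsSeparated)
    (fun B ↦ #(G.vertexBoundary B)) ⟨A, by simpa using hA⟩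
  obtain ⟨C, hC, hCmin⟩ := exists_min_image
    (univ.filter fun C ↦ G.IsSeparated C ∧ #(G.vertexBoundary C) = #(G.vertexBoundary B))
    (fun C ↦ #C) ⟨B, by simpa using hB⟩
  simp only [mem_filter, mem_univ, true_and] at hB hBmin hC hCmin
  exact ⟨C, hC.1, fun D hD ↦ hC.2 ▸ hBmin D hD, fun D hD h ↦ hCmin D ⟨hD, h.trans hC.2⟩⟩

lemma IsSeparated.exterior {A : Finset V} (hA : G.IsSeparated A) :
    G.IsSeparated (G.vertexExterior A) := by
  refine ⟨hA.2, hA.1.mono fun x hx ↦ ?_⟩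
  simp only [mem_vertexExterior]
  exact ⟨fun h ↦ h.1 hx, fun a ha hadj ↦ ha.2 x hx hadj.symm⟩

lemma vertexBoundary_exterior_subset (A : Finset V) :
    G.vertexBoundary (G.vertexExterior A) ⊆ G.vertexBoundary A := by
  intro x hx
  simp only [mem_vertexBoundary, mem_vertexExterior] at hx ⊢
  obtain ⟨hx, a, ha, hadj⟩ := hx
  have : x ∉ A := fun h ↦ ha.2 x h hadj.symm
  grind

lemma IsAtom.card_le_card_exterior {A : Finset V} (hA : G.IsAtom A) :
    #A ≤ #(G.vertexExterior A) :=
  hA.card_le _ hA.separated.exterior <|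
    (card_le_card (vertexBoundary_exterior_subset A)).antisymm
      (hA.card_boundary_le _ hA.separated.exterior)

lemma card_vertexBoundary_inter_add_le (A B : Finset V) :
    #(G.vertexBoundary (A ∩ B)) + #(G.vertexExterior A ∩ G.vertexBoundary B) ≤
      #(G.vertexBoundary B) + #(G.vertexBoundary A ∩ B) := by
  have hsub : G.vertexBoundary (A ∩ B) ⊆
      (G.vertexBoundary B \ G.vertexExterior A) ∪ (G.vertexBoundary A ∩ B) := by
    intro x hx
    simp only [mem_union, mem_sdiff, mem_inter, mem_vertexBoundary, mem_vertexExterior] at hx ⊢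
    grind
  have h := (card_le_card hsub).trans (card_union_le _ _)
  have h' := card_sdiff_add_card_inter (G.vertexBoundary B) (G.vertexExterior A)
  rw [inter_comm] at h'
  omega

lemma card_vertexBoundary_union_add_le (A B : Finset V) :
    #(G.vertexBoundary (A ∪ B)) + #(G.vertexBoundary A ∩ B) ≤
      #(G.vertexBoundary A) + #(G.vertexExterior A ∩ G.vertexBoundary B) := by
  have hsub : G.vertexBoundary (A ∪ B) ⊆
      (G.vertexBoundary A \ B) ∪ (G.vertexExterior A ∩ G.vertexBoundary B) := by
    intro x hx
    simp only [mem_union, mem_sdiff, mem_inter, mem_vertexBoundary, mem_vertexExterior] at hx ⊢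
    grind
  have h := (card_le_card hsub).trans (card_union_le _ _)
  have h' := card_sdiff_add_card_inter (G.vertexBoundary A) B
  omega

lemma card_exterior_le_of_disjoint {A B : Finset V}
    (h : Disjoint (G.vertexExterior A) (G.vertexExterior B)) :
    #(G.vertexExterior A) ≤
      #(G.vertexExterior A ∩ B) + #(G.vertexExterior A ∩ G.vertexBoundary B) := by
  refine (card_le_card fun x hx ↦ ?_).trans (card_union_le _ _)
  have := Finset.disjoint_left.mp h hx
  simp only [mem_vertexExterior, mem_union, mem_inter, mem_vertexBoundary] at *
  grind

lemma card_inter_add_card_boundary_inter_add_card_exterior_inter (A B : Finset V) :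
    #(A ∩ B) + #(G.vertexBoundary A ∩ B) + #(G.vertexExterior A ∩ B) = #B := by
  rw [← card_union_of_disjoint (s := A ∩ B), ← card_union_of_disjoint]
  · congr 1
    ext x
    simp only [mem_vertexExterior, mem_union, mem_inter, mem_vertexBoundary]
    grind
  all_goals
    rw [Finset.disjoint_left]
    intro x
    simp only [mem_vertexExterior, mem_union, mem_inter, mem_vertexBoundary]
    grind

/-- Two atoms that meet are equal. -/
lemma IsAtom.eq_of_inter_nonempty {A B : Finset V} (hA : G.IsAtom A) (hB : G.IsAtom B)
    (hAB : (A ∩ B).Nonempty) : A = B := by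
  have hbd : #(G.vertexBoundary A) = #(G.vertexBoundary B) :=
    (hA.card_boundary_le B hB.separated).antisymm (hB.card_boundary_le A hA.separated)
  have hcard : #A = #B :=
    (hA.card_le B hB.separated hbd.symm).antisymm (hB.card_le A hA.separated hbd)
  by_contra hne
  have hlt : #(A ∩ B) < #A := by
    refine card_lt_card (inter_subset_left.ssubset_of_ne fun h ↦ hne ?_)
    exact eq_of_subset_of_card_le (inter_eq_left.mp h) hcard.ge
  have hsep : G.IsSeparated (A ∩ B) := by
    refine ⟨hAB, hA.separated.2.mono fun x hx ↦ ?_⟩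
    simp only [mem_vertexExterior, mem_inter] at hx ⊢
    grind
  have hgt : #(G.vertexBoundary A) < #(G.vertexBoundary (A ∩ B)) :=
    (hA.card_boundary_le _ hsep).lt_of_ne fun h ↦ (hA.card_le _ hsep h.symm).not_gt hlt
  have hinter := card_vertexBoundary_inter_add_le (G := G) A B
  by_cases hdisj : Disjoint (G.vertexExterior A) (G.vertexExterior B)
  · have h₁ := card_exterior_le_of_disjoint hdisj
    have h₂ := card_inter_add_card_boundary_inter_add_card_exterior_inter (G := G) A B
    have h₃ := hA.card_le_card_exterior
    have h₄ := hAB.card_pos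
    omega
  · obtain ⟨x, hxA, hxB⟩ := not_disjoint_iff.mp hdisj
    have hsep' : G.IsSeparated (A ∪ B) := by
      refine ⟨hA.separated.1.mono subset_union_left, x, ?_⟩
      simp only [mem_vertexExterior, mem_union] at hxA hxB ⊢
      grind
    have h₁ := hA.card_boundary_le _ hsep'
    have h₂ := card_vertexBoundary_union_add_le (G := G) A B
    omega

lemma vertexBoundary_map (φ : G ≃g G) (A : Finset V) :
    G.vertexBoundary (A.map φ.toEquiv.toEmbedding) =
      (G.vertexBoundary A).map φ.toEquiv.toEmbedding := by
  ext x
  obtain ⟨y, rfl⟩ := φ.surjective x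
  have hmem (B : Finset V) (z : V) : φ z ∈ B.map φ.toEquiv.toEmbedding ↔ z ∈ B :=
    mem_map' φ.toEquiv.toEmbedding
  rw [hmem, mem_vertexBoundary, mem_vertexBoundary, φ.surjective.exists]
  simp only [hmem, φ.map_adj_iff]

lemma vertexExterior_map (φ : G ≃g G) (A : Finset V) :
    G.vertexExterior (A.map φ.toEquiv.toEmbedding) =
      (G.vertexExterior A).map φ.toEquiv.toEmbedding := by
  ext x
  obtain ⟨y, rfl⟩ := φ.surjective x
  have hmem (B : Finset V) (z : V) : φ z ∈ B.map φ.toEquiv.toEmbedding ↔ z ∈ B :=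
    mem_map' φ.toEquiv.toEmbedding
  rw [hmem, mem_vertexExterior, mem_vertexExterior, φ.surjective.forall]
  simp only [hmem, φ.map_adj_iff]

lemma IsAtom.map {A : Finset V} (hA : G.IsAtom A) (φ : G ≃g G) :
    G.IsAtom (A.map φ.toEquiv.toEmbedding) where
  separated := by
    simpa [IsSeparated, vertexExterior_map] using hA.separated
  card_boundary_le := by
    simpa [vertexBoundary_map] using hA.card_boundary_le
  card_le := by
    simpa [vertexBoundary_map] using hA.card_le

lemma Connected.vertexBoundary_nonempty (hG : G.Connected) {A : Finset V}
    (hA : G.IsSeparated A) : (G.vertexBoundary A).Nonempty := by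
  obtain ⟨⟨a, ha⟩, b, hb⟩ := hA
  obtain ⟨p⟩ := hG.preconnected a b
  obtain ⟨d, -, hd₁, hd₂⟩ := p.exists_boundary_dart (A : Set V) ha
    (by simpa using (mem_vertexExterior.mp hb).1)
  exact ⟨d.snd, mem_vertexBoundary.mpr ⟨hd₂, d.fst, hd₁, d.adj⟩⟩

/-- The vertex connectivity of a connected edge-transitive graph is at least its minimum degree. -/
theorem _root_.EdgeTransitive.minDegree_le_card_vertexBoundary [DecidableRel G.Adj]
    (het : EdgeTransitive G) (hG : G.Connected) {A : Finset V} (hA : G.IsSeparated A) :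
    G.minDegree ≤ #(G.vertexBoundary A) := by
  obtain ⟨B, hB⟩ := hA.exists_isAtom
  refine le_trans ?_ (hB.card_boundary_le A hA)
  by_contra! hlt
  obtain ⟨b, hb⟩ := hB.separated.1
  obtain ⟨c, hbc, hc⟩ : ∃ c, G.Adj b c ∧ c ∈ B := by
    by_contra! h
    refine hlt.not_ge ((G.minDegree_le_degree b).trans ?_)
    rw [← card_neighborFinset_eq_degree]
    refine card_le_card fun c hc ↦ ?_
    rw [mem_neighborFinset] at hc
    exact mem_vertexBoundary.mpr ⟨h c hc, b, hb, hc⟩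
  obtain ⟨x, hx⟩ := hG.vertexBoundary_nonempty hB.separated
  obtain ⟨hxB, a, ha, hax⟩ := mem_vertexBoundary.mp hx
  obtain ⟨φ, hφ⟩ := het s(b, c) hbc s(a, x) hax
  have hmem : ∀ y ∈ s(a, x), y ∈ B.map φ.toEquiv.toEmbedding := by
    intro y hy
    rw [← hφ, Sym2.mem_map] at hy
    obtain ⟨z, hz, rfl⟩ := hy
    have hzB : z ∈ B := by
      rcases Sym2.mem_iff.mp hz with rfl | rfl <;> assumption
    exact mem_map_of_mem φ.toEquiv.toEmbedding hzB
  have heq := hB.eq_of_inter_nonempty (hB.map φ) ⟨a, mem_inter.mpr ⟨ha, hmem a (by simp)⟩⟩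
  exact hxB (heq ▸ hmem x (by simp))

/-- In a connected edge-transitive graph, deleting fewer than `δ(G)` vertices does not disconnect
any two of the remaining ones. -/
theorem _root_.EdgeTransitive.exists_isPath_avoiding [DecidableRel G.Adj]
    (het : EdgeTransitive G) (hG : G.Connected) {S : Finset V} (hS : #S < G.minDegree)
    {u v : V} (hu : u ∉ S) (hv : v ∉ S) :
    ∃ R : G.Walk u v, R.IsPath ∧ ∀ y ∈ R.support, y ∉ S := by
  suffices h : ∃ R : G.Walk u v, ∀ y ∈ R.support, y ∉ S by
    obtain ⟨R, hR⟩ := h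
    exact ⟨R.bypass, R.bypass_isPath, fun y hy ↦ hR y (R.support_bypass_subset_support hy)⟩
  by_contra hno
  let A : Finset V := {x | ∃ R : G.Walk u x, ∀ y ∈ R.support, y ∉ S}
  have hbd : G.vertexBoundary A ⊆ S := by
    intro x hx
    by_contra hxS
    obtain ⟨hxA, a, ha, hadj⟩ := mem_vertexBoundary.mp hx
    simp only [A, mem_filter, mem_univ, true_and] at hxA ha
    obtain ⟨R, hR⟩ := ha
    refine hxA ⟨R.concat hadj, fun y hy ↦ ?_⟩
    rw [Walk.support_concat, List.mem_append, List.mem_singleton] at hy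
    rcases hy with hy | rfl
    exacts [hR y hy, hxS]
  have hA : G.IsSeparated A := by
    refine ⟨⟨u, ?_⟩, v, ?_⟩
    · simp only [A, mem_filter, mem_univ, true_and]
      exact ⟨Walk.nil, by simpa using hu⟩
    · simp only [vertexExterior, mem_compl, mem_union, not_or]
      exact ⟨by simpa [A] using hno, fun h ↦ hv (hbd h)⟩
  exact hS.not_ge ((het.minDegree_le_card_vertexBoundary hG hA).trans (card_le_card hbd))

lemma Connected.exists_isCycle_of_two_le_minDegree [DecidableRel G.Adj] (hG : G.Connected)
    (hδ : 2 ≤ G.minDegree) : ∃ (w : V) (C : G.Walk w w), C.IsCycle := by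
  by_contra! h
  have hT : G.IsTree := ⟨hG, fun w C hC ↦ h w C hC⟩
  obtain ⟨w⟩ := hG.nonempty
  have hw : 0 < G.degree w := by have := G.minDegree_le_degree w; omega
  obtain ⟨x, hx⟩ := (G.degree_pos_iff_exists_adj w).mp hw
  have : Nontrivial V := ⟨w, x, hx.ne⟩
  have := hT.minDegree_eq_one_of_nontrivial
  omega

end SimpleGraph

lemma EdgeTransitive.exists_isCycle_mem_edges {V : Type*} {G : SimpleGraph V} (het : EdgeTransitive G) {w : V}
    {C : G.Walk w w} (hC : C.IsCycle) {e : Sym2 V} (he : e ∈ G.edgeSet) :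
    ∃ (x : V) (D : G.Walk x x), D.IsCycle ∧ e ∈ D.edges := by
  obtain ⟨f, hf⟩ := List.exists_mem_of_ne_nil C.edges (by simpa using hC.ne_nil)
  obtain ⟨φ, rfl⟩ := het f (C.edges_subset_edgeSet hf) e he
  refine ⟨_, C.map φ.toHom, hC.map φ.injective, ?_⟩
  rw [Walk.edges_map]
  exact List.mem_map_of_mem hf

/-- In a finite connected edge-transitive graph with minimum degree `δ(G) ≥ 2`,
every path of length at most `δ(G)` closes to a cycle. -/
theorem edgeTransitive_path_length_le_minDegree_closesToCycle
    {V : Type*} [Fintype V] (G : SimpleGraph V) [DecidableRel G.Adj]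
    (hconn : G.Connected) (het : EdgeTransitive G) (hδ : 2 ≤ G.minDegree)
    {u v : V} (P : G.Walk u v) (hP : P.IsPath) (hlen : P.length ≤ G.minDegree) :
    ClosesToCycle G P := by
  classical
  obtain ⟨w, C, hC⟩ := hconn.exists_isCycle_of_two_le_minDegree hδ
  cases P with
  | nil => exact ⟨w, C, hC, by simp⟩
  | cons h Q =>
    cases hQ : Q with
    | nil =>
      obtain ⟨x, D, hD, hmem⟩ :=
        het.exists_isCycle_mem_edges hC ((G.mem_edgeSet).mpr h)
      exact ⟨x, D, hD, by simpa using hmem⟩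
    | cons h' Q' =>
      rw [← hQ]
      have hQlen : 1 ≤ Q.length := by simp [hQ]
      have hPath := (Walk.cons_isPath_iff h Q).mp hP
      have hcard : (Q.support.toFinset.erase v).card < G.minDegree := by
        rw [Finset.card_erase_of_mem (by simp),
          List.toFinset_card_of_nodup hPath.1.support_nodup, Walk.length_support]
        rw [Walk.length_cons] at hlen
        omega
      obtain ⟨R, hR, hRS⟩ := het.exists_isPath_avoiding hconn hcard
        (u := v) (v := u) (by simp) (by simp [hPath.2])
      refine ⟨u, (Walk.cons h Q).append R, hP.isCycle_append hR ?_ ?_, ?_⟩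
      · intro y hyQ hyR
        rw [Walk.support_cons, List.tail_cons] at hyQ
        have hyv : y ≠ v := by
          rintro rfl
          have := hR.support_nodup
          rw [← Walk.cons_tail_support R] at this
          exact (List.nodup_cons.mp this).1 hyR
        exact hRS y (List.mem_of_mem_tail hyR) (by simp [hyv, hyQ])
      · left
        rw [Walk.length_cons]
        omega
      · intro e he
        rw [Walk.edges_append]
        exact List.mem_append_left _ he
end

section
/- Let G be a finite simple graph and let C' be an induced cycle of length at least 4 in the line graph L(G). Then the vertices of C' taken in cyclic order, which are edges of G, form the edge sequence of a cycle in G; in particular, there is a cycle C in G whose edge set is exactly the vertex set of C'. -/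
open SimpleGraph

namespace SimpleGraph

/-- A sequence of consecutively adjacent vertices, pairwise distinct up to index `k`, traces out
a path. -/
lemma exists_isPath_of_seq {V : Type*} {G : SimpleGraph V} {v : ℕ → V}
    (hadj : ∀ i, G.Adj (v i) (v (i + 1))) (k : ℕ) (hinj : Set.InjOn v (Set.Iic k)) :
    ∃ p : G.Walk (v 0) (v k), p.IsPath ∧ (∀ x, x ∈ p.support ↔ ∃ i ≤ k, v i = x) ∧
      ∀ f, f ∈ p.edges ↔ ∃ i < k, s(v i, v (i + 1)) = f := by
  induction k with
  | zero => exact ⟨Walk.nil, by simp, by simp [eq_comm], by simp⟩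
  | succ k ih =>
    obtain ⟨p, hp, hs, he⟩ := ih (hinj.mono (Set.Iic_subset_Iic.2 k.le_succ))
    refine ⟨p.concat (hadj k), hp.concat ?_ _, fun x => ?_, fun f => ?_⟩
    · rw [hs]
      rintro ⟨i, hi, h⟩
      have := hinj (Set.mem_Iic.2 (by lia)) (Set.mem_Iic.2 le_rfl) h
      lia
    · simp only [Walk.support_concat, List.mem_append, List.mem_singleton,
        hs, Nat.le_succ_iff, or_and_right, exists_or, exists_eq_left, eq_comm]
    · simp only [Walk.edges_concat, List.concat_eq_append, List.mem_append, List.mem_singleton,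
        he, Nat.lt_succ_iff_lt_or_eq, or_and_right, exists_or, exists_eq_left, eq_comm (a := f)]

/-- A closed sequence of `n ≥ 3` consecutively adjacent, pairwise distinct vertices traces out
a cycle. -/
lemma exists_isCycle_of_seq {V : Type*} {G : SimpleGraph V} {v : ℕ → V} {n : ℕ} (hn : 3 ≤ n)
    (hadj : ∀ i, G.Adj (v i) (v (i + 1))) (hper : v n = v 0) (hinj : Set.InjOn v (Set.Iio n)) :
    ∃ (w : V) (C : G.Walk w w), C.IsCycle ∧
      ∀ f, f ∈ C.edges ↔ ∃ i < n, s(v i, v (i + 1)) = f := by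
  obtain ⟨k, rfl⟩ : ∃ k, n = k + 1 := ⟨n - 1, by lia⟩
  obtain ⟨p, hp, -, he⟩ := exists_isPath_of_seq hadj k
    (hinj.mono fun i hi => Set.mem_Iio.2 (Nat.lt_succ_of_le hi))
  have hk : G.Adj (v k) (v 0) := hper ▸ hadj k
  refine ⟨_, Walk.cons hk p, (Walk.cons_isCycle_iff p hk).2 ⟨hp, ?_⟩, fun f => ?_⟩
  · rw [he]
    rintro ⟨i, hi, h⟩
    have key : ∀ {a b}, a ≤ k → b ≤ k → v a = v b → a = b := fun ha hb h =>
      hinj (Set.mem_Iio.2 (by lia)) (Set.mem_Iio.2 (by lia)) h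
    rcases Sym2.eq_iff.1 h with ⟨h₁, -⟩ | ⟨h₁, h₂⟩
    · have := key (by lia) le_rfl h₁
      lia
    · have := key (by lia) (by lia) h₁
      have := key (by lia) le_rfl h₂
      lia
  · simp only [Walk.edges_cons, List.mem_cons, he, Nat.lt_succ_iff_lt_or_eq, or_and_right,
      exists_or, exists_eq_left, hper, eq_comm (a := f), or_comm]

/-- An edge sequence of period `n ≥ 4` in which distinct edges meet exactly when they are
cyclically consecutive is the edge sequence of a cycle. -/
lemma exists_isCycle_of_edge_seq {V : Type*} {G : SimpleGraph V} {n : ℕ} (hn : 4 ≤ n)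
    {f : ℕ → Sym2 V} (hf : ∀ i, f i ∈ G.edgeSet) (hmod : ∀ i, f (i % n) = f i)
    (hmeet : ∀ i, ∃ x, x ∈ f i ∧ x ∈ f (i + 1))
    (hcons : ∀ i j x, x ∈ f i → x ∈ f j →
      i ≡ j [MOD n] ∨ i + 1 ≡ j [MOD n] ∨ i ≡ j + 1 [MOD n]) :
    ∃ (w : V) (C : G.Walk w w), C.IsCycle ∧ ∀ e, e ∈ C.edges ↔ ∃ i, f i = e := by
  choose u hu hu' using hmeet
  let v i := u (i % n)
  have hv i : v i ∈ f i := hmod i ▸ hu _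
  have hv' i : v i ∈ f (i + 1) := by
    have := hu' (i % n)
    rwa [← hmod, Nat.mod_add_mod, hmod] at this
  have hne i : v i ≠ v (i + 1) := by
    intro h
    have key := hcons i (i + 2) (v i) (hv i) (h ▸ hv' (i + 1))
    have not_dvd (d : ℕ) (h₀ : 0 < d) (h₃ : d < 4) : ¬ n ∣ d := fun hd => by
      have := Nat.le_of_dvd h₀ hd
      lia
    rcases key with h | h | h <;> rw [Nat.modEq_iff_dvd' (by lia)] at h
    · exact not_dvd _ (by lia) (by lia) h
    · exact not_dvd _ (by lia) (by lia) h
    · exact not_dvd _ (by lia) (by lia) h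
  have hvmod {i j : ℕ} (h : i ≡ j [MOD n]) : v i = v j := congrArg u h
  have hedge i : s(v i, v (i + 1)) = f (i + 1) :=
    ((Sym2.mem_and_mem_iff (hne i)).1 ⟨hv' i, hv (i + 1)⟩).symm
  have hinj {i j : ℕ} (h : v i = v j) : i ≡ j [MOD n] := by
    rcases hcons i j (v i) (hv i) (h ▸ hv j) with h' | h' | h'
    · exact h'
    · exact absurd (h.trans (hvmod h').symm) (hne i)
    · exact absurd (h.symm.trans (hvmod h')) (hne j)
  obtain ⟨w, C, hC, he⟩ := exists_isCycle_of_seq (G := G) (v := v) (n := n) (by lia)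
    (fun i => by
      rw [← mem_edgeSet, hedge]
      exact hf _)
    (hvmod (by simp [Nat.ModEq]))
    (fun i hi j hj h => (hinj h).eq_of_lt_of_lt hi hj)
  refine ⟨w, C, hC, fun e => ?_⟩
  simp only [he, hedge]
  constructor
  · rintro ⟨i, -, h⟩
    exact ⟨_, h⟩
  · rintro ⟨i, rfl⟩
    refine ⟨(i + (n - 1)) % n, Nat.mod_lt _ (by lia), ?_⟩
    rw [← hmod, Nat.mod_add_mod, show i + (n - 1) + 1 = i + n by lia, Nat.add_mod_right, hmod]

end SimpleGraph

/-- If `C'` is an induced cycle of length at least 4 in the line graph `L(G)`,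
then its vertices (which are edges of `G`) form the edge sequence of a cycle in `G`; in
particular there is a cycle `C` in `G` whose edge set is exactly the vertex set of `C'`. -/
theorem inducedCycle_in_lineGraph_gives_cycle
    {V : Type*} [Fintype V] (G : SimpleGraph V) {e : G.edgeSet}
    (C' : G.lineGraph.Walk e e) (hC' : C'.IsCycle)
    (hind : InducedWalk G.lineGraph C') (hlen : 4 ≤ C'.length) :
    ∃ (w : V) (C : G.Walk w w), C.IsCycle ∧
      ∀ f : Sym2 V, f ∈ C.edges ↔ ∃ x ∈ C'.support, (x : Sym2 V) = f := by
  set n := C'.length with hn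
  have hlt i : i % n < n := Nat.mod_lt _ (by lia)
  have hsucc i : C'.getVert (i % n + 1) = C'.getVert ((i + 1) % n) := by
    rw [← Nat.mod_add_mod]
    rcases Nat.lt_or_eq_of_le (Nat.succ_le_of_lt (hlt i)) with h | h
    · rw [Nat.mod_eq_of_lt h]
    · rw [show i % n + 1 = n from h, Nat.mod_self, hn, Walk.getVert_length, Walk.getVert_zero]
  have hinj {i j : ℕ} (h : C'.getVert (i % n) = C'.getVert (j % n)) : i ≡ j [MOD n] :=
    hC'.getVert_injOn' (Nat.le_sub_one_of_lt (hlt i)) (Nat.le_sub_one_of_lt (hlt j)) h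
  obtain ⟨w, C, hC, he⟩ := exists_isCycle_of_edge_seq (G := G) (n := n)
    (f := fun i => (C'.getVert (i % n) : Sym2 V)) hlen (fun i => (C'.getVert (i % n)).2)
    (fun i => by simp)
    (fun i => by
      have := C'.adj_getVert_succ (hlt i)
      rw [hsucc] at this
      exact (lineGraph_adj_iff_exists.1 this).2)
    (fun i j x hi hj => by
      by_cases hij : C'.getVert (i % n) = C'.getVert (j % n)
      · exact .inl (hinj hij)
      have hmem := hind _ (C'.getVert_mem_support (i % n)) _ (C'.getVert_mem_support (j % n))
        (lineGraph_adj_iff_exists.2 ⟨hij, x, hi, hj⟩)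
      obtain ⟨k, hk, hs⟩ := C'.mk_mem_edges_iff_exists.1 hmem
      rw [← Nat.mod_eq_of_lt hk, hsucc] at hs
      rcases Sym2.eq_iff.1 hs with ⟨h₁, h₂⟩ | ⟨h₁, h₂⟩
      · exact .inr (.inl (((hinj h₁).symm.add_right 1).trans (hinj h₂)))
      · exact .inr (.inr ((hinj h₂).symm.trans ((hinj h₁).add_right 1))))
  refine ⟨w, C, hC, fun f => ?_⟩
  rw [he]
  constructor
  · rintro ⟨i, rfl⟩
    exact ⟨_, C'.getVert_mem_support _, rfl⟩
  · rintro ⟨x, hx, rfl⟩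
    obtain ⟨i, rfl, hi⟩ := Walk.mem_support_iff_exists_getVert.1 hx
    rcases Nat.lt_or_eq_of_le hi with h | h
    · exact ⟨i, by rw [Nat.mod_eq_of_lt h]⟩
    · exact ⟨0, by rw [Nat.zero_mod, h, Walk.getVert_length, Walk.getVert_zero]⟩
end
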